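/- Let G be a simple 3-regular, 3-connected graph such that removing any 6 edges does not disconnect G into 4 or more components. Then |G| is 6-arc connected. -/

import Mathlib

open Topology

noncomputable section

variable {V : Type*}

open Classical in
/-- The Dirac function marking a vertex: the point of `|G|` corresponding to vertex `v`. -/
noncomputable def vertexPoint (v : V) : V → ℝ := fun u => if u = v then 1 else 0

open Classical in
/-- The point of `|G|` lying on the edge `vw` at parameter `t` (measured from `v` towards `w`). -/
noncomputable def edgePoint (v w : V) (t : ℝ) : V → ℝ :=
  fun u => (if u = v then 1 - t else 0) + (if u = w then t else 0)

/-- The geometric realization `|G|` of a simple graph `G`, realized as the set of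
formal convex combinations of adjacent pairs of vertices; each closed edge carries
its usual topology as a copy of `[0,1]`. -/
def GraphRealization (G : SimpleGraph V) : Set (V → ℝ) :=
  {x | (∃ v, x = vertexPoint v) ∨
    ∃ v w t, G.Adj v w ∧ t ∈ Set.Icc (0 : ℝ) 1 ∧ x = edgePoint v w t}

/-- A subset of a topological space is an arc if it is homeomorphic to `[0,1]`. -/
def IsArc {X : Type*} [TopologicalSpace X] (A : Set X) : Prop :=
  Nonempty (↥A ≃ₜ ↥unitInterval)

/-- A space is `n`-arc connected if any at most `n` points lie on a common arc. -/
def NArcConn (X : Type*) [TopologicalSpace X] (n : ℕ) : Prop :=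
  ∀ S : Finset X, S.card ≤ n → ∃ A : Set X, IsArc A ∧ ↑S ⊆ A

/-- The unit circle in the plane. -/
def unitCircleSet : Set (ℝ × ℝ) := {p | p.1 ^ 2 + p.2 ^ 2 = 1}

/-- A subset of a topological space is a simple closed curve if homeomorphic to the circle. -/
def IsSimpleClosedCurve {X : Type*} [TopologicalSpace X] (C : Set X) : Prop :=
  Nonempty (↥C ≃ₜ ↥unitCircleSet)

/-- A space is `n`-circle connected if any at most `n` points lie on a common
simple closed curve. -/
def NCircleConn (X : Type*) [TopologicalSpace X] (n : ℕ) : Prop :=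
  ∀ S : Finset X, S.card ≤ n → ∃ C : Set X, IsSimpleClosedCurve C ∧ ↑S ⊆ C

/-- A space is `n`-strongly arc connected if any list of at most `n` points is contained
in an arc, the points appearing along the arc in the listed order. -/
def NStrongArcConn (X : Type*) [TopologicalSpace X] (n : ℕ) : Prop :=
  ∀ l : List X, l.length ≤ n →
    ∃ f : ↥unitInterval → X, Topology.IsEmbedding f ∧
      ∃ t : Fin l.length → ↥unitInterval, Monotone t ∧ ∀ i, f (t i) = l.get i

/-- A graph is `k`-connected if removing fewer than `k` vertices leaves it connected. -/
def KConnected (G : SimpleGraph V) (k : ℕ) : Prop :=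
  ∀ S : Set V, S.encard < (k : ℕ∞) → (G.induce (Sᶜ : Set V)).Connected

/-- A graph is cyclically connected if any two vertices lie on a common cycle. -/
def CyclicallyConnected (G : SimpleGraph V) : Prop :=
  ∀ v w : V, ∃ (u : V) (c : G.Walk u u), c.IsCycle ∧ v ∈ c.support ∧ w ∈ c.support

/-- The circle of radius `r` centered at `c` in the plane. -/
def circleAt (c : ℝ × ℝ) (r : ℝ) : Set (ℝ × ℝ) :=
  {p | (p.1 - c.1) ^ 2 + (p.2 - c.2) ^ 2 = r ^ 2}

/-- The horizontal segment at height `y` from abscissa `a` to `b`. -/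
def hSeg (y a b : ℝ) : Set (ℝ × ℝ) := {p | p.2 = y ∧ a ≤ p.1 ∧ p.1 ≤ b}

/-- The θ-curve: unit circle together with horizontal diameter. -/
def thetaSet : Set (ℝ × ℝ) := circleAt (0, 0) 1 ∪ hSeg 0 (-1) 1

/-- Figure-eight: two unit circles meeting at the origin. -/
def figureEightSet : Set (ℝ × ℝ) := circleAt (-1, 0) 1 ∪ circleAt (1, 0) 1

/-- Lollipop: unit circle with the segment from `(1,0)` to `(2,0)` attached. -/
def lollipopSet : Set (ℝ × ℝ) := circleAt (0, 0) 1 ∪ hSeg 0 1 2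

/-- Lollipop with its free endpoint removed. -/
def openLollipopSet : Set (ℝ × ℝ) := lollipopSet \ {(2, 0)}

/-- Dumbbell: two disjoint unit circles joined by a segment. -/
def dumbbellSet : Set (ℝ × ℝ) := circleAt (-2, 0) 1 ∪ circleAt (2, 0) 1 ∪ hSeg 0 (-1) 1

/-- Happy-face curve: two circles meeting at a point, joined by a further arc. -/
def happyFaceSet : Set (ℝ × ℝ) :=
  circleAt (-1, 0) 1 ∪ circleAt (1, 0) 1 ∪ {p | p.1 ^ 2 + p.2 ^ 2 = 4 ∧ p.2 ≤ 0}

/-- Baguette curve: two disjoint circles joined by two disjoint arcs. -/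
def baguetteSet : Set (ℝ × ℝ) :=
  circleAt (-3, 0) 1 ∪ circleAt (3, 0) 1 ∪ hSeg 0 (-2) 2 ∪ hSeg 1 (-3) 3

/-- A graph is a basic 4-ac graph iff its realization is homeomorphic to a circle,
a θ-curve, a happy-face curve or a baguette curve (this captures precisely the
subdivisions of those four graphs). -/
def IsBasicFourAC {W : Type*} (H : SimpleGraph W) : Prop :=
  Nonempty (↥(GraphRealization H) ≃ₜ ↥unitCircleSet) ∨
  Nonempty (↥(GraphRealization H) ≃ₜ ↥thetaSet) ∨
  Nonempty (↥(GraphRealization H) ≃ₜ ↥happyFaceSet) ∨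
  Nonempty (↥(GraphRealization H) ≃ₜ ↥baguetteSet)

/-- A chain-graph decomposition of the connected graph `G`: links indexed by an
interval `J` of `ℤ`, non-consecutive links are disjoint, consecutive links share
exactly one vertex. -/
structure IsChainGraph (G : SimpleGraph V) (J : Set ℤ) (L : ℤ → G.Subgraph) : Prop where
  connected : G.Connected
  ordConnected : J.OrdConnected
  nonempty : J.Nonempty
  cover : (⨆ i ∈ J, L i) = (⊤ : G.Subgraph)
  sep : ∀ i ∈ J, ∀ j ∈ J, i + 1 < j → (L i).verts ∩ (L j).verts = ∅
  link : ∀ i ∈ J, i + 1 ∈ J → ∃ v, (L i).verts ∩ (L (i + 1)).verts = {v}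

/-- A cut-vertex: a vertex whose removal disconnects the graph. -/
def IsCutVertex (G : SimpleGraph V) (v : V) : Prop :=
  ¬ (G.induce ({v}ᶜ : Set V)).Connected

/-- A block: a maximal 2-connected subgraph. -/
def IsBlock (G : SimpleGraph V) (H : G.Subgraph) : Prop :=
  KConnected H.coe 2 ∧ ∀ H' : G.Subgraph, H ≤ H' → KConnected H'.coe 2 → H' = H

/-- The block graph of `G`: the bipartite graph on cut-vertices and blocks, a cut-vertex
being adjacent to the blocks containing it. -/
def BlockGraph (G : SimpleGraph V) :
    SimpleGraph ({v : V // IsCutVertex G v} ⊕ {H : G.Subgraph // IsBlock G H}) :=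
  SimpleGraph.fromRel fun a b =>
    ∃ (c : {v : V // IsCutVertex G v}) (B : {H : G.Subgraph // IsBlock G H}),
      a = Sum.inl c ∧ b = Sum.inr B ∧ (c : V) ∈ (B : G.Subgraph).verts

/-- An `A`–`B` path: a path starting in `A`, ending in `B` and meeting `A ∪ B` only
in these two endvertices. -/
structure ABPath (G : SimpleGraph V) (A B : Set V) where
  first : V
  last : V
  walk : G.Walk first last
  isPath : walk.IsPath
  firstA : first ∈ A
  lastB : last ∈ B
  meetA : ∀ v ∈ walk.support, v ∈ A → v = first
  meetB : ∀ v ∈ walk.support, v ∈ B → v = last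

/-- A family of pairwise vertex-disjoint paths. -/
def PathFamilyDisjoint {G : SimpleGraph V} {A B : Set V} {k : ℕ}
    (P : Fin k → ABPath G A B) : Prop :=
  ∀ i j, i ≠ j → ∀ v, v ∈ (P i).walk.support → v ∉ (P j).walk.support

/-- The set of vertices used by a family of paths. -/
def familySupport {G : SimpleGraph V} {A B : Set V} {k : ℕ}
    (P : Fin k → ABPath G A B) : Set V :=
  {v | ∃ i, v ∈ (P i).walk.support}

/-- The set of edges used by a family of paths. -/
def familyEdges {G : SimpleGraph V} {A B : Set V} {k : ℕ}
    (P : Fin k → ABPath G A B) : Set (Sym2 V) :=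
  {e | ∃ i, e ∈ (P i).walk.edges}

/-- A walk `W` (with no repeated edges) is alternating with respect to the disjoint
path family `P`: it starts in `A` off the paths; repeated vertices lie on paths of the
family; upon hitting a path by a new edge it follows that path backwards for at least
one edge; and it traverses edges of paths of the family only backwards. -/
structure IsAlternatingWalk {G : SimpleGraph V} {A B : Set V} {k : ℕ}
    (P : Fin k → ABPath G A B) {x y : V} (W : G.Walk x y) : Prop where
  trail : W.IsTrail
  startA : x ∈ A
  startOff : x ∉ familySupport P
  repeats : ∀ v, List.Duplicate v W.support → v ∈ familySupport P
  follows : ∀ (i : ℕ) (hi : i < W.darts.length) (j : Fin k),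
      (W.darts.get ⟨i, hi⟩).snd ∈ (P j).walk.support →
      (W.darts.get ⟨i, hi⟩).edge ∉ (P j).walk.edges →
      ∃ h : i + 1 < W.darts.length, (W.darts.get ⟨i + 1, h⟩).symm ∈ (P j).walk.darts
  backward : ∀ d ∈ W.darts, ∀ j : Fin k,
      d.edge ∈ (P j).walk.edges → d.symm ∈ (P j).walk.darts

end

/-- A finite multigraph on `0, …, nodes - 1`; the nodes below `marks` are the marked ones. -/
structure Skeleton where
  marks : ℕ
  nodes : ℕ
  edges : List (ℕ × ℕ)

namespace Skeleton

def incident (v : ℕ) (e : ℕ × ℕ) : Bool := e.1.beq v || e.2.beq v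

def valence (E : List (ℕ × ℕ)) (v : ℕ) : ℕ := E.countP (incident v)

/-- Marked nodes have at most two neighbours, all other nodes at most three. -/
def capacity (k v : ℕ) : ℕ := bif v.blt k then 2 else 3

def distinct : List ℕ → Bool
  | [] => true
  | a :: l => l.all (fun b => !a.beq b) && distinct l

/-- The adjacency matrix of a graph on `0, …, 31`, as a single number. -/
def packed : List (ℕ × ℕ) → ℕ
  | [] => 0
  | e :: E => ((packed E).lor (Nat.shiftLeft 1 ((Nat.mul 32 e.1).add e.2))).lor
      (Nat.shiftLeft 1 ((Nat.mul 32 e.2).add e.1))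

/-- Follow the path coded by the base 32 digits of `code`, starting at `v`;
`seen` collects the nodes visited. -/
def follow (adj full : ℕ) : ℕ → ℕ → ℕ → ℕ → Bool
  | 0, _, _, _ => false
  | fuel + 1, seen, v, code =>
    ((seen.shiftRight v).land 1).beq 0 &&
      (((seen.lor (Nat.shiftLeft 1 v)).land full).beq full ||
        (((adj.shiftRight ((Nat.mul 32 v).add (code.land 31))).land 1).beq 1 &&
          follow adj full fuel (seen.lor (Nat.shiftLeft 1 v)) (code.land 31) (code.shiftRight 5)))

/-- Does `code` describe a path of `s` that visits all marked nodes? -/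
def isTraversal (s : Skeleton) (code : ℕ) : Bool :=
  s.nodes.ble 32 && (code.land 31).blt s.nodes &&
    follow (packed s.edges) ((Nat.shiftLeft 1 s.marks).sub 1) 32 0 (code.land 31)
      (code.shiftRight 5)

def extract (a b : ℕ) : List (ℕ × ℕ) → Option (List (ℕ × ℕ))
  | [] => none
  | e :: E => bif (e.1.beq a && e.2.beq b) || (e.1.beq b && e.2.beq a) then some E
    else (extract a b E).map (e :: ·)

def hasImage (σ : ℕ → ℕ) : List (ℕ × ℕ) → List (ℕ × ℕ) → Bool
  | [], _ => true
  | e :: T, E =>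
    match extract (σ e.1) (σ e.2) E with
    | none => false
    | some E' => hasImage σ T E'

def digit (c i : ℕ) : ℕ := (c.shiftRight (Nat.mul 5 i)).land 31

/-- Do the base 32 digits of `c` embed `t` into `s`? -/
def embeds (t s : Skeleton) (c : ℕ) : Bool :=
  t.marks.beq s.marks && distinct ((List.range t.nodes).map (digit c)) &&
    (List.range t.nodes).all (fun i =>
      (digit c i).blt s.nodes && ((digit c i).blt s.marks == i.blt t.marks)) &&
    (List.range s.marks).all (fun j => (List.range s.marks).any (fun i => (digit c i).beq j)) &&
    hasImage (digit c) t.edges s.edges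

/-- The ways to remove an element from a list, up to permutation. -/
def picks : List (ℕ × ℕ) → List ((ℕ × ℕ) × List (ℕ × ℕ))
  | [] => []
  | e :: E =>
    let L := (picks E).map fun p => (p.1, e :: p.2)
    bif E.any (fun f => f.1.beq e.1 && f.2.beq e.2) then L else (e, E) :: L

/-- The ways to make a point of a skeleton with edges `F ++ G` a node, where the point is one of
the nodes in `N` or lies on an edge of `F`. A result lists the new number of nodes, the new edges
and the node. -/
def attach (k n : ℕ) (N : List ℕ) (F G : List (ℕ × ℕ)) : List (ℕ × List (ℕ × ℕ) × ℕ) :=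
  (N.filter fun v => (valence (F ++ G) v).blt (capacity k v)).map (fun v => (n, F ++ G, v)) ++
    (picks F).map fun p => (n + 1, (p.1.1, n) :: (n, p.1.2) :: (p.2 ++ G), n)

inductive Move
  | leaf (t : ℕ)
  | ear
  | cut (mask : ℕ)

def leafOk (s : Skeleton) (t : ℕ) : Bool :=
  t.blt s.marks && (valence s.edges t).blt 2 && Nat.blt 1 s.nodes

def leafChildren (s : Skeleton) (t : ℕ) : List Skeleton :=
  (attach s.marks s.nodes ((List.range s.nodes).filter fun v => !v.beq t) s.edges []).map
    fun r => ⟨s.marks, r.1, (t, r.2.2) :: r.2.1⟩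

def branchEnd (k : ℕ) (e : ℕ × ℕ) : ℕ := bif e.1.blt k then e.2 else e.1

def earOk (s : Skeleton) : Bool :=
  s.marks.beq 6 && Nat.ble 10 s.nodes && s.edges.all (fun e => (e.1.blt 6).xor (e.2.blt 6)) &&
    (List.range s.nodes).all fun v => v.blt 6 || (valence s.edges v).beq 3

def earChildren (s : Skeleton) : List Skeleton :=
  (picks s.edges).flatMap fun p =>
    ((picks p.2).filter fun q => !(branchEnd s.marks p.1).beq (branchEnd s.marks q.1)).map fun q =>
      ⟨s.marks, s.nodes + 2, (s.nodes, s.nodes + 1) ::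
        (q.1.1, s.nodes + 1) :: (s.nodes + 1, q.1.2) ::
        (p.1.1, s.nodes) :: (s.nodes, p.1.2) :: q.2⟩

def crossing (mask : ℕ) : List (ℕ × ℕ) → List (ℕ × ℕ)
  | [] => []
  | e :: E =>
    match mask.testBit e.1, mask.testBit e.2 with
    | true, false => e :: crossing mask E
    | false, true => (e.2, e.1) :: crossing mask E
    | _, _ => crossing mask E

def within (mask : ℕ) (b : Bool) (E : List (ℕ × ℕ)) : List (ℕ × ℕ) :=
  E.filter fun e => (mask.testBit e.1 == b) && (mask.testBit e.2 == b)

def nodesOn (mask : ℕ) (b : Bool) (n : ℕ) : List ℕ :=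
  (List.range n).filter fun v => mask.testBit v == b

def cutOk (s : Skeleton) (mask : ℕ) : Bool :=
  let C := crossing mask s.edges
  let big := fun b m => Nat.ble m ((nodesOn mask b s.nodes).length + (within mask b s.edges).length)
  distinct (C.map Prod.fst) && distinct (C.map Prod.snd) &&
    ((C.length.beq 1 && big true 2 && big false 2) ||
      (C.length.beq 2 && big true 6 && big false 6))

def cutChildren (s : Skeleton) (mask : ℕ) : List Skeleton :=
  let C := crossing mask s.edges
  let xs := C.map Prod.fst
  let ys := C.map Prod.snd
  (attach s.marks s.nodes ((nodesOn mask true s.nodes).filter fun v => !xs.any v.beq)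
      (within mask true s.edges) []).flatMap
    fun r => (attach s.marks r.1 ((nodesOn mask false s.nodes).filter fun v => !ys.any v.beq)
        (within mask false s.edges) r.2.1).flatMap
      fun q => (ys ++ [q.2.2]).permutations'.map fun p =>
        ⟨s.marks, q.1, (xs ++ [r.2.2]).zip p ++ q.2.1⟩

def children (s : Skeleton) : Move → List Skeleton
  | .leaf t => bif leafOk s t then leafChildren s t else [s]
  | .ear => bif earOk s then earChildren s else [s]
  | .cut m => bif cutOk s m then cutChildren s m else [s]

/-- A skeleton, a move, and for each of the resulting skeletons the code of a traversal (twice the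
code plus one) or of an embedding of a later table entry. -/
structure Entry where
  skel : Skeleton
  move : Move
  certs : List ℕ

def checkCert (T : List Entry) (s : Skeleton) (c : ℕ) : Bool :=
  bif (c.land 1).beq 1 then s.isTraversal (c.shiftRight 1)
  else match T[(c.shiftRight 1).land 255]? with
    | some t => embeds t.skel s (c.shiftRight 9)
    | none => false

def checkCerts (T : List Entry) : List Skeleton → List ℕ → Bool
  | [], _ => true
  | _ :: _, [] => false
  | s :: l, c :: cs => checkCert T s c && checkCerts T l cs

def wellFormed (s : Skeleton) : Bool :=
  s.marks.ble s.nodes && s.edges.all fun e => e.1.blt s.nodes && e.2.blt s.nodes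

def checkEntry (e : Entry) (T : List Entry) : Bool :=
  e.skel.wellFormed && checkCerts T (e.skel.children e.move) e.certs

/-- Check the entries of a list that is followed by `T`. -/
def checkEntries : List Entry → List Entry → Bool
  | [], _ => true
  | e :: A, T => checkEntry e (A ++ T) && checkEntries A T

/-- Check `n` entries of `T`, starting with the `i`-th. -/
def checkRange (T : List Entry) (i n : ℕ) : Bool :=
  checkEntries ((T.drop i).take n) (T.drop (i + n))

end Skeleton

namespace List

variable {α β : Type*}

theorem exists_perm_of_map_perm {f : α → β} {l : List α} {L : List β} (h : (l.map f).Perm L) :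
    ∃ l' : List α, l'.Perm l ∧ l'.map f = L := by
  induction L generalizing l with
  | nil => exact ⟨[], by simp_all, rfl⟩
  | cons c L ih =>
    obtain ⟨a, ha, rfl⟩ := List.mem_map.1 (h.mem_iff.2 List.mem_cons_self)
    obtain ⟨s, t, rfl⟩ := List.append_of_mem ha
    have h1 : ((s ++ t).map f).Perm L := by
      rw [← List.perm_cons (f a)]
      refine List.Perm.trans ?_ h
      simp only [List.map_append, List.map_cons]
      exact List.perm_middle.symm
    obtain ⟨l', hl, rfl⟩ := ih h1
    exact ⟨a :: l', (hl.cons a).trans List.perm_middle.symm, rfl⟩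

theorem exists_append_of_not_nodup {l : List α} (h : ¬ l.Nodup) :
    ∃ u z v w, l = u ++ z :: v ++ z :: w := by
  induction l with
  | nil => simp at h
  | cons a l ih =>
    by_cases ha : a ∈ l
    · obtain ⟨s, t, rfl⟩ := List.append_of_mem ha
      exact ⟨[], a, s, t, rfl⟩
    · obtain ⟨u, z, v, w, rfl⟩ := ih fun hl => h (List.nodup_cons.2 ⟨ha, hl⟩)
      exact ⟨a :: u, z, v, w, rfl⟩

/-- Split a list at the last element with a given property. -/
theorem exists_append_cons_of_last {p : α → Prop} {l : List α} (h : ∃ x ∈ l, p x) :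
    ∃ s x t, l = s ++ x :: t ∧ p x ∧ ∀ y ∈ t, ¬ p y := by
  induction l with
  | nil => simp at h
  | cons a l ih =>
    by_cases hl : ∃ x ∈ l, p x
    · obtain ⟨s, x, t, rfl, hx, ht⟩ := ih hl
      exact ⟨a :: s, x, t, rfl, hx, ht⟩
    · push Not at hl
      obtain ⟨x, hx, hp⟩ := h
      rcases List.mem_cons.1 hx with rfl | hx
      · exact ⟨[], x, l, rfl, hp, hl⟩
      · exact absurd hp (hl x hx)

end List

namespace Skeleton

variable {W : Type*}

/-- There is a walk from `a` to `b` avoiding `S`. -/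
def Reach (I : SimpleGraph W) (S : Set W) (a b : W) : Prop :=
  a ∉ S ∧ Relation.ReflTransGen (fun x y => I.Adj x y ∧ y ∉ S) a b

theorem Reach.refl {I : SimpleGraph W} {S : Set W} {a : W} (h : a ∉ S) : Reach I S a a :=
  ⟨h, .refl⟩

theorem Reach.trans {I : SimpleGraph W} {S : Set W} {a b c : W} (h : Reach I S a b)
    (h' : Reach I S b c) : Reach I S a c :=
  ⟨h.1, h.2.trans h'.2⟩

theorem Reach.of_adj {I : SimpleGraph W} {S : Set W} {a b : W} (h : I.Adj a b) (ha : a ∉ S)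
    (hb : b ∉ S) : Reach I S a b :=
  ⟨ha, .single ⟨h, hb⟩⟩

theorem Reach.symm {I : SimpleGraph W} {S : Set W} {a b : W} (h : Reach I S a b) :
    Reach I S b a := by
  obtain ⟨ha, h⟩ := h
  induction h with
  | refl => exact .refl ha
  | @tail b c hb h ih => exact (Reach.of_adj h.1.symm h.2 ih.1).trans ih

/-- A path from `A` to `B` with no inner point in `A ∪ B`. -/
structure IsLink (I : SimpleGraph W) (A B : Set W) (l : List W) : Prop where
  ne_nil : l ≠ []
  chain : l.IsChain I.Adj
  nodup : l.Nodup
  left : ∀ x ∈ l, x ∈ A ↔ l.head? = some x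
  right : ∀ x ∈ l, x ∈ B ↔ l.getLast? = some x

theorem Reach.exists_chain {I : SimpleGraph W} {S : Set W} {a b : W} (h : Reach I S a b) :
    ∃ l : List W, l.IsChain I.Adj ∧ l.head? = some a ∧ l.getLast? = some b ∧ ∀ x ∈ l, x ∉ S := by
  obtain ⟨ha, h⟩ := h
  induction h using Relation.ReflTransGen.head_induction_on with
  | refl => exact ⟨[b], by simp, rfl, rfl, by simpa using ha⟩
  | @head a c hc h ih =>
    obtain ⟨l, h1, h2, h3, h4⟩ := ih hc.2
    refine ⟨a :: l, ?_, rfl, ?_, ?_⟩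
    · rw [List.isChain_cons]
      exact ⟨by simp [h2, hc.1], h1⟩
    · simp [List.getLast?_cons, h3]
    · simpa using ⟨ha, h4⟩

theorem Reach.exists_isLink {I : SimpleGraph W} {S A B : Set W} {a b : W} (h : Reach I S a b)
    (ha : a ∈ A) (hb : b ∈ B) : ∃ l, IsLink I A B l ∧ ∀ x ∈ l, x ∉ S := by
  classical
  have hex : ∃ n, ∃ l : List W, l.length = n ∧ l.IsChain I.Adj ∧ (∃ a ∈ A, l.head? = some a) ∧
      (∃ b ∈ B, l.getLast? = some b) ∧ ∀ x ∈ l, x ∉ S := by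
    obtain ⟨l, h1, h2, h3, h4⟩ := h.exists_chain
    exact ⟨_, l, rfl, h1, ⟨a, ha, h2⟩, ⟨b, hb, h3⟩, h4⟩
  obtain ⟨l, hl, hc, ⟨a', ha', hla⟩, ⟨b', hb', hlb⟩, hS⟩ := Nat.find_spec hex
  have hmin : ∀ l' : List W, l'.length < l.length → l'.IsChain I.Adj →
      (∃ a ∈ A, l'.head? = some a) → (∃ b ∈ B, l'.getLast? = some b) → (∀ x ∈ l', x ∈ l) → False :=
    fun l' h1 h2 h3 h4 h5 => Nat.find_min hex (hl ▸ h1) ⟨l', rfl, h2, h3, h4, fun x hx => hS x (h5 x hx)⟩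
  refine ⟨l, ⟨by rintro rfl; simp at hla, hc, ?_, ?_, ?_⟩, hS⟩
  · by_contra hn
    obtain ⟨u, z, v, w, rfl⟩ := List.exists_append_of_not_nodup hn
    refine hmin (u ++ z :: w) (by simp) ?_ ⟨a', ha', ?_⟩ ⟨b', hb', ?_⟩ ?_
    · rw [List.append_assoc, List.cons_append, List.isChain_split] at hc
      rw [List.isChain_split]
      exact ⟨hc.1, hc.2.suffix ⟨z :: v, by simp⟩⟩
    · rw [← hla]; cases u <;> simp
    · rw [← hlb]; simp [List.getLast?_append, List.getLast?_cons]
    · intro x hx; simp at hx ⊢; tauto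
  · intro x hx
    refine ⟨fun hxA => ?_, fun h => ?_⟩
    · obtain ⟨u, v, rfl⟩ := List.append_of_mem hx
      rcases u with _ | ⟨c, u⟩
      · rfl
      · refine (hmin (x :: v) (by simp) (hc.suffix ⟨_, rfl⟩) ⟨x, hxA, rfl⟩ ⟨b', hb', ?_⟩ ?_).elim
        · rw [← hlb]; simp [List.getLast?_append, List.getLast?_cons]
        · intro y hy; exact List.mem_append_right _ hy
    · rw [hla] at h; exact Option.some.inj h ▸ ha'
  · intro x hx
    refine ⟨fun hxB => ?_, fun h => ?_⟩
    · obtain ⟨u, v, rfl⟩ := List.append_of_mem hx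
      rcases v.eq_nil_or_concat with rfl | ⟨v, c, rfl⟩
      · simp
      · refine (hmin (u ++ [x]) (by simp) (hc.prefix ⟨v ++ [c], by simp⟩) ⟨a', ha', ?_⟩
          ⟨x, hxB, by simp⟩ ?_).elim
        · rw [← hla]; cases u <;> simp
        · intro y hy; simp at hy ⊢; tauto
    · rw [hlb] at h; exact Option.some.inj h ▸ hb'

theorem IsLink.getLast?_suffix {α : Type*} {x : α} {u p : List α} (h : x :: u <:+ p) :
    p.getLast? = (x :: u).getLast? := by
  obtain ⟨t, rfl⟩ := h
  simp [List.getLast?_append, List.getLast?_cons]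

theorem IsLink.notMem_left {I : SimpleGraph W} {A B : Set W} {x : W} {u p : List W}
    (hp : IsLink I A B p) (hs : x :: u <:+ p) {z : W} (hz : z ∈ u) : z ∉ A := by
  intro hzA
  obtain ⟨t, rfl⟩ := hs
  have h := (hp.left z (by simp [hz])).1 hzA
  have hn := hp.nodup
  rcases t with _ | ⟨c, t⟩
  · simp at h hn; exact hn.1 (h ▸ hz)
  · simp at h hn; exact hn.1.2.2 (h ▸ hz)

theorem IsLink.extend {I : SimpleGraph W} {A B B' : Set W} {q u p : List W} {x : W}
    (hq : IsLink I A B' q) (hx : q.getLast? = some x) (hp : IsLink I A B p) (hs : x :: u <:+ p)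
    (hd : q.Disjoint u) (hB : B ⊆ B') : IsLink I A B (q ++ u) := by
  have hlast := IsLink.getLast?_suffix hs
  have hc := hp.chain.suffix hs
  have hn := hp.nodup.sublist hs.sublist
  obtain ⟨q, rfl⟩ := List.getLast?_eq_some_iff.1 hx
  refine ⟨by simp, ?_, ?_, ?_, ?_⟩
  · rw [List.append_assoc, List.singleton_append, List.isChain_split]
    exact ⟨hq.chain, hc⟩
  · exact List.nodup_append'.2 ⟨hq.nodup, (List.nodup_cons.1 hn).2, hd⟩
  · intro z hz
    have hh : (q ++ [x] ++ u).head? = (q ++ [x]).head? := by cases q <;> simp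
    rw [hh]
    rcases List.mem_append.1 hz with hz | hz
    · exact hq.left z hz
    · refine ⟨fun h => (hp.notMem_left hs hz h).elim, fun h => (hd ?_ hz).elim⟩
      exact List.mem_of_head? h
  · intro z hz
    have hh : (q ++ [x] ++ u).getLast? = p.getLast? := by
      rw [hlast]; simp [List.getLast?_append, List.getLast?_cons]
    rw [hh]
    have key : z ∈ x :: u → (z ∈ B ↔ p.getLast? = some z) := fun h =>
      hp.right z (hs.subset h)
    rcases List.mem_append.1 hz with hz' | hz'
    · by_cases hzx : z = x
      · exact key (by simp [hzx])
      · refine ⟨fun h => ?_, fun h => ?_⟩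
        · have := (hq.right z hz').1 (hB h)
          simp at this; exact (hzx this.symm).elim
        · rw [hlast] at h
          have := List.mem_of_getLast? h
          rcases List.mem_cons.1 this with h' | h'
          · exact (hzx h').elim
          · exact (hd hz' h').elim
    · exact key (by simp [hz'])

theorem IsLink.exists_getLast? {I : SimpleGraph W} {A B : Set W} {l : List W}
    (h : IsLink I A B l) : ∃ b ∈ B, l.getLast? = some b := by
  have := List.getLast?_eq_some_getLast h.ne_nil
  exact ⟨_, (h.right _ (List.getLast_mem h.ne_nil)).2 this, this⟩

theorem IsLink.exists_head? {I : SimpleGraph W} {A B : Set W} {l : List W}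
    (h : IsLink I A B l) : ∃ a ∈ A, l.head? = some a := by
  have := List.head?_eq_some_head h.ne_nil
  exact ⟨_, (h.left _ (List.head_mem h.ne_nil)).2 this, this⟩

theorem IsLink.mono_of_last {I : SimpleGraph W} {A B B' : Set W} {q : List W} {y : W}
    (hq : IsLink I A B' q) (hy : q.getLast? = some y) (hyB : y ∈ B) (hB : B ⊆ B') :
    IsLink I A B q := by
  refine ⟨hq.ne_nil, hq.chain, hq.nodup, hq.left, fun z hz => ⟨fun h => (hq.right z hz).1 (hB h), ?_⟩⟩
  intro h
  rw [hy] at h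
  exact Option.some.inj h ▸ hyB

/-- Menger's theorem in augmentation form: a family of disjoint `A`-`B` links that is separated
by no set of at most its own size can be replaced by one with one more link, keeping the old
ends. -/
theorem exists_augmentation {I : SimpleGraph W} {A : Set W} (P : List (List W)) (B : Set W)
    (hP : ∀ p ∈ P, IsLink I A B p) (hd : P.flatten.Nodup)
    (h : ∀ S : List W, S.length ≤ P.length → ∃ a ∈ A, ∃ b ∈ B, Reach I {x | x ∈ S} a b) :
    ∃ (Q : List (List W)) (a b : W), (∀ q ∈ Q, IsLink I A B q) ∧ Q.flatten.Nodup ∧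
      (Q.map List.head?).Perm (some a :: P.map List.head?) ∧
      (Q.map List.getLast?).Perm (some b :: P.map List.getLast?) := by
  induction hn : P.flatten.length using Nat.strong_induction_on generalizing P B with
  | _ n ih =>
  obtain ⟨a, ha, b, hb, hab⟩ := h (P.filterMap List.getLast?) (List.length_filterMap_le ..)
  obtain ⟨R, hR, hRS⟩ := hab.exists_isLink ha hb
  by_cases hRP : ∃ x ∈ R, x ∈ P.flatten
  swap
  · push Not at hRP
    obtain ⟨a', -, ha'⟩ := hR.exists_head?
    obtain ⟨b', -, hb'⟩ := hR.exists_getLast?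
    refine ⟨R :: P, a', b', ?_, ?_, by simp [ha'], by simp [hb']⟩
    · simpa using ⟨hR, hP⟩
    · rw [List.flatten_cons, List.nodup_append']
      exact ⟨hR.nodup, hd, hRP⟩
  obtain ⟨r1, x, r2, rfl, hxP, hr2⟩ := List.exists_append_cons_of_last hRP
  obtain ⟨p, hpP, hxp⟩ := List.mem_flatten.1 hxP
  obtain ⟨P1, P2, rfl⟩ := List.append_of_mem hpP
  obtain ⟨p1, p2, rfl⟩ := List.append_of_mem hxp
  set p := p1 ++ x :: p2 with hp_def
  set R := r1 ++ x :: r2 with hR_def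
  set P0 := P1 ++ P2 with hP0
  have hperm : (P1 ++ p :: P2).Perm (p :: P0) := List.perm_middle
  have hp := hP p hpP
  have hP0l : ∀ q ∈ P0, IsLink I A B q := fun q hq => hP q (by simp [hP0] at hq ⊢; tauto)
  have hd' : (p ++ P0.flatten).Nodup := by
    have := hperm.flatten.nodup_iff.1 hd
    simpa using this
  obtain ⟨hpn, hP0n, hpP0⟩ := List.nodup_append'.1 hd'
  have hr2' : ∀ z ∈ r2, z ∉ p ∧ z ∉ P0.flatten := by
    intro z hz
    have := hr2 z hz
    rw [hperm.flatten.mem_iff, List.flatten_cons, List.mem_append] at this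
    tauto
  have hsp : x :: p2 <:+ p := ⟨p1, rfl⟩
  have hsR : x :: r2 <:+ R := ⟨r1, rfl⟩
  have hxlast : p.getLast? ≠ some x := by
    intro hx
    refine hRS x (by simp [hR_def]) ?_
    exact List.mem_filterMap.2 ⟨p, hpP, hx⟩
  have hxB : x ∉ B := fun h => hxlast ((hp.right x hxp).1 h)
  have hp2 : p2 ≠ [] := by
    rintro rfl
    exact hxlast (by simp [hp_def])
  have hr2n : r2 ≠ [] := by
    rintro rfl
    exact hxB ((hR.right x (by simp [hR_def])).2 (by simp [hR_def]))
  have hpn' : p1.Nodup ∧ (x ∉ p2 ∧ p2.Nodup) ∧ p1.Disjoint (x :: p2) := by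
    have := hpn
    rwa [hp_def, List.nodup_append', List.nodup_cons] at this
  have hRn' : r1.Nodup ∧ (x ∉ r2 ∧ r2.Nodup) ∧ r1.Disjoint (x :: r2) := by
    have := hR.nodup
    rwa [hR_def, List.nodup_append', List.nodup_cons] at this
  set B' : Set W := {z | z ∈ B ∨ z ∈ p2 ∨ z ∈ r2 ∨ z = x} with hB'
  have hBB : B ⊆ B' := fun z hz => Or.inl hz
  have hp' : IsLink I A B' (p1 ++ [x]) := by
    refine ⟨by simp, hp.chain.prefix ⟨p2, by simp [hp_def]⟩, hpn.sublist ?_, ?_, ?_⟩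
    · simp [hp_def]
    · intro z hz
      rw [hp.left z (by simp at hz; simp [hp_def]; tauto), hp_def]
      cases p1 <;> simp
    · intro z hz
      simp only [List.getLast?_append, List.getLast?_singleton, Option.some_or, Option.some.injEq]
      refine ⟨fun hzB => ?_, fun h => h ▸ Or.inr (Or.inr (Or.inr rfl))⟩
      by_contra hne
      have hz1 : z ∈ p1 := by simp at hz; tauto
      rcases hzB with h | h | h | h
      · have := (hp.right z (by simp [hp_def, hz1])).1 h
        rw [IsLink.getLast?_suffix hsp] at this
        exact hpn'.2.2 hz1 (List.mem_of_getLast? this)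
      · exact hpn'.2.2 hz1 (by simp [h])
      · exact (hr2' z h).1 (by simp [hp_def, hz1])
      · exact hne h.symm
  have hP0' : ∀ q ∈ P0, IsLink I A B' q := by
    intro q hq
    have hq' := hP0l q hq
    refine ⟨hq'.ne_nil, hq'.chain, hq'.nodup, hq'.left, fun z hz => ?_⟩
    have hz0 : z ∈ P0.flatten := List.mem_flatten.2 ⟨q, hq, hz⟩
    rw [← hq'.right z hz]
    refine ⟨fun h => ?_, fun h => hBB h⟩
    rcases h with h | h | h | h
    · exact h
    · exact (hpP0 (by simp [hp_def, h]) hz0).elim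
    · exact ((hr2' z h).2 hz0).elim
    · exact (hpP0 (by simp [hp_def, h]) hz0).elim
  obtain ⟨Q', a', y, hQ', hQn, hQh, hQl⟩ := ih ((p1 ++ [x]) :: P0).flatten.length (by
      rw [← hn, hperm.flatten.length_eq]
      have := List.length_pos_iff.2 hp2
      simp [hp_def]; omega) ((p1 ++ [x]) :: P0) B' (by simpa using ⟨hp', hP0'⟩) (by
      rw [List.flatten_cons, List.nodup_append']
      refine ⟨hp'.nodup, hP0n, fun z hz => hpP0 ?_⟩
      simp at hz; simp [hp_def]; tauto) (by
      intro S hS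
      obtain ⟨a, ha, b, hb, hr⟩ := h S (by rw [hperm.length_eq]; simpa using hS)
      exact ⟨a, ha, b, hBB hb, hr⟩) rfl
  have hheads : (Q'.map List.head?).Perm (some a' :: (P1 ++ p :: P2).map List.head?) := by
    refine hQh.trans (List.Perm.cons _ ?_)
    refine List.Perm.trans ?_ (hperm.map _).symm
    have : (p1 ++ [x]).head? = p.head? := by rw [hp_def]; cases p1 <;> simp
    simp [this]
  obtain ⟨Q, hQperm, hQmap⟩ := List.exists_perm_of_map_perm hQl
  obtain ⟨qy, Q1, rfl, hqy, hQ1⟩ := List.map_eq_cons_iff.1 hQmap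
  obtain ⟨qx, Q0, rfl, hqx, hQ0⟩ := List.map_eq_cons_iff.1 hQ1
  replace hqx : qx.getLast? = some x := by simpa using hqx
  have hQ'' : ∀ q ∈ qy :: qx :: Q0, IsLink I A B' q := fun q hq => hQ' q (hQperm.mem_iff.1 hq)
  have hQn' := hQperm.flatten.nodup_iff.2 hQn
  have hly := hQ'' qy (by simp)
  have hlx := hQ'' qx (by simp)
  -- elements of the new family in the augmented target are ends
  have hends : ∀ q ∈ Q0, ∀ z ∈ q, z ∈ B' → z ∈ B ∧ z ∉ p2 ∧ z ∉ r2 := by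
    intro q hq z hz hzB
    have h1 := ((hQ'' q (by simp [hq])).right z hz).1 hzB
    have h2 : q.getLast? ∈ P0.map List.getLast? := hQ0 ▸ List.mem_map_of_mem hq
    obtain ⟨q', hq', hqq⟩ := List.mem_map.1 h2
    rw [h1] at hqq
    have h3 := List.mem_of_getLast? hqq
    have h4 : z ∈ P0.flatten := List.mem_flatten.2 ⟨q', hq', h3⟩
    exact ⟨((hP0l q' hq').right z h3).2 hqq, fun h => hpP0 (by simp [hp_def, h]) h4,
      fun h => (hr2' z h).2 h4⟩
  have hQ0B : ∀ q ∈ Q0, IsLink I A B q := by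
    intro q hq
    have hq' := hQ'' q (by simp [hq])
    obtain ⟨z, hz, hz'⟩ := hq'.exists_getLast?
    exact hq'.mono_of_last hz' (hends q hq z (List.mem_of_getLast? hz') hz).1 hBB
  have hqx' : ∀ z ∈ qx, z ∈ B' → z = x := by
    intro z hz hzB
    have := (hlx.right z hz).1 hzB
    rw [hqx] at this; simpa using this.symm
  have hqy' : ∀ z ∈ qy, z ∈ B' → z = y := by
    intro z hz hzB
    have := (hly.right z hz).1 hzB
    rw [hqy] at this; simpa using this.symm
  have hyq : y ∈ qy := List.mem_of_getLast? hqy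
  have hxq : x ∈ qx := List.mem_of_getLast? hqx
  have hyB' : y ∈ B' := (hly.right y hyq).2 hqy
  have hQn'' : (qy.Nodup ∧ qx.Nodup ∧ Q0.flatten.Nodup) ∧ qy.Disjoint qx ∧
      qy.Disjoint Q0.flatten ∧ qx.Disjoint Q0.flatten := by
    simp only [List.flatten_cons, List.nodup_append', List.disjoint_append_right] at hQn'
    tauto
  obtain ⟨⟨-, -, hn0⟩, hyx, hy0, hx0⟩ := hQn''
  have hyx' : y ≠ x := fun h => hyx hyq (h ▸ hxq)
  have hp2B : ∀ z ∈ p2, z ∈ B' := fun z hz => Or.inr (Or.inl hz)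
  have hr2B : ∀ z ∈ r2, z ∈ B' := fun z hz => Or.inr (Or.inr (Or.inl hz))
  have hQheads : ((qy :: qx :: Q0).map List.head?).Perm
      (some a' :: (P1 ++ p :: P2).map List.head?) := (hQperm.map _).trans hheads
  have hPlast : ((P1 ++ p :: P2).map List.getLast?).Perm (p.getLast? :: Q0.map List.getLast?) := by
    rw [hQ0]; exact hperm.map List.getLast?
  have happ : ∀ q u : List W, q ≠ [] → (q ++ u).head? = q.head? := by
    intro q u hq; cases q <;> simp at hq ⊢
  have hlst : ∀ {q u l : List W} {z : W}, q.getLast? = some z → z :: u <:+ l →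
      (q ++ u).getLast? = l.getLast? := by
    intro q u l z hq hl
    rw [IsLink.getLast?_suffix hl, List.getLast?_append, hq, List.getLast?_cons]
    cases u.getLast? <;> simp
  have h0 : ∀ u : List W, (∀ z ∈ u, z ∈ p2 ∨ z ∈ r2) → u.Disjoint Q0.flatten := by
    intro u hu z hz hz0
    obtain ⟨q, hq, hzq⟩ := List.mem_flatten.1 hz0
    have hzB : z ∈ B' := by rcases hu z hz with h | h; exacts [hp2B z h, hr2B z h]
    obtain ⟨-, h1, h2⟩ := hends q hq z hzq hzB
    rcases hu z hz with h | h
    exacts [h1 h, h2 h]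
  -- the two symmetric cases
  have key : ∀ (l l' u u' : List W), IsLink I A B l → IsLink I A B l' → x :: u <:+ l →
      x :: u' <:+ l' → u.Disjoint u' → (∀ z ∈ u, z ∈ p2 ∨ z ∈ r2) → (∀ z ∈ u', z ∈ p2 ∨ z ∈ r2) →
      x ∉ u → x ∉ u' → u.Nodup → u'.Nodup → y ∈ u →
      ∃ Q : List (List W), (∀ q ∈ Q, IsLink I A B q) ∧ Q.flatten.Nodup ∧
        (Q.map List.head?).Perm (some a' :: (P1 ++ p :: P2).map List.head?) ∧
        (Q.map List.getLast?) = l.getLast? :: l'.getLast? :: Q0.map List.getLast? := by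
    intro l l' u u' hl hl' hs hs' huu hu hu' hxu hxu' hun hun' hyu
    obtain ⟨s1, s2, rfl⟩ := List.append_of_mem hyu
    have hB1 : ∀ z ∈ s1 ++ y :: s2, z ∈ B' := fun z hz => by
      rcases hu z hz with h | h; exacts [hp2B z h, hr2B z h]
    have hB2 : ∀ z ∈ u', z ∈ B' := fun z hz => by
      rcases hu' z hz with h | h; exacts [hp2B z h, hr2B z h]
    have hs2 : y :: s2 <:+ l := List.IsSuffix.trans ⟨x :: s1, by simp⟩ hs
    have hys : y ∉ s2 := by
      have := (List.nodup_append'.1 hun).2.1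
      exact (List.nodup_cons.1 this).1
    have hss : ∀ z ∈ s2, z ∈ s1 ++ y :: s2 := fun z hz => by simp [hz]
    have d1 : qy.Disjoint s2 := fun z hz hz2 => hys (hqy' z hz (hB1 z (hss z hz2)) ▸ hz2)
    have d2 : qx.Disjoint u' := fun z hz hz2 => hxu' (hqx' z hz (hB2 z hz2) ▸ hz2)
    have d3 : qy.Disjoint u' := fun z hz hz2 => huu hyu (hqy' z hz (hB2 z hz2) ▸ hz2)
    have d4 : qx.Disjoint s2 := fun z hz hz2 =>
      hxu (hqx' z hz (hB1 z (hss z hz2)) ▸ hss z hz2)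
    have d5 : s2.Disjoint u' := fun z hz hz2 => huu (hss z hz) hz2
    refine ⟨(qy ++ s2) :: (qx ++ u') :: Q0, ?_, ?_, ?_, ?_⟩
    · simp only [List.mem_cons, forall_eq_or_imp]
      exact ⟨hly.extend hqy hl hs2 d1 hBB, hlx.extend hqx hl' hs' d2 hBB, hQ0B⟩
    · simp only [List.flatten_cons, List.nodup_append', List.disjoint_append_right,
        List.disjoint_append_left]
      exact ⟨⟨hly.nodup, (List.nodup_cons.1 (List.nodup_append'.1 hun).2.1).2, d1⟩,
        ⟨⟨hlx.nodup, hun', d2⟩, hn0, hx0, h0 u' hu'⟩, ⟨⟨hyx, d4.symm⟩, d3, d5⟩, hy0,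
        h0 s2 fun z hz => hu z (hss z hz)⟩
    · simpa [happ _ _ hly.ne_nil, happ _ _ hlx.ne_nil] using hQheads
    · simp [hlst hqy hs2, hlst hqx hs']
  have hpr : p2.Disjoint r2 := fun z hz hz2 => (hr2' z hz2).1 (by simp [hp_def, hz])
  obtain ⟨b', -, hb'⟩ := hR.exists_getLast?
  rcases hyB' with hyB | hyp | hyr | hyx''
  · have d2 : qx.Disjoint p2 := fun z hz hz2 => hpn'.2.1.1 (hqx' z hz (hp2B z hz2) ▸ hz2)
    by_cases hyp : y ∈ p2
    · obtain ⟨Q, h1, h2, h3, h4⟩ := key p R p2 r2 hp hR hsp hsR hpr (by tauto) (by tauto) hpn'.2.1.1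
        hRn'.2.1.1 hpn'.2.1.2 hRn'.2.1.2 hyp
      refine ⟨Q, a', b', h1, h2, h3, ?_⟩
      rw [h4, ← hb']
      exact (List.Perm.swap _ _ _).trans (hPlast.symm.cons _)
    have d3 : qy.Disjoint p2 := fun z hz hz2 => hyp (hqy' z hz (hp2B z hz2) ▸ hz2)
    refine ⟨qy :: (qx ++ p2) :: Q0, a', y, ?_, ?_, ?_, ?_⟩
    · simp only [List.mem_cons, forall_eq_or_imp]
      exact ⟨hly.mono_of_last hqy hyB hBB, hlx.extend hqx hp hsp d2 hBB, hQ0B⟩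
    · simp only [List.flatten_cons, List.nodup_append', List.disjoint_append_right,
        List.disjoint_append_left]
      exact ⟨hly.nodup, ⟨⟨hlx.nodup, hpn'.2.1.2, d2⟩, hn0, hx0, h0 p2 (by tauto)⟩, ⟨hyx, d3⟩, hy0⟩
    · simpa [happ _ _ hlx.ne_nil] using hQheads
    · simp only [List.map_cons, hlst hqx hsp, hqy]
      exact hPlast.symm.cons _
  · obtain ⟨Q, h1, h2, h3, h4⟩ := key p R p2 r2 hp hR hsp hsR hpr (by tauto) (by tauto) hpn'.2.1.1
      hRn'.2.1.1 hpn'.2.1.2 hRn'.2.1.2 hyp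
    refine ⟨Q, a', b', h1, h2, h3, ?_⟩
    rw [h4, ← hb']
    exact (List.Perm.swap _ _ _).trans (hPlast.symm.cons _)
  · obtain ⟨Q, h1, h2, h3, h4⟩ := key R p r2 p2 hR hp hsR hsp hpr.symm (by tauto) (by tauto)
      hRn'.2.1.1 hpn'.2.1.1 hRn'.2.1.2 hpn'.2.1.2 hyr
    refine ⟨Q, a', b', h1, h2, h3, ?_⟩
    rw [h4, ← hb']
    exact hPlast.symm.cons _
  · exact (hyx' hyx'').elim

end Skeleton

namespace Skeleton

variable {W : Type*}

/-- The combinatorial properties of the subdivided graph that the search for paths uses. -/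
structure Net (I : SimpleGraph W) (mk br : W → Prop) : Prop where
  not_br : ∀ x, mk x → ¬ br x
  main_adj : ∀ x y, mk x ∨ br x → mk y ∨ br y → ¬ I.Adj x y
  deg_le_three : ∀ x (l : List W), l.Nodup → (∀ y ∈ l, I.Adj x y) → l.length ≤ 3
  deg_le_two : ∀ x (l : List W), ¬ br x → l.Nodup → (∀ y ∈ l, I.Adj x y) → l.length ≤ 2
  exists_adj : ∀ x, mk x → ∃ y z, y ≠ z ∧ I.Adj x y ∧ I.Adj x z
  conn_one : ∀ S : List W, S.length ≤ 1 → ∀ x y, x ∉ S → y ∉ S → Reach I {z | z ∈ S} x y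
  conn_two : ∀ S : List W, S.length ≤ 2 → ∀ A B : List W, A.Nodup → B.Nodup → 6 ≤ A.length →
    6 ≤ B.length → ∃ a ∈ A, ∃ b ∈ B, Reach I {z | z ∈ S} a b
  four : ∀ M N : List W, M.Nodup → N.Nodup → M.length = 6 → N.length = 4 → (∀ x ∈ M, mk x) →
    (∀ x ∈ N, br x) → ∃ x ∈ N, ∃ y ∈ N, x ≠ y ∧ Reach I {z | z ∈ M} x y

/-- The nodes joined by a segment. -/
def ends (s : ℕ × List W × ℕ) : ℕ × ℕ := (s.1, s.2.2)

/-- The list of points of a segment. -/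
def seg (φ : ℕ → W) (s : ℕ × List W × ℕ) : List W := φ s.1 :: (s.2.1 ++ [φ s.2.2])

/-- The points of a model of a skeleton. -/
def used (n : ℕ) (φ : ℕ → W) (S : List (ℕ × List W × ℕ)) : List W :=
  (List.range n).map φ ++ S.flatMap fun s => s.2.1

/-- A subdivision of a skeleton inside `I`. -/
structure Model (I : SimpleGraph W) (mk br : W → Prop) (s : Skeleton) (φ : ℕ → W)
    (S : List (ℕ × List W × ℕ)) : Prop where
  perm : (S.map ends).Perm s.edges
  marks_le : s.marks ≤ s.nodes
  lt : ∀ e ∈ S, e.1 < s.nodes ∧ e.2.2 < s.nodes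
  chain : ∀ e ∈ S, (seg φ e).IsChain I.Adj
  nodup : (used s.nodes φ S).Nodup
  mark : ∀ i < s.marks, mk (φ i)
  branch : ∀ i, s.marks ≤ i → i < s.nodes → br (φ i)
  ne : ∀ e ∈ S, e.1 ≠ e.2.2

def Good (I : SimpleGraph W) (mk br : W → Prop) (s : Skeleton) : Prop :=
  ∀ φ S, Model I mk br s φ S →
    ∃ l : List W, l.Nodup ∧ l.IsChain I.Adj ∧ ∀ i < s.marks, φ i ∈ l

variable {I : SimpleGraph W} {mk br : W → Prop} {s : Skeleton} {φ : ℕ → W}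
  {S : List (ℕ × List W × ℕ)}

theorem mem_used {n : ℕ} {x : W} :
    x ∈ used n φ S ↔ (∃ i < n, φ i = x) ∨ ∃ e ∈ S, x ∈ e.2.1 := by
  simp [used]

theorem mem_seg {e : ℕ × List W × ℕ} {x : W} :
    x ∈ seg φ e ↔ x = φ e.1 ∨ x ∈ e.2.1 ∨ x = φ e.2.2 := by
  simp [seg]

namespace Model

theorem congr (h : Model I mk br s φ S) {S' : List (ℕ × List W × ℕ)} {E' : List (ℕ × ℕ)}
    (hS : S'.Perm S) (hE : s.edges.Perm E') : Model I mk br ⟨s.marks, s.nodes, E'⟩ φ S' where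
  perm := ((hS.map _).trans h.perm).trans hE
  marks_le := h.marks_le
  lt e he := h.lt e (hS.mem_iff.1 he)
  chain e he := h.chain e (hS.mem_iff.1 he)
  nodup := by
    refine (List.Perm.nodup_iff ?_).2 h.nodup
    exact List.Perm.append_left _ (hS.flatMap_right _)
  mark := h.mark
  branch := h.branch
  ne e he := h.ne e (hS.mem_iff.1 he)

theorem main (h : Model I mk br s φ S) {i : ℕ} (hi : i < s.nodes) : mk (φ i) ∨ br (φ i) := by
  rcases lt_or_ge i s.marks with h' | h'
  exacts [Or.inl (h.mark i h'), Or.inr (h.branch i h' hi)]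

theorem inj (h : Model I mk br s φ S) {i j : ℕ} (hi : i < s.nodes) (hj : j < s.nodes)
    (hij : φ i = φ j) : i = j := by
  have := (List.nodup_append'.1 h.nodup).1
  exact List.inj_on_of_nodup_map this (by simpa) (by simpa) hij

theorem notMem_mid (h : Model I mk br s φ S) {i : ℕ} (hi : i < s.nodes) {e : ℕ × List W × ℕ}
    (he : e ∈ S) : φ i ∉ e.2.1 := by
  intro hm
  exact (List.nodup_append'.1 h.nodup).2.2 (List.mem_map_of_mem (List.mem_range.2 hi))
    (List.mem_flatMap.2 ⟨e, he, hm⟩)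

theorem pairwise (h : Model I mk br s φ S) : S.Pairwise fun e f => e.2.1.Disjoint f.2.1 :=
  (List.nodup_flatMap.1 (List.nodup_append'.1 h.nodup).2.1).2

theorem eq_of_mem (h : Model I mk br s φ S) {e f : ℕ × List W × ℕ} (he : e ∈ S) (hf : f ∈ S)
    {z : W} (hz : z ∈ e.2.1) (hz' : z ∈ f.2.1) : e = f := by
  by_contra hne
  have : Std.Symm fun e f : ℕ × List W × ℕ => e.2.1.Disjoint f.2.1 := ⟨fun _ _ hd => hd.symm⟩
  exact h.pairwise.forall he hf hne hz hz'

theorem mid_nodup (h : Model I mk br s φ S) {e : ℕ × List W × ℕ} (he : e ∈ S) : e.2.1.Nodup :=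
  (List.nodup_flatMap.1 (List.nodup_append'.1 h.nodup).2.1).1 e he

theorem seg_nodup (h : Model I mk br s φ S) {e : ℕ × List W × ℕ} (he : e ∈ S) :
    (seg φ e).Nodup := by
  have h1 := h.notMem_mid (h.lt e he).1 he
  have h2 := h.notMem_mid (h.lt e he).2 he
  have h3 : φ e.1 ≠ φ e.2.2 := fun h' => h.ne e he (h.inj (h.lt e he).1 (h.lt e he).2 h')
  simp only [seg, List.nodup_cons, List.mem_append, List.nodup_append', List.mem_singleton]
  exact ⟨by tauto, h.mid_nodup he, by simp, by simpa using h2⟩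

theorem mid_ne_nil (hN : Net I mk br) (h : Model I mk br s φ S) {e : ℕ × List W × ℕ}
    (he : e ∈ S) : e.2.1 ≠ [] := by
  intro h0
  have hc := h.chain e he
  rw [seg, h0] at hc
  simp at hc
  exact hN.main_adj _ _ (h.main (h.lt e he).1) (h.main (h.lt e he).2) hc

theorem mem_used_of_mem_seg (h : Model I mk br s φ S) {e : ℕ × List W × ℕ} (he : e ∈ S) {x : W}
    (hx : x ∈ seg φ e) : x ∈ used s.nodes φ S := by
  rw [mem_used]
  rcases mem_seg.1 hx with rfl | hx | rfl
  exacts [Or.inl ⟨_, (h.lt e he).1, rfl⟩, Or.inr ⟨e, he, hx⟩, Or.inl ⟨_, (h.lt e he).2, rfl⟩]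

/-- Add segments to a model. -/
theorem add (h : Model I mk br s φ S) {T : List (ℕ × List W × ℕ)} {E : List (ℕ × ℕ)}
    (hT : T.map ends = E) (hlt : ∀ e ∈ T, e.1 < s.nodes ∧ e.2.2 < s.nodes)
    (hne : ∀ e ∈ T, e.1 ≠ e.2.2)
    (hc : ∀ e ∈ T, (seg φ e).IsChain I.Adj) (hn : (T.flatMap fun e => e.2.1).Nodup)
    (hd : ∀ e ∈ T, ∀ x ∈ e.2.1, x ∉ used s.nodes φ S) :
    Model I mk br ⟨s.marks, s.nodes, E ++ s.edges⟩ φ (T ++ S) where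
  perm := by rw [List.map_append, hT]; exact h.perm.append_left _
  marks_le := h.marks_le
  lt e he := (List.mem_append.1 he).elim (hlt e) (h.lt e)
  chain e he := (List.mem_append.1 he).elim (hc e) (h.chain e)
  nodup := by
    have h1 : (used s.nodes φ (T ++ S)).Perm ((T.flatMap fun e => e.2.1) ++ used s.nodes φ S) := by
      simp only [used, List.flatMap_append]
      rw [← List.append_assoc, ← List.append_assoc]
      exact List.perm_append_comm.append_right _
    refine h1.nodup_iff.2 (List.nodup_append'.2 ⟨hn, h.nodup, fun x hx => ?_⟩)
    obtain ⟨e, he, hx⟩ := List.mem_flatMap.1 hx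
    exact hd e he x hx
  mark := h.mark
  branch := h.branch
  ne e he := (List.mem_append.1 he).elim (hne e) (h.ne e)

/-- Restrict a model to some of its segments. -/
theorem sub (h : Model I mk br s φ S) {T : List (ℕ × List W × ℕ)} (hT : T.Sublist S)
    {E : List (ℕ × ℕ)} (hE : T.map ends = E) : Model I mk br ⟨s.marks, s.nodes, E⟩ φ T where
  perm := hE ▸ .refl _
  marks_le := h.marks_le
  lt e he := h.lt e (hT.subset he)
  chain e he := h.chain e (hT.subset he)
  nodup := h.nodup.sublist ((hT.flatMap _).append_left _)
  mark := h.mark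
  branch := h.branch
  ne e he := h.ne e (hT.subset he)

/-- Make an inner point of a segment a node. -/
theorem subdivide {k n a b : ℕ} {E : List (ℕ × ℕ)} {m₁ m₂ : List W} {z : W}
    (h : Model I mk br ⟨k, n, (a, b) :: E⟩ φ ((a, m₁ ++ z :: m₂, b) :: S)) (hz : br z) :
    Model I mk br ⟨k, n + 1, (a, n) :: (n, b) :: E⟩ (Function.update φ n z)
        ((a, m₁, n) :: (n, m₂, b) :: S) ∧
      (used (n + 1) (Function.update φ n z) ((a, m₁, n) :: (n, m₂, b) :: S)).Perm
        (used n φ ((a, m₁ ++ z :: m₂, b) :: S)) ∧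
      (∀ i < n, Function.update φ n z i = φ i) := by
  have hφ : ∀ i < n, Function.update φ n z i = φ i := fun i hi =>
    Function.update_of_ne (by omega) ..
  have hn : Function.update φ n z n = z := Function.update_self ..
  have hab := h.lt _ List.mem_cons_self
  simp only at hab
  have hperm : (used (n + 1) (Function.update φ n z) ((a, m₁, n) :: (n, m₂, b) :: S)).Perm
        (used n φ ((a, m₁ ++ z :: m₂, b) :: S)) := by
    have h1 : (List.range n).map (Function.update φ n z) = (List.range n).map φ :=
      List.map_congr_left fun i hi => hφ i (List.mem_range.1 hi)
    simp only [used, List.range_succ, List.map_append, List.map_cons, List.map_nil, hn, h1,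
      List.flatMap_cons, List.append_assoc]
    refine List.Perm.append_left _ ?_
    simp only [List.cons_append, List.nil_append]
    exact List.perm_middle.symm
  refine ⟨⟨?_, ?_, ?_, ?_, hperm.nodup_iff.2 h.nodup, ?_, ?_, ?_⟩, hperm, hφ⟩
  · have := h.perm
    simp only [List.map_cons, ends, List.perm_cons] at this ⊢
    exact this
  · exact h.marks_le.trans (Nat.le_succ n)
  · intro e he
    simp only [List.mem_cons] at he
    rcases he with rfl | rfl | he
    · exact ⟨by simp; omega, by simp⟩
    · exact ⟨by simp, by simp; omega⟩
    · have := h.lt e (List.mem_cons_of_mem _ he)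
      simp only at this ⊢; omega
  · have hc := h.chain _ List.mem_cons_self
    simp only [seg] at hc
    rw [List.append_assoc, List.cons_append, ← List.cons_append, List.isChain_split] at hc
    intro e he
    simp only [List.mem_cons] at he
    rcases he with rfl | rfl | he
    · simpa only [seg, hn, hφ a hab.1, List.cons_append] using hc.1
    · simpa only [seg, hn, hφ b hab.2] using hc.2
    · have := h.lt e (List.mem_cons_of_mem _ he)
      simp only [seg, hφ _ this.1, hφ _ this.2]
      exact h.chain e (List.mem_cons_of_mem _ he)
  · intro i hi
    have := h.marks_le
    simp only at this hi
    rw [hφ i (by omega)]; exact h.mark i hi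
  · intro i hi hi'
    simp only at hi hi'
    rcases Nat.lt_succ_iff_lt_or_eq.1 hi' with h' | rfl
    · rw [hφ i h']; exact h.branch i hi h'
    · rwa [hn]
  · intro e he
    simp only [List.mem_cons] at he
    rcases he with rfl | rfl | he
    · simp; omega
    · simp; omega
    · exact h.ne e (List.mem_cons_of_mem _ he)

end Model

/-- An inner point of a path with a third neighbour is a branch point. -/
theorem Net.br_of_adj (hN : Net I mk br) {l₁ l₂ : List W} {p z q y : W}
    (hc : (l₁ ++ p :: z :: q :: l₂).IsChain I.Adj) (hn : (l₁ ++ p :: z :: q :: l₂).Nodup)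
    (hy : I.Adj z y) (hyp : y ≠ p) (hyq : y ≠ q) : br z := by
  by_contra hz
  have hc' := hc.suffix (List.suffix_append _ _)
  rw [List.isChain_cons_cons, List.isChain_cons_cons] at hc'
  have hn' := (List.nodup_append'.1 hn).2.1
  have hpq : p ≠ q := by
    rintro rfl
    simp at hn'
  have := hN.deg_le_two z [y, p, q] hz (by simp [hyp, hyq, hpq]) (by
    simp [hy, hc'.1.symm, hc'.2.1])
  simp at this

theorem Net.br_of_mem_mid (hN : Net I mk br) (h : Model I mk br s φ S) {e : ℕ × List W × ℕ}
    (he : e ∈ S) {z y : W} (hz : z ∈ e.2.1) (hy : I.Adj z y) (hye : y ∉ seg φ e) : br z := by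
  obtain ⟨u, v, huv⟩ := List.append_of_mem hz
  have hseg : seg φ e = (φ e.1 :: u) ++ z :: (v ++ [φ e.2.2]) := by simp [seg, huv]
  obtain ⟨u', p, hu⟩ : ∃ u' p, φ e.1 :: u = u' ++ [p] :=
    ⟨_, _, (List.dropLast_append_getLast (by simp)).symm⟩
  obtain ⟨q, v', hv⟩ : ∃ q v', v ++ [φ e.2.2] = q :: v' := by
    cases v <;> simp
  rw [hu, hv, List.append_assoc, List.singleton_append] at hseg
  have hp : y ≠ p := by rintro rfl; simp [hseg] at hye
  have hq : y ≠ q := by rintro rfl; simp [hseg] at hye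
  exact hN.br_of_adj (hseg ▸ h.chain e he) (hseg ▸ h.seg_nodup he) hy hp hq

theorem nodup_map_of_mem_mid {α β : Type*} {S : List α} {f : α → List β} {g : α → β}
    (h : (S.flatMap f).Nodup) (hg : ∀ a ∈ S, g a ∈ f a) : (S.map g).Nodup := by
  induction S with
  | nil => simp
  | cons a S ih =>
    rw [List.flatMap_cons, List.nodup_append'] at h
    rw [List.map_cons, List.nodup_cons]
    refine ⟨fun hm => ?_, ih h.2.1 fun b hb => hg b (List.mem_cons_of_mem _ hb)⟩
    obtain ⟨b, hb, hab⟩ := List.mem_map.1 hm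
    exact h.2.2 (hg a List.mem_cons_self)
      (hab ▸ List.mem_flatMap.2 ⟨b, hb, hg b (List.mem_cons_of_mem _ hb)⟩)

theorem incident_iff {v : ℕ} {e : ℕ × ℕ} : incident v e = true ↔ e.1 = v ∨ e.2 = v := by
  simp [incident]

/-- The neighbours of a node along the segments of a model. -/
theorem Model.exists_neighbours (hN : Net I mk br) (h : Model I mk br s φ S) (v : ℕ) :
    ∃ l : List W, l.Nodup ∧ l.length = valence s.edges v ∧ (∀ y ∈ l, I.Adj (φ v) y) ∧
      ∀ y ∈ l, ∃ e ∈ S, φ v ∈ seg φ e ∧ y ∈ seg φ e := by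
  classical
  let g : ℕ × List W × ℕ → W := fun e =>
    if e.1 = v then (e.2.1.head?).getD (φ v) else (e.2.1.getLast?).getD (φ v)
  have hg : ∀ e ∈ S, g e ∈ e.2.1 := by
    intro e he
    have := Model.mid_ne_nil hN h he
    simp only [g]
    split_ifs
    · rw [List.head?_eq_some_head this]; exact List.head_mem this
    · rw [List.getLast?_eq_some_getLast this]; exact List.getLast_mem this
  refine ⟨(S.filter fun e => incident v (ends e)).map g, ?_, ?_, ?_, ?_⟩
  · refine nodup_map_of_mem_mid (f := fun e => e.2.1) ?_ fun e he => hg e (List.mem_filter.1 he).1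
    exact (List.nodup_append'.1 h.nodup).2.1.sublist (List.filter_sublist.flatMap _)
  · rw [List.length_map, ← List.countP_eq_length_filter, valence, ← h.perm.countP_eq,
      List.countP_map]
    rfl
  · intro y hy
    obtain ⟨e, he, rfl⟩ := List.mem_map.1 hy
    obtain ⟨he, hi⟩ := List.mem_filter.1 he
    have hm := Model.mid_ne_nil hN h he
    have hc := h.chain e he
    simp only [seg] at hc
    simp only [g]
    split_ifs with h1
    · rw [List.head?_eq_some_head hm, ← h1]
      rw [List.isChain_cons] at hc
      exact hc.1 _ (by rw [List.head?_append_of_ne_nil _ hm, List.head?_eq_some_head hm]; rfl)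
    · have h2 : e.2.2 = v := by
        have := incident_iff.1 hi; simp only [ends] at this; tauto
      rw [List.getLast?_eq_some_getLast hm, ← h2]
      rw [← List.cons_append, List.isChain_append] at hc
      refine (hc.2.2 _ ?_ _ rfl).symm
      rw [List.getLast?_cons, List.getLast?_eq_some_getLast hm]; rfl
  · intro y hy
    obtain ⟨e, he, rfl⟩ := List.mem_map.1 hy
    obtain ⟨he, hi⟩ := List.mem_filter.1 he
    refine ⟨e, he, mem_seg.2 ?_, mem_seg.2 (Or.inr (Or.inl (hg e he)))⟩
    have := incident_iff.1 hi; simp only [ends] at this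
    rcases this with h | h
    exacts [Or.inl (by rw [h]), Or.inr (Or.inr (by rw [h]))]

theorem Model.valence_lt (hN : Net I mk br) (h : Model I mk br s φ S) {v : ℕ}
    {y : W} (hy : I.Adj (φ v) y) (hfree : ∀ e ∈ S, φ v ∈ seg φ e → y ∉ seg φ e) :
    valence s.edges v < capacity s.marks v := by
  obtain ⟨l, hl, hlen, hadj, hseg⟩ := h.exists_neighbours hN v
  have hyl : y ∉ l := fun hyl => by
    obtain ⟨e, he, h1, h2⟩ := hseg y hyl
    exact hfree e he h1 h2
  have h1 : (y :: l).Nodup := List.nodup_cons.2 ⟨hyl, hl⟩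
  have h2 : ∀ x ∈ y :: l, I.Adj (φ v) x := by simpa using ⟨hy, hadj⟩
  rw [← hlen, capacity]
  rcases lt_or_ge v s.marks with hvk | hvk
  · have := hN.deg_le_two _ _ (hN.not_br _ (h.mark v hvk)) h1 h2
    have h3 : v.blt s.marks = true := by rwa [Nat.blt_eq]
    simp [h3] at this ⊢
    omega
  · have := hN.deg_le_three _ _ h1 h2
    have h3 : v.blt s.marks = false := by
      rw [← Bool.not_eq_true, Nat.blt_eq]; omega
    simp [h3] at this ⊢
    omega

end Skeleton

namespace Skeleton

variable {W : Type*}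

theorem IsLink.exists_eq_cons {I : SimpleGraph W} {A B : Set W} {l : List W} (h : IsLink I A B l)
    (hd : ∀ x ∈ A, x ∉ B) :
    ∃ x m z, l = x :: (m ++ [z]) ∧ x ∈ A ∧ z ∈ B ∧ ∀ w ∈ m, w ∉ A ∧ w ∉ B := by
  obtain ⟨x, hx, hx'⟩ := h.exists_head?
  obtain ⟨z, hz, hz'⟩ := h.exists_getLast?
  have hn := h.nodup
  obtain ⟨l, rfl⟩ := List.head?_eq_some_iff.1 hx'
  rcases List.eq_nil_or_concat l with rfl | ⟨m, z', rfl⟩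
  · simp only [List.getLast?_singleton, Option.some.injEq] at hz'
    exact absurd hz (hz' ▸ hd x hx)
  · rw [List.concat_eq_append] at *
    have hzz : z' = z := by
      rw [← List.cons_append, List.getLast?_concat] at hz'
      exact Option.some.inj hz'
    subst hzz
    refine ⟨x, m, z', rfl, hx, hz, fun w hw => ⟨fun hA => ?_, fun hB => ?_⟩⟩
    · have := (h.left w (by simp [hw])).1 hA
      simp only [List.head?_cons, Option.some.injEq] at this
      subst this
      simp [hw] at hn
    · have := (h.right w (by simp [hw])).1 hB
      rw [hz', Option.some.injEq] at this
      subst this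
      simp [List.nodup_append', hw] at hn

variable {I : SimpleGraph W} {mk br : W → Prop} {s : Skeleton} {φ : ℕ → W}
  {S : List (ℕ × List W × ℕ)}

theorem exists_mem_picks {F : List (ℕ × ℕ)} {e : ℕ × ℕ} (he : e ∈ F) :
    ∃ p ∈ picks F, p.1 = e ∧ F.Perm (p.1 :: p.2) := by
  induction F with
  | nil => simp at he
  | cons a F ih =>
    by_cases hF : e ∈ F
    · obtain ⟨p, hp, rfl, hperm⟩ := ih hF
      refine ⟨(p.1, a :: p.2), ?_, rfl, (hperm.cons a).trans (.swap ..)⟩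
      have : (p.1, a :: p.2) ∈ (picks F).map fun p => (p.1, a :: p.2) :=
        List.mem_map.2 ⟨p, hp, rfl⟩
      simp only [picks]
      cases F.any fun f => f.1.beq a.1 && f.2.beq a.2
      · exact List.mem_cons_of_mem _ this
      · exact this
    · obtain rfl : e = a := by simpa [hF] using he
      refine ⟨(e, F), ?_, rfl, .refl _⟩
      have : (F.any fun f => f.1.beq e.1 && f.2.beq e.2) = false := by
        rw [← Bool.not_eq_true, List.any_eq_true]
        rintro ⟨f, hf, h⟩
        simp only [Bool.and_eq_true, Nat.beq_eq] at h
        exact hF (Prod.ext h.1 h.2 ▸ hf)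
      simp [picks, this]

theorem seg_congr {φ' : ℕ → W} {n : ℕ} (h : ∀ i < n, φ' i = φ i) {e : ℕ × List W × ℕ}
    (he : e.1 < n ∧ e.2.2 < n) : seg φ' e = seg φ e := by
  rw [seg, seg, h _ he.1, h _ he.2]

/-- Make a point of a model with a free neighbour a node. -/
theorem Model.exists_attach (hN : Net I mk br) {k n : ℕ} {F G : List (ℕ × ℕ)}
    (h : Model I mk br ⟨k, n, F ++ G⟩ φ S) {N : List ℕ} {z y : W}
    (hz : (∃ v ∈ N, φ v = z) ∨ ∃ e ∈ S, ends e ∈ F ∧ z ∈ e.2.1) (hlt : ∀ v ∈ N, v < n)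
    (hy : I.Adj z y) (hfree : ∀ e ∈ S, z ∈ seg φ e → y ∉ seg φ e) :
    ∃ r ∈ attach k n N F G, ∃ φ' S', Model I mk br ⟨k, r.1, r.2.1⟩ φ' S' ∧ φ' r.2.2 = z ∧
      r.2.2 < r.1 ∧ n ≤ r.1 ∧ (∀ i < n, φ' i = φ i) ∧ (used r.1 φ' S').Perm (used n φ S) ∧
      ∀ e' ∈ S', ∃ e ∈ S, seg φ' e' ⊆ seg φ e := by
  rcases hz with ⟨v, hv, rfl⟩ | ⟨e, he, heF, hz⟩
  · refine ⟨(n, F ++ G, v), ?_, φ, S, h, rfl, hlt v hv, le_rfl, fun _ _ => rfl, .refl _,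
      fun e he => ⟨e, he, List.Subset.refl _⟩⟩
    have := h.valence_lt hN hy hfree
    refine List.mem_append_left _ (List.mem_map.2 ⟨v, List.mem_filter.2 ⟨hv, ?_⟩, rfl⟩)
    rwa [Nat.blt_eq]
  · have hbr := hN.br_of_mem_mid h he hz hy (hfree e he (mem_seg.2 (Or.inr (Or.inl hz))))
    obtain ⟨p, hp, hpe, hperm⟩ := exists_mem_picks heF
    obtain ⟨S₁, S₂, rfl⟩ := List.append_of_mem he
    obtain ⟨a, m, b⟩ := e
    obtain ⟨m₁, m₂, rfl⟩ := List.append_of_mem hz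
    have hS : ((a, m₁ ++ z :: m₂, b) :: (S₁ ++ S₂)).Perm (S₁ ++ (a, m₁ ++ z :: m₂, b) :: S₂) :=
      List.perm_middle.symm
    have h1 : Model I mk br ⟨k, n, (a, b) :: (p.2 ++ G)⟩ φ _ := h.congr hS (by
      have := hperm.append_right G
      rw [hpe] at this
      exact this)
    obtain ⟨h2, h3, h4⟩ := h1.subdivide hbr
    refine ⟨_, List.mem_append_right _ (List.mem_map.2 ⟨p, hp, rfl⟩),
      Function.update φ n z, (a, m₁, n) :: (n, m₂, b) :: (S₁ ++ S₂), ?_, ?_, ?_, ?_, h4, ?_, ?_⟩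
    · rw [hpe]; exact h2
    · simp
    · simp
    · simp
    · exact h3.trans (List.Perm.append_left _ (hS.flatMap_right _))
    · have hab := h1.lt _ List.mem_cons_self
      simp only at hab
      intro e' he'
      simp only [List.mem_cons] at he'
      rcases he' with rfl | rfl | he'
      · refine ⟨_, he, fun x => ?_⟩
        simp only [mem_seg, h4 a hab.1, Function.update_self, List.mem_append, List.mem_cons]
        tauto
      · refine ⟨_, he, fun x => ?_⟩
        simp only [mem_seg, h4 b hab.2, Function.update_self, List.mem_append, List.mem_cons]
        tauto
      · refine ⟨e', hS.subset (List.mem_cons_of_mem _ he'), ?_⟩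
        rw [seg_congr h4 (h1.lt e' (List.mem_cons_of_mem _ he'))]
        exact List.Subset.refl _

theorem Net.head?_of_adj (hN : Net I mk br) {x w a : W} {m : List W}
    (hc : (x :: (m ++ [w])).IsChain I.Adj) (hn : (x :: (m ++ [w])).Nodup) (ha : a ∈ m)
    (hxa : I.Adj x a) (hbr : ¬ br a) : m.head? = some a := by
  obtain ⟨u, v, rfl⟩ := List.append_of_mem ha
  rcases List.eq_nil_or_concat u with rfl | ⟨u, p, rfl⟩
  · simp
  · obtain ⟨q, v', hv⟩ : ∃ q v', v ++ [w] = q :: v' := by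
      cases v <;> simp
    have he : x :: (u.concat p ++ a :: v ++ [w]) = (x :: u) ++ p :: a :: q :: v' := by
      simp [← hv]
    rw [he] at hc hn
    rw [List.cons_append, List.nodup_cons] at hn
    refine absurd (hN.br_of_adj hc (List.nodup_cons.2 hn) hxa.symm ?_ ?_) hbr
    · rintro rfl; simp at hn
    · rintro rfl; simp at hn

theorem Model.exists_unused (hN : Net I mk br) (h : Model I mk br s φ S) {t : ℕ} (ht : t < s.marks)
    (hv : valence s.edges t < 2) : ∃ y, I.Adj (φ t) y ∧ y ∉ used s.nodes φ S := by
  by_contra! hcon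
  obtain ⟨a, b, hab, ha, hb⟩ := hN.exists_adj _ (h.mark t ht)
  have hm : mk (φ t) := h.mark t ht
  have key : ∀ x, I.Adj (φ t) x → ∃ e ∈ S, incident t (ends e) = true ∧ x ∈ e.2.1 ∧ ¬ br x := by
    intro x hx
    have hbr : ¬ br x := fun hbr => hN.main_adj _ _ (Or.inl hm) (Or.inr hbr) hx
    rcases mem_used.1 (hcon x hx) with ⟨i, hi, rfl⟩ | ⟨e, he, hxe⟩
    · exact absurd hx (hN.main_adj _ _ (Or.inl hm) (h.main hi))
    · refine ⟨e, he, ?_, hxe, hbr⟩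
      have htn := ht.trans_le h.marks_le
      by_contra hinc
      refine hbr (hN.br_of_mem_mid h he hxe hx.symm fun hmem => hinc (incident_iff.2 ?_))
      rcases mem_seg.1 hmem with h1 | h1 | h1
      · exact Or.inl (h.inj (h.lt e he).1 htn h1.symm)
      · exact absurd h1 (h.notMem_mid htn he)
      · exact Or.inr (h.inj (h.lt e he).2 htn h1.symm)
  obtain ⟨e, he, hei, hae, hbra⟩ := key a ha
  obtain ⟨f, hf, hfi, hbf, hbrb⟩ := key b hb
  have hef : e = f := by
    rw [valence, ← h.perm.countP_eq, List.countP_map, List.countP_eq_length_filter] at hv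
    have h1 := List.mem_filter.2 ⟨he, show (incident t ∘ ends) e = true from hei⟩
    have h2 := List.mem_filter.2 ⟨hf, show (incident t ∘ ends) f = true from hfi⟩
    obtain ⟨c, hc⟩ := List.length_eq_one_iff.1 (le_antisymm (by omega) (List.length_pos_of_mem h1))
    rw [hc, List.mem_singleton] at h1 h2
    rw [h1, h2]
  subst hef
  have hc := h.chain e he
  have hn := h.seg_nodup he
  rcases incident_iff.1 hei with h1 | h1
  · simp only [ends] at h1
    simp only [seg, h1] at hc hn
    have h2 := hN.head?_of_adj hc hn hae ha hbra
    rw [hN.head?_of_adj hc hn hbf hb hbrb] at h2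
    exact hab (Option.some.inj h2).symm
  · simp only [ends] at h1
    have hc' : (seg φ e).reverse.IsChain I.Adj := by
      rw [List.isChain_reverse]
      exact hc.imp fun _ _ h => h.symm
    have hn' := List.nodup_reverse.2 hn
    have hr : (seg φ e).reverse = φ t :: (e.2.1.reverse ++ [φ e.1]) := by simp [seg, h1]
    rw [hr] at hc' hn'
    have h2 := hN.head?_of_adj hc' hn' (List.mem_reverse.2 hae) ha hbra
    rw [hN.head?_of_adj hc' hn' (List.mem_reverse.2 hbf) hb hbrb] at h2
    exact hab (Option.some.inj h2).symm

theorem good_of_leaf (hN : Net I mk br) {t : ℕ} (ht : leafOk s t = true)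
    (hc : ∀ c ∈ leafChildren s t, Good I mk br c) : Good I mk br s := by
  intro φ S h
  simp only [leafOk, Bool.and_eq_true, Nat.blt_eq] at ht
  obtain ⟨⟨htm, hval⟩, hnodes⟩ := ht
  have htn := htm.trans_le h.marks_le
  obtain ⟨y, hty, hyU⟩ := h.exists_unused hN htm hval
  obtain ⟨v, hv, hvt⟩ : ∃ v < s.nodes, v ≠ t := by
    by_cases h0 : t = 0
    exacts [⟨1, hnodes, by omega⟩, ⟨0, by omega, by omega⟩]
  have htU : φ t ∈ used s.nodes φ S := mem_used.2 (Or.inl ⟨t, htn, rfl⟩)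
  have hR : Reach I {z | z ∈ [φ t]} y (φ v) := by
    refine hN.conn_one [φ t] (by simp) y (φ v) ?_ ?_
    · rw [List.mem_singleton]; rintro rfl; exact hyU htU
    · rw [List.mem_singleton]; exact fun h' => hvt (h.inj hv htn h')
  obtain ⟨l, hl, hlt⟩ := hR.exists_isLink (A := {y})
    (B := {x | x ∈ used s.nodes φ S ∧ x ≠ φ t}) rfl
    ⟨mem_used.2 (Or.inl ⟨v, hv, rfl⟩), fun h' => hvt (h.inj hv htn h')⟩
  obtain ⟨y', m, z, rfl, rfl, ⟨hzU, hzt⟩, hm⟩ := hl.exists_eq_cons (by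
    rintro x rfl ⟨h', -⟩; exact hyU h')
  have hmU : ∀ x ∈ y' :: m, x ∉ used s.nodes φ S := by
    intro x hx hxU
    have hxt : x ≠ φ t := by
      rintro rfl
      exact hlt (φ t) (by simpa using Or.inr (Or.inl (List.mem_of_ne_of_mem (by
        rintro rfl; exact hyU htU) hx))) (by simp)
    rcases List.mem_cons.1 hx with rfl | hx
    · exact hyU hxU
    · exact (hm x hx).2 ⟨hxU, hxt⟩
  have hchain : ((y' :: m) ++ [z]).IsChain I.Adj := hl.chain
  have hym : (y' :: m) ≠ [] := by simp
  have hlast : I.Adj ((y' :: m).getLast hym) z := by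
    rw [List.isChain_append] at hchain
    exact hchain.2.2 _ (by rw [List.getLast?_eq_some_getLast hym]; rfl) _ rfl
  have h0 : Model I mk br ⟨s.marks, s.nodes, s.edges ++ []⟩ φ S := by
    rw [List.append_nil]; exact h
  obtain ⟨r, hr, φ', S', h', hz', hr1, hr2, hφ, hU, hseg⟩ := h0.exists_attach hN
    (N := (List.range s.nodes).filter fun v => !v.beq t) (z := z)
    (y := (y' :: m).getLast hym) (by
      rcases mem_used.1 hzU with ⟨i, hi, rfl⟩ | ⟨e, he, hze⟩
      · refine Or.inl ⟨i, List.mem_filter.2 ⟨List.mem_range.2 hi, ?_⟩, rfl⟩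
        have : i ≠ t := by rintro rfl; exact hzt rfl
        simpa [← Bool.not_eq_true] using this
      · exact Or.inr ⟨e, he, h.perm.subset (List.mem_map_of_mem he), hze⟩)
    (fun v hv => List.mem_range.1 (List.mem_filter.1 hv).1) hlast.symm
    (fun e he _ hye => hmU _ (List.getLast_mem hym) (h.mem_used_of_mem_seg he hye))
  have htr : φ' t = φ t := hφ t htn
  have h2 := h'.add (T := [(t, y' :: m, r.2.2)]) rfl (by
      simp only [List.mem_singleton, forall_eq]
      exact ⟨htn.trans_le hr2, hr1⟩) (by
      simp only [List.mem_singleton, forall_eq]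
      rintro rfl
      exact hzt (hz' ▸ htr)) (by
      simp only [List.mem_singleton, forall_eq, seg, hz', htr]
      exact List.isChain_cons_cons.2 ⟨hty, hchain⟩) (by
      have := hl.nodup
      rw [← List.cons_append] at this
      simpa using this.sublist (List.sublist_append_left _ _)) (by
      simp only [List.mem_singleton, forall_eq]
      exact fun x hx hxU => hmU x hx (hU.subset hxU))
  obtain ⟨L, hL1, hL2, hL3⟩ := hc _ (List.mem_map.2 ⟨r, hr, rfl⟩) _ _ h2
  exact ⟨L, hL1, hL2, fun i hi => hφ i (hi.trans_le h.marks_le) ▸ hL3 i hi⟩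

end Skeleton

namespace Skeleton

variable {W : Type*} {I : SimpleGraph W} {mk br : W → Prop} {s : Skeleton} {φ : ℕ → W}
  {S : List (ℕ × List W × ℕ)}

/-- The branch node `i` and the segments at `i`, without their other ends. -/
def star (k : ℕ) (φ : ℕ → W) (S : List (ℕ × List W × ℕ)) (i : ℕ) : Set W :=
  {x | x = φ i ∨ ∃ e ∈ S, branchEnd k (ends e) = i ∧ x ∈ e.2.1}

theorem branchEnd_cases {k : ℕ} {e : ℕ × ℕ} (he : (e.1.blt k).xor (e.2.blt k) = true) :
    (e.1 = branchEnd k e ∧ k ≤ e.1 ∧ e.2 < k) ∨ (e.1 < k ∧ k ≤ e.2 ∧ e.2 = branchEnd k e) := by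
  rw [branchEnd]
  cases h1 : e.1.blt k <;> cases h2 : e.2.blt k <;> simp only [h1, h2] at he <;>
    first | exact absurd he (by decide) | skip
  · rw [← Bool.not_eq_true, Nat.blt_eq] at h1
    rw [Nat.blt_eq] at h2
    exact Or.inl ⟨rfl, by omega, h2⟩
  · rw [← Bool.not_eq_true, Nat.blt_eq] at h2
    rw [Nat.blt_eq] at h1
    exact Or.inr ⟨h1, by omega, rfl⟩

theorem Model.xor_ends (h : Model I mk br s φ S)
    (hE : ∀ e ∈ s.edges, (e.1.blt s.marks).xor (e.2.blt s.marks) = true) {e : ℕ × List W × ℕ}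
    (he : e ∈ S) : ((ends e).1.blt s.marks).xor ((ends e).2.blt s.marks) = true :=
  hE _ (h.perm.subset (List.mem_map_of_mem he))

theorem Model.seg_subset_star (h : Model I mk br s φ S)
    (hE : ∀ e ∈ s.edges, (e.1.blt s.marks).xor (e.2.blt s.marks) = true) {e : ℕ × List W × ℕ}
    (he : e ∈ S) {x : W} (hx : x ∈ seg φ e) :
    x ∈ star s.marks φ S (branchEnd s.marks (ends e)) ∨ ∃ j < s.marks, φ j = x := by
  have hb := branchEnd_cases (h.xor_ends hE he)
  simp only [ends] at hb
  rcases mem_seg.1 hx with rfl | hx | rfl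
  · rcases hb with hb | hb
    · exact Or.inl (Or.inl (by rw [hb.1]; rfl))
    · exact Or.inr ⟨_, hb.1, rfl⟩
  · exact Or.inl (Or.inr ⟨e, he, rfl, hx⟩)
  · rcases hb with hb | hb
    · exact Or.inr ⟨_, hb.2.2, rfl⟩
    · exact Or.inl (Or.inl (by rw [hb.2.2]; rfl))

theorem Model.exists_of_mem_star (hN : Net I mk br) (h : Model I mk br s φ S)
    (hE : ∀ e ∈ s.edges, (e.1.blt s.marks).xor (e.2.blt s.marks) = true) {i : ℕ}
    (hi : s.marks ≤ i) (hin : i < s.nodes) (hval : valence s.edges i = 3) {z y : W}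
    (hz : z ∈ star s.marks φ S i) (hzy : I.Adj z y) (hy : y ∉ star s.marks φ S i)
    (hym : ∀ j < s.marks, φ j ≠ y) :
    ∃ e ∈ S, branchEnd s.marks (ends e) = i ∧ z ∈ e.2.1 ∧ br z := by
  have hye : ∀ e ∈ S, branchEnd s.marks (ends e) = i → y ∉ seg φ e := by
    intro e he hbe hye
    rcases h.seg_subset_star hE he hye with h' | ⟨j, hj, h'⟩
    exacts [hy (hbe ▸ h'), hym j hj h']
  rcases hz with rfl | ⟨e, he, hbe, hze⟩
  · have hlt := h.valence_lt hN hzy fun e he hie => hye e he ?_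
    · have : i.blt s.marks = false := by rw [← Bool.not_eq_true, Nat.blt_eq]; omega
      rw [hval, capacity, this] at hlt
      simp at hlt
    · have hb := branchEnd_cases (h.xor_ends hE he)
      simp only [ends] at hb ⊢
      rcases mem_seg.1 hie with h1 | h1 | h1
      · have := h.inj hin (h.lt e he).1 h1
        rcases hb with hb | hb <;> omega
      · exact absurd h1 (h.notMem_mid hin he)
      · have := h.inj hin (h.lt e he).2 h1
        rcases hb with hb | hb <;> omega
  · exact ⟨e, he, hbe, hze, hN.br_of_mem_mid h he hze hzy (hye e he hbe)⟩

theorem Model.disjoint_star (h : Model I mk br s φ S) {i j : ℕ} (hi : i < s.nodes)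
    (hj : j < s.nodes) (hij : i ≠ j) {x : W} (hx : x ∈ star s.marks φ S i) :
    x ∉ star s.marks φ S j := by
  rintro (h2 | ⟨f, hf, hfj, h2⟩) <;> rcases hx with h1 | ⟨e, he, hei, h1⟩
  · exact hij (h.inj hi hj (h1 ▸ h2))
  · exact h.notMem_mid hj he (h2 ▸ h1)
  · exact h.notMem_mid hi hf (h1 ▸ h2)
  · exact hij (by rw [← hei, ← hfj, h.eq_of_mem he hf h1 h2])

theorem good_of_ear (hN : Net I mk br) (hs : earOk s = true)
    (hc : ∀ c ∈ earChildren s, Good I mk br c) : Good I mk br s := by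
  intro φ S h
  simp only [earOk, Bool.and_eq_true, Nat.beq_eq, Nat.ble_eq, List.all_eq_true, Bool.or_eq_true,
    Nat.blt_eq, List.mem_range] at hs
  obtain ⟨⟨⟨hk, hn⟩, hE⟩, hval⟩ := hs
  rw [← hk] at hE
  have hmap : ∀ a c, a + c ≤ s.nodes → ((List.range' a c).map φ).Nodup := by
    intro a c hac
    refine List.Nodup.map_on (fun i hi j hj hij => ?_) List.nodup_range'
    rw [List.mem_range'_1] at hi hj
    exact h.inj (by omega) (by omega) hij
  obtain ⟨x, hx, y, hy, hxy, hR⟩ := hN.four ((List.range' 0 6).map φ) ((List.range' 6 4).map φ)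
    (hmap _ _ (by omega)) (hmap _ _ (by omega)) (by simp) (by simp) (by
      intro x hx
      obtain ⟨i, hi, rfl⟩ := List.mem_map.1 hx
      rw [List.mem_range'_1] at hi
      exact h.mark i (by omega)) (by
      intro x hx
      obtain ⟨i, hi, rfl⟩ := List.mem_map.1 hx
      rw [List.mem_range'_1] at hi
      exact h.branch i (by omega) (by omega))
  obtain ⟨i, hi, rfl⟩ := List.mem_map.1 hx
  obtain ⟨j, hj, rfl⟩ := List.mem_map.1 hy
  rw [List.mem_range'_1] at hi hj
  have hij : j ≠ i := by rintro rfl; exact hxy rfl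
  obtain ⟨l, hl, hlm⟩ := hR.exists_isLink (A := star s.marks φ S i)
    (B := {x | ∃ j, s.marks ≤ j ∧ j < s.nodes ∧ j ≠ i ∧ x ∈ star s.marks φ S j})
    (Or.inl rfl) ⟨j, by omega, by omega, hij, Or.inl rfl⟩
  obtain ⟨z, m, w, rfl, hzA, ⟨j, hjk, hjn, hji, hwB⟩, hm⟩ := hl.exists_eq_cons (by
    rintro x hx ⟨j', h1, h2, h3, h4⟩
    exact h.disjoint_star (by omega) h2 h3.symm hx h4)
  have hlm' : ∀ x ∈ z :: (m ++ [w]), ∀ i < s.marks, φ i ≠ x := by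
    rintro x hx i hi rfl
    exact hlm _ hx (List.mem_map.2 ⟨i, by rw [List.mem_range'_1]; omega, rfl⟩)
  have hwA : w ∉ star s.marks φ S i := h.disjoint_star hjn (by omega) hji hwB
  have hzB : z ∉ star s.marks φ S j := h.disjoint_star (by omega) hjn hji.symm hzA
  have hchain := hl.chain
  have hnodup := hl.nodup
  obtain ⟨e, he, hei, hze, hzbr⟩ : ∃ e ∈ S, branchEnd s.marks (ends e) = i ∧ z ∈ e.2.1 ∧ br z := by
    rcases m with _ | ⟨y, m⟩
    · exact h.exists_of_mem_star hN hE (by omega) (by omega)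
        ((hval i (by omega)).resolve_left (by omega)) hzA (y := w) (by simpa using hchain)
        hwA (hlm' w (by simp))
    · exact h.exists_of_mem_star hN hE (by omega) (by omega)
        ((hval i (by omega)).resolve_left (by omega)) hzA (y := y)
        (by rw [List.cons_append, List.isChain_cons_cons] at hchain; exact hchain.1)
        (hm y (by simp)).1 (hlm' y (by simp))
  obtain ⟨f, hf, hfj, hwf, hwbr⟩ : ∃ e ∈ S, branchEnd s.marks (ends e) = j ∧ w ∈ e.2.1 ∧ br w := by
    rcases List.eq_nil_or_concat m with rfl | ⟨m, y, rfl⟩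
    · exact h.exists_of_mem_star hN hE hjk hjn
        ((hval j hjn).resolve_left (by omega)) hwB (y := z) (by simpa [I.adj_comm] using hchain)
        hzB (hlm' z (by simp))
    · refine h.exists_of_mem_star hN hE hjk hjn
        ((hval j hjn).resolve_left (by omega)) hwB (y := y) ?_
        (fun hy => (hm y (by simp)).2 ⟨j, hjk, hjn, hji, hy⟩) (hlm' y (by simp))
      simp only [List.concat_eq_append, List.append_assoc, List.singleton_append] at hchain
      rw [← List.cons_append, List.isChain_append_cons_cons] at hchain
      exact hchain.2.1.symm
  have hef : f ≠ e := by rintro rfl; exact hji (hfj.symm.trans hei)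
  obtain ⟨S₀, hS⟩ : ∃ S₀, (e :: f :: S₀).Perm S := by
    classical
    exact ⟨_, ((List.perm_cons_erase ((List.mem_erase_of_ne hef).2 hf)).symm.cons e).trans
      (List.perm_cons_erase he).symm⟩
  have hperm := (hS.map ends).trans h.perm
  obtain ⟨p, hp, hpe, hp'⟩ := exists_mem_picks (hperm.subset List.mem_cons_self)
  have hperm2 := hperm.trans hp'
  rw [hpe, List.map_cons, List.perm_cons, List.map_cons] at hperm2
  obtain ⟨q, hq, hqf, hq'⟩ := exists_mem_picks (hperm2.subset List.mem_cons_self)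
  obtain ⟨a, u, b⟩ := e
  obtain ⟨c, v, d⟩ := f
  obtain ⟨u₁, u₂, rfl⟩ := List.append_of_mem hze
  obtain ⟨v₁, v₂, rfl⟩ := List.append_of_mem hwf
  have h1 : Model I mk br ⟨s.marks, s.nodes, (a, b) :: (c, d) :: q.2⟩ φ _ := h.congr hS (by
    refine hp'.trans ?_
    rw [hpe]
    refine List.Perm.cons _ (hq'.trans ?_)
    rw [hqf]; exact .refl _)
  obtain ⟨h2, hU2, hφ2⟩ := h1.subdivide hzbr
  have h3 : Model I mk br ⟨s.marks, s.nodes + 1, (c, d) :: (a, s.nodes) :: (s.nodes, b) :: q.2⟩ _ _ :=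
    h2.congr (S' := (c, v₁ ++ w :: v₂, d) :: (a, u₁, s.nodes) :: (s.nodes, u₂, b) :: S₀)
      (List.perm_append_comm (l₁ := [_]) (l₂ := [_, _]) |>.append_right _)
      (List.perm_append_comm (l₁ := [_, _]) (l₂ := [_]) |>.append_right _)
  obtain ⟨h4, hU4, hφ4⟩ := h3.subdivide hwbr
  generalize hφ' : Function.update (Function.update φ s.nodes z) (s.nodes + 1) w = φ' at *
  have hφz : φ' s.nodes = z := by rw [hφ4 _ (by omega), Function.update_self]
  have hφw : φ' (s.nodes + 1) = w := by rw [← hφ', Function.update_self]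
  have hused : ∀ x ∈ m, x ∉ used s.nodes φ S := by
    intro x hx hxU
    have hstar : ∀ i', s.marks ≤ i' → i' < s.nodes → x ∉ star s.marks φ S i' := by
      intro i' h1 h2 h3
      by_cases h4 : i' = i
      · exact (hm x hx).1 (h4 ▸ h3)
      · exact (hm x hx).2 ⟨i', h1, h2, h4, h3⟩
    rcases mem_used.1 hxU with ⟨i', hi', rfl⟩ | ⟨e, he, hxe⟩
    · rcases lt_or_ge i' s.marks with h' | h'
      · exact hlm' (φ i') (by simp [hx]) i' h' rfl
      · exact hstar i' h' hi' (Or.inl rfl)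
    · have hlt := h.lt e he
      refine hstar (branchEnd s.marks (ends e)) ?_ ?_ (Or.inr ⟨e, he, rfl, hxe⟩) <;>
      rcases branchEnd_cases (h.xor_ends hE he) with hb | hb <;> simp only [ends] at hb ⊢ <;> omega
  have h5 := h4.add (T := [(s.nodes, m, s.nodes + 1)]) rfl (by simp) (by simp) (by
      simp only [List.mem_singleton, forall_eq, seg, hφz, hφw]
      exact hchain) (by
      simp only [List.flatMap_cons, List.flatMap_nil, List.append_nil]
      exact (List.nodup_append'.1 (List.nodup_cons.1 hnodup).2).1) (by
      simp only [List.mem_singleton, forall_eq]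
      intro x hx hxU
      have h6 := hU4.subset hxU
      refine hused x hx ?_
      have hp1 : (used (s.nodes + 1) (Function.update φ s.nodes z)
          ((c, v₁ ++ w :: v₂, d) :: (a, u₁, s.nodes) :: (s.nodes, u₂, b) :: S₀)).Perm
          (used (s.nodes + 1) (Function.update φ s.nodes z)
          ((a, u₁, s.nodes) :: (s.nodes, u₂, b) :: (c, v₁ ++ w :: v₂, d) :: S₀)) :=
        List.Perm.append_left _
          ((List.perm_append_comm (l₁ := [_]) (l₂ := [_, _]) |>.append_right _).flatMap_right _)
      exact (List.Perm.append_left _ (hS.flatMap_right _)).subset (hU2.subset (hp1.subset h6)))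
  obtain ⟨L, hL1, hL2, hL3⟩ := hc _ (List.mem_flatMap.2 ⟨p, hp, List.mem_map.2 ⟨q,
    List.mem_filter.2 ⟨hq, by
      rw [hpe, hqf, hei, hfj, Bool.not_eq_true', ← Bool.not_eq_true, Nat.beq_eq]
      exact hji.symm⟩, rfl⟩⟩) φ' _ (by
      rw [hpe, hqf]
      exact h5)
  refine ⟨L, hL1, hL2, fun i hi => ?_⟩
  have hi' := hi.trans_le h.marks_le
  have := hL3 i hi
  rwa [hφ4 i (by omega), hφ2 i hi'] at this

end Skeleton

namespace Skeleton

variable {W : Type*}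

theorem nodup_map_of_nodup_flatten {Q : List (List W)} {g : List W → Option W}
    (hQ : Q.flatten.Nodup) (hg : ∀ q ∈ Q, ∃ x ∈ q, g q = some x) : (Q.map g).Nodup := by
  induction Q with
  | nil => simp
  | cons q Q ih =>
    rw [List.flatten_cons, List.nodup_append'] at hQ
    rw [List.map_cons, List.nodup_cons]
    refine ⟨fun hm => ?_, ih hQ.2.1 fun b hb => hg b (List.mem_cons_of_mem _ hb)⟩
    obtain ⟨b, hb, hab⟩ := List.mem_map.1 hm
    obtain ⟨x, hx, hx'⟩ := hg q List.mem_cons_self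
    obtain ⟨y, hy, hy'⟩ := hg b (List.mem_cons_of_mem _ hb)
    obtain rfl : y = x := by rw [hx', hy'] at hab; exact Option.some.inj hab
    exact hQ.2.2 hx (List.mem_flatten.2 ⟨b, hb, hy⟩)

theorem exists_mem_notMem {l T : List W} (hl : l.Nodup) (h : T.length < l.length) :
    ∃ x ∈ l, x ∉ T := by
  by_contra! hcon
  exact absurd (hl.subperm hcon).length_le (by omega)

theorem sublist_flatMap {α : Type*} {S : List α} {f g : α → List W}
    (h : ∀ a ∈ S, (f a).Sublist (g a)) : (S.flatMap f).Sublist (S.flatMap g) := by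
  induction S with
  | nil => simp
  | cons a S ih =>
    rw [List.flatMap_cons, List.flatMap_cons]
    exact (h a List.mem_cons_self).append (ih fun b hb => h b (List.mem_cons_of_mem _ hb))

theorem length_le_length_flatMap {α : Type*} {S : List α} {f : α → List W}
    (h : ∀ a ∈ S, f a ≠ []) : S.length ≤ (S.flatMap f).length := by
  induction S with
  | nil => simp
  | cons a S ih =>
    have h1 := List.length_pos_of_ne_nil (h a List.mem_cons_self)
    have h2 := ih fun b hb => h b (List.mem_cons_of_mem _ hb)
    simp only [List.flatMap_cons, List.length_append, List.length_cons]
    omega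

theorem nodup_of_distinct {l : List ℕ} (h : distinct l = true) : l.Nodup := by
  induction l with
  | nil => simp
  | cons a l ih =>
    simp only [distinct, Bool.and_eq_true, List.all_eq_true] at h
    refine List.nodup_cons.2 ⟨fun ha => ?_, ih h.2⟩
    simpa using h.1 a ha

/-- Reverse a segment. -/
def flip (e : ℕ × List W × ℕ) : ℕ × List W × ℕ := (e.2.2, e.2.1.reverse, e.1)

theorem seg_flip (φ : ℕ → W) (e : ℕ × List W × ℕ) : seg φ (flip e) = (seg φ e).reverse := by
  simp [seg, flip]

variable {I : SimpleGraph W} {mk br : W → Prop} {s : Skeleton} {φ : ℕ → W}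
  {S : List (ℕ × List W × ℕ)}

theorem Model.map_flip (h : Model I mk br s φ S) (g : ℕ × List W × ℕ → ℕ × List W × ℕ)
    (hg : ∀ e ∈ S, g e = e ∨ g e = flip e) :
    Model I mk br ⟨s.marks, s.nodes, (S.map g).map ends⟩ φ (S.map g) where
  perm := .refl _
  marks_le := h.marks_le
  lt := by
    simp only [List.mem_map, forall_exists_index, and_imp, forall_apply_eq_imp_iff₂]
    intro e he
    have := h.lt e he
    rcases hg e he with h' | h' <;> rw [h']
    exacts [this, this.symm]
  chain := by
    simp only [List.mem_map, forall_exists_index, and_imp, forall_apply_eq_imp_iff₂]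
    intro e he
    have := h.chain e he
    rcases hg e he with h' | h' <;> rw [h']
    · exact this
    · rw [seg_flip, List.isChain_reverse]
      exact this.imp fun _ _ h => h.symm
  nodup := by
    refine (List.Perm.nodup_iff ?_).2 h.nodup
    refine List.Perm.append_left _ ?_
    rw [List.flatMap_map]
    refine List.Perm.flatMap_left _ fun e he => ?_
    rcases hg e he with h' | h' <;> rw [h']
    exact List.reverse_perm _
  mark := h.mark
  branch := h.branch
  ne := by
    simp only [List.mem_map, forall_exists_index, and_imp, forall_apply_eq_imp_iff₂]
    intro e he
    have := h.ne e he
    rcases hg e he with h' | h' <;> rw [h']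
    exacts [this, this.symm]

theorem exists_segments {Q : List (List W)} {X p : List ℕ} (hX : X.map (some ∘ φ) = Q.map List.head?)
    (hp : p.map (some ∘ φ) = Q.map List.getLast?) (hQ : ∀ q ∈ Q, ∃ x m z, q = x :: (m ++ [z])) :
    ∃ T : List (ℕ × List W × ℕ), T.map ends = X.zip p ∧ T.map (seg φ) = Q ∧
      ∀ e ∈ T, e.1 ∈ X ∧ e.2.2 ∈ p := by
  induction Q generalizing X p with
  | nil => exact ⟨[], by simp_all⟩
  | cons q Q ih =>
    obtain ⟨a, X, rfl, ha, hX⟩ := List.map_eq_cons_iff.1 hX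
    obtain ⟨b, p, rfl, hb, hp⟩ := List.map_eq_cons_iff.1 hp
    obtain ⟨T, hT1, hT2, hT3⟩ := ih hX hp fun q hq => hQ q (List.mem_cons_of_mem _ hq)
    obtain ⟨x, m, z, rfl⟩ := hQ q List.mem_cons_self
    rw [← List.cons_append, List.getLast?_concat] at hb
    refine ⟨(a, m, b) :: T, by simp [hT1, ends], ?_, ?_⟩
    · simp only [Function.comp, List.head?_cons, Option.some.injEq] at ha hb
      simp [hT2, seg, ha, hb]
    · intro e he
      rcases List.mem_cons.1 he with rfl | he
      · simp
      · exact ⟨List.mem_cons_of_mem _ (hT3 e he).1, List.mem_cons_of_mem _ (hT3 e he).2⟩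

theorem IsLink.notMem_of_mem_mid {A B : Set W} {e : ℕ × List W × ℕ} (h : IsLink I A B (seg φ e))
    {x : W} (hx : x ∈ e.2.1) : x ∉ A ∧ x ∉ B := by
  have hxs : x ∈ seg φ e := mem_seg.2 (Or.inr (Or.inl hx))
  have hn := h.nodup
  rw [seg] at hn
  constructor
  · intro hA
    have := (h.left x hxs).1 hA
    simp only [seg, List.head?_cons, Option.some.injEq] at this
    rw [this] at hn
    simp [hx] at hn
  · intro hB
    have := (h.right x hxs).1 hB
    rw [seg, ← List.cons_append, List.getLast?_concat, Option.some.injEq] at this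
    rw [this] at hn
    simp [List.nodup_append', hx] at hn

theorem within_map_ends (mask : ℕ) (b : Bool) (S : List (ℕ × List W × ℕ)) :
    within mask b (S.map ends) =
      (S.filter fun e => (mask.testBit e.1 == b) && (mask.testBit e.2.2 == b)).map ends := by
  rw [within, List.filter_map]
  rfl

/-- Orient the segments that cross a cut. -/
def orient (mask : ℕ) (e : ℕ × List W × ℕ) : ℕ × List W × ℕ :=
  bif !mask.testBit e.1 && mask.testBit e.2.2 then flip e else e

theorem crossing_map_ends (mask : ℕ) (S : List (ℕ × List W × ℕ)) :
    crossing mask (S.map ends) =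
      ((S.map (orient mask)).filter fun e => mask.testBit e.1 && !mask.testBit e.2.2).map ends := by
  induction S with
  | nil => rfl
  | cons e S ih =>
    rw [List.map_cons, List.map_cons, List.filter_cons]
    cases h1 : mask.testBit e.1 <;> cases h2 : mask.testBit e.2.2 <;>
      simp [crossing, ends, orient, flip, h1, h2, ih]

theorem within_map_orient (mask : ℕ) (b : Bool) (S : List (ℕ × List W × ℕ)) :
    within mask b ((S.map (orient mask)).map ends) = within mask b (S.map ends) := by
  induction S with
  | nil => rfl
  | cons e S ih =>
    simp only [within] at ih
    simp only [within, List.map_cons, List.filter_cons, ih]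
    cases h1 : mask.testBit e.1 <;> cases h2 : mask.testBit e.2.2 <;> cases b <;>
      simp [ends, orient, flip, h1, h2]

theorem side_split (mask : ℕ) {S : List (ℕ × List W × ℕ)}
    (hS : ∀ e ∈ S, mask.testBit e.2.2 = true → mask.testBit e.1 = true) :
    ((S.filter fun e => mask.testBit e.1 && !mask.testBit e.2.2) ++
      ((S.filter fun e => (mask.testBit e.1 == true) && (mask.testBit e.2.2 == true)) ++
      (S.filter fun e => (mask.testBit e.1 == false) && (mask.testBit e.2.2 == false)))).Perm S := by
  induction S with
  | nil => exact .refl _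
  | cons e S ih =>
    have ih := ih fun e he => hS e (List.mem_cons_of_mem _ he)
    have := hS e List.mem_cons_self
    simp only [List.filter_cons]
    cases h1 : mask.testBit e.1 <;> cases h2 : mask.testBit e.2.2 <;> simp [h1, h2] at this ⊢
    · exact (List.Perm.append_left _ List.perm_middle).trans
        (List.perm_middle.trans (List.Perm.cons e (by simpa using ih)))
    · simpa using ih
    · refine List.Perm.trans List.perm_middle (List.Perm.cons e ?_)
      simpa using ih

end Skeleton

namespace Skeleton

variable {W : Type*} {I : SimpleGraph W} {mk br : W → Prop} {φ : ℕ → W}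

/-- A model whose segments are sorted according to a cut. -/
structure CutModel (I : SimpleGraph W) (mk br : W → Prop) (k n mask : ℕ) (φ : ℕ → W)
    (C X Y : List (ℕ × List W × ℕ)) : Prop where
  model : Model I mk br ⟨k, n, (C ++ (X ++ Y)).map ends⟩ φ (C ++ (X ++ Y))
  cross : ∀ e ∈ C, mask.testBit e.1 = true ∧ mask.testBit e.2.2 = false
  left : ∀ e ∈ X, mask.testBit e.1 = true ∧ mask.testBit e.2.2 = true
  right : ∀ e ∈ Y, mask.testBit e.1 = false ∧ mask.testBit e.2.2 = false

/-- The points on one side of a cut. -/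
def shore (mask : ℕ) (b : Bool) (n : ℕ) (φ : ℕ → W) (X : List (ℕ × List W × ℕ)) : List W :=
  (nodesOn mask b n).map φ ++ X.flatMap fun e => e.2.1

theorem mem_nodesOn {mask : ℕ} {b : Bool} {n v : ℕ} :
    v ∈ nodesOn mask b n ↔ v < n ∧ mask.testBit v = b := by
  simp [nodesOn]

theorem mem_shore {mask : ℕ} {b : Bool} {n : ℕ} {X : List (ℕ × List W × ℕ)} {x : W} :
    x ∈ shore mask b n φ X ↔
      (∃ v < n, mask.testBit v = b ∧ φ v = x) ∨ ∃ e ∈ X, x ∈ e.2.1 := by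
  simp [shore, mem_nodesOn, and_assoc]

namespace CutModel

variable {k n mask : ℕ} {C X Y : List (ℕ × List W × ℕ)}

theorem mem_left (_ : CutModel I mk br k n mask φ C X Y) {e : ℕ × List W × ℕ} (he : e ∈ X) :
    e ∈ C ++ (X ++ Y) := by simp [he]

theorem mem_right (_ : CutModel I mk br k n mask φ C X Y) {e : ℕ × List W × ℕ} (he : e ∈ Y) :
    e ∈ C ++ (X ++ Y) := by simp [he]

theorem mem_cross (_ : CutModel I mk br k n mask φ C X Y) {e : ℕ × List W × ℕ} (he : e ∈ C) :
    e ∈ C ++ (X ++ Y) := by simp [he]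

theorem ne_of_cross (h : CutModel I mk br k n mask φ C X Y) {e f : ℕ × List W × ℕ} (he : e ∈ C)
    (hf : f ∈ X ∨ f ∈ Y) : e ≠ f := by
  rintro rfl
  have := h.cross e he
  rcases hf with hf | hf
  · simpa [this] using h.left e hf
  · simpa [this] using h.right e hf

theorem disjoint (h : CutModel I mk br k n mask φ C X Y) {x : W}
    (hx : x ∈ shore mask true n φ X) : x ∉ shore mask false n φ Y := by
  intro hy
  rcases mem_shore.1 hx with ⟨v, hv, hvt, rfl⟩ | ⟨e, he, hxe⟩ <;>
    rcases mem_shore.1 hy with ⟨w, hw, hwt, h'⟩ | ⟨f, hf, hxf⟩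
  · rw [h.model.inj hw hv h', hvt] at hwt
    exact Bool.noConfusion hwt
  · exact h.model.notMem_mid hv (h.mem_right hf) hxf
  · exact h.model.notMem_mid hw (h.mem_left he) (h' ▸ hxe)
  · have := h.model.eq_of_mem (h.mem_left he) (h.mem_right hf) hxe hxf
    subst this
    simpa [h.left e he] using h.right e hf

theorem notMem_shore_of_mem_cross (h : CutModel I mk br k n mask φ C X Y) {e : ℕ × List W × ℕ}
    (he : e ∈ C) {x : W} (hx : x ∈ e.2.1) :
    x ∉ shore mask true n φ X ∧ x ∉ shore mask false n φ Y := by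
  constructor <;> intro h' <;> rcases mem_shore.1 h' with ⟨v, hv, -, rfl⟩ | ⟨f, hf, hxf⟩
  · exact h.model.notMem_mid hv (h.mem_cross he) hx
  · exact h.ne_of_cross he (Or.inl hf) (h.model.eq_of_mem (h.mem_cross he) (h.mem_left hf) hx hxf)
  · exact h.model.notMem_mid hv (h.mem_cross he) hx
  · exact h.ne_of_cross he (Or.inr hf) (h.model.eq_of_mem (h.mem_cross he) (h.mem_right hf) hx hxf)

theorem isLink (h : CutModel I mk br k n mask φ C X Y) {e : ℕ × List W × ℕ} (he : e ∈ C) :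
    IsLink I {x | x ∈ shore mask true n φ X} {x | x ∈ shore mask false n φ Y} (seg φ e) := by
  have hlt := h.model.lt e (h.mem_cross he)
  have h1 : φ e.1 ∈ shore mask true n φ X := mem_shore.2 (Or.inl ⟨_, hlt.1, (h.cross e he).1, rfl⟩)
  have h2 : φ e.2.2 ∈ shore mask false n φ Y :=
    mem_shore.2 (Or.inl ⟨_, hlt.2, (h.cross e he).2, rfl⟩)
  have hn := h.model.seg_nodup (h.mem_cross he)
  refine ⟨by simp [seg], h.model.chain e (h.mem_cross he), hn, fun x hx => ?_, fun x hx => ?_⟩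
  · simp only [seg, List.head?_cons, Option.some.injEq, Set.mem_ofPred_eq]
    refine ⟨fun hA => ?_, fun h' => h' ▸ h1⟩
    rcases mem_seg.1 hx with rfl | hx | rfl
    · rfl
    · exact absurd hA (h.notMem_shore_of_mem_cross he hx).1
    · exact absurd h2 (h.disjoint hA)
  · rw [seg, ← List.cons_append, List.getLast?_concat, Option.some.injEq, Set.mem_ofPred_eq]
    refine ⟨fun hB => ?_, fun h' => h' ▸ h2⟩
    rcases mem_seg.1 hx with rfl | hx | rfl
    · exact absurd hB (h.disjoint h1)
    · exact absurd hB (h.notMem_shore_of_mem_cross he hx).2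
    · rfl

theorem flatten_nodup (h : CutModel I mk br k n mask φ C X Y) (h1 : (C.map Prod.fst).Nodup)
    (h2 : (C.map fun e => e.2.2).Nodup) : (C.map (seg φ)).flatten.Nodup := by
  rw [← List.flatMap_def, List.nodup_flatMap]
  refine ⟨fun e he => h.model.seg_nodup (h.mem_cross he), ?_⟩
  have h3 := (List.pairwise_append.1 h.model.pairwise).1
  rw [List.Nodup, List.pairwise_map] at h1 h2
  refine ((h1.and h2).and h3).imp_of_mem ?_
  rintro e f he hf ⟨⟨h1, h2⟩, h3⟩ x hx hx'
  have hle := h.model.lt e (h.mem_cross he)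
  have hlf := h.model.lt f (h.mem_cross hf)
  have hce := h.cross e he
  have hcf := h.cross f hf
  rcases mem_seg.1 hx with rfl | hx | rfl
  · rcases mem_seg.1 hx' with h' | h' | h'
    · exact h1 (h.model.inj hle.1 hlf.1 h')
    · exact h.model.notMem_mid hle.1 (h.mem_cross hf) h'
    · have := h.model.inj hle.1 hlf.2 h'
      simp [this, hcf.2] at hce
  · rcases mem_seg.1 hx' with rfl | h' | rfl
    · exact h.model.notMem_mid hlf.1 (h.mem_cross he) hx
    · exact h3 hx h'
    · exact h.model.notMem_mid hlf.2 (h.mem_cross he) hx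
  · rcases mem_seg.1 hx' with h' | h' | h'
    · have := h.model.inj hle.2 hlf.1 h'
      simp [this, hcf.1] at hce
    · exact h.model.notMem_mid hle.2 (h.mem_cross hf) h'
    · exact h2 (h.model.inj hle.2 hlf.2 h')

theorem seg_left (h : CutModel I mk br k n mask φ C X Y) {e : ℕ × List W × ℕ} (he : e ∈ X) {x : W}
    (hx : x ∈ seg φ e) : x ∈ shore mask true n φ X := by
  have hlt := h.model.lt e (h.mem_left he)
  rcases mem_seg.1 hx with rfl | hx | rfl
  · exact mem_shore.2 (Or.inl ⟨_, hlt.1, (h.left e he).1, rfl⟩)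
  · exact mem_shore.2 (Or.inr ⟨e, he, hx⟩)
  · exact mem_shore.2 (Or.inl ⟨_, hlt.2, (h.left e he).2, rfl⟩)

theorem seg_right (h : CutModel I mk br k n mask φ C X Y) {e : ℕ × List W × ℕ} (he : e ∈ Y) {x : W}
    (hx : x ∈ seg φ e) : x ∈ shore mask false n φ Y := by
  have hlt := h.model.lt e (h.mem_right he)
  rcases mem_seg.1 hx with rfl | hx | rfl
  · exact mem_shore.2 (Or.inl ⟨_, hlt.1, (h.right e he).1, rfl⟩)
  · exact mem_shore.2 (Or.inr ⟨e, he, hx⟩)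
  · exact mem_shore.2 (Or.inl ⟨_, hlt.2, (h.right e he).2, rfl⟩)

/-- The result of the augmentation along a cut. -/
theorem exists_links (h : CutModel I mk br k n mask φ C X Y) (h1 : (C.map Prod.fst).Nodup)
    (h2 : (C.map fun e => e.2.2).Nodup)
    (hR : ∀ T : List W, T.length ≤ C.length → ∃ a ∈ shore mask true n φ X,
      ∃ b ∈ shore mask false n φ Y, Reach I {x | x ∈ T} a b) :
    ∃ (Q : List (List W)) (a b : W),
      (∀ q ∈ Q, IsLink I {x | x ∈ shore mask true n φ X} {x | x ∈ shore mask false n φ Y} q) ∧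
      Q.flatten.Nodup ∧ Q.map List.head? = (C.map fun e => some (φ e.1)) ++ [some a] ∧
      (Q.map List.getLast?).Perm ((C.map fun e => some (φ e.2.2)) ++ [some b]) ∧
      (∀ e ∈ C, φ e.1 ≠ a) ∧ ∀ e ∈ C, φ e.2.2 ≠ b := by
  obtain ⟨Q, a, b, hQ, hn, hhead, hlast⟩ := exists_augmentation (C.map (seg φ))
    {x | x ∈ shore mask false n φ Y} (by
      intro p hp
      obtain ⟨e, he, rfl⟩ := List.mem_map.1 hp
      exact h.isLink he) (h.flatten_nodup h1 h2) (by simpa using hR)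
  have e1 : (C.map (seg φ)).map List.head? = C.map fun e => some (φ e.1) := by
    rw [List.map_map]; exact List.map_congr_left fun e _ => by simp [seg]
  have e2 : (C.map (seg φ)).map List.getLast? = C.map fun e => some (φ e.2.2) := by
    rw [List.map_map]
    refine List.map_congr_left fun e _ => ?_
    rw [Function.comp, seg, ← List.cons_append, List.getLast?_concat]
  rw [e1] at hhead
  rw [e2] at hlast
  obtain ⟨Q', hQ', hhead'⟩ := List.exists_perm_of_map_perm
    (hhead.trans (List.perm_append_comm (l₁ := [_])))
  have hn' : Q'.flatten.Nodup := (List.Perm.flatten hQ').nodup_iff.2 hn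
  have hlast' := ((hQ'.map List.getLast?).trans hlast).trans (List.perm_append_comm (l₁ := [_]))
  have hQ'' := fun q hq => hQ q (hQ'.subset hq)
  refine ⟨Q', a, b, hQ'', hn', hhead', hlast', ?_, ?_⟩
  · have := nodup_map_of_nodup_flatten hn' (g := List.head?) fun q hq => by
      have := (hQ'' q hq).ne_nil
      exact ⟨_, List.head_mem this, List.head?_eq_some_head this⟩
    rw [hhead', List.nodup_append'] at this
    rintro e he rfl
    exact this.2.2 (List.mem_map.2 ⟨e, he, rfl⟩) (by simp)
  · have := nodup_map_of_nodup_flatten hn' (g := List.getLast?) fun q hq => by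
      have := (hQ'' q hq).ne_nil
      exact ⟨_, List.getLast_mem this, List.getLast?_eq_some_getLast this⟩
    rw [hlast'.nodup_iff, List.nodup_append'] at this
    rintro e he rfl
    exact this.2.2 (List.mem_map.2 ⟨e, he, rfl⟩) (by simp)

theorem exists_path (hN : Net I mk br) (h : CutModel I mk br k n mask φ C X Y)
    (h1 : (C.map Prod.fst).Nodup) (h2 : (C.map fun e => e.2.2).Nodup)
    (hR : ∀ T : List W, T.length ≤ C.length → ∃ a ∈ shore mask true n φ X,
      ∃ b ∈ shore mask false n φ Y, Reach I {x | x ∈ T} a b)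
    (hc : ∀ r ∈ attach k n ((nodesOn mask true n).filter fun v => !(C.map Prod.fst).any v.beq)
        (X.map ends) [],
      ∀ q ∈ attach k r.1 ((nodesOn mask false n).filter fun v => !(C.map fun e => e.2.2).any v.beq)
        (Y.map ends) r.2.1,
      ∀ p : List ℕ, p.Perm ((C.map fun e => e.2.2) ++ [q.2.2]) →
        Good I mk br ⟨k, q.1, (C.map Prod.fst ++ [r.2.2]).zip p ++ q.2.1⟩) :
    ∃ l : List W, l.Nodup ∧ l.IsChain I.Adj ∧ ∀ i < k, φ i ∈ l := by
  obtain ⟨Q, a, b, hQ, hn, hhead, hlast, haC, hbC⟩ := h.exists_links h1 h2 hR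
  have hQ' : ∀ q ∈ Q, ∃ x m z, q = x :: (m ++ [z]) := fun q hq => by
    obtain ⟨x, m, z, h', -⟩ := (hQ q hq).exists_eq_cons fun x hx => h.disjoint hx
    exact ⟨x, m, z, h'⟩
  obtain ⟨w, haA, haw, hwA⟩ : ∃ w, a ∈ shore mask true n φ X ∧ I.Adj a w ∧
      w ∉ shore mask true n φ X := by
    obtain ⟨q, hq, hqa⟩ := List.mem_map.1 (show some a ∈ Q.map List.head? by simp [hhead])
    obtain ⟨x, m, z, rfl, hx, hz, hm⟩ := (hQ q hq).exists_eq_cons fun x hx => h.disjoint hx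
    obtain rfl : x = a := by simpa using hqa
    have hch := (hQ _ hq).chain
    rcases m with _ | ⟨w, m⟩
    · exact ⟨z, hx, by simpa using hch, fun h' => h.disjoint h' hz⟩
    · rw [List.cons_append, List.isChain_cons_cons] at hch
      exact ⟨w, hx, hch.1, (hm w (by simp)).1⟩
  obtain ⟨y, hbB, hby, hyB⟩ : ∃ w, b ∈ shore mask false n φ Y ∧ I.Adj b w ∧
      w ∉ shore mask false n φ Y := by
    obtain ⟨q, hq, hqb⟩ := List.mem_map.1 (hlast.symm.subset (show some b ∈ _ by simp))
    obtain ⟨x, m, z, rfl, hx, hz, hm⟩ := (hQ q hq).exists_eq_cons fun x hx => h.disjoint hx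
    rw [← List.cons_append, List.getLast?_concat, Option.some.injEq] at hqb
    subst hqb
    have hch := (hQ _ hq).chain
    rcases List.eq_nil_or_concat m with rfl | ⟨m, w, rfl⟩
    · exact ⟨x, hz, by simpa [I.adj_comm] using hch, h.disjoint hx⟩
    · simp only [List.concat_eq_append, List.append_assoc, List.singleton_append] at hch
      rw [← List.cons_append, List.isChain_append_cons_cons] at hch
      exact ⟨w, hz, hch.2.1.symm, (hm w (by simp)).2⟩
  have hnotAny : ∀ (l : List ℕ) (v : ℕ), v ∉ l → (!l.any v.beq) = true := by
    intro l v hv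
    rw [Bool.not_eq_true', ← Bool.not_eq_true, List.any_eq_true]
    rintro ⟨x, hx, hvx⟩
    exact hv (Nat.beq_eq.mp hvx ▸ hx)
  have hXsub : X.Sublist (C ++ (X ++ Y)) :=
    (List.sublist_append_left X Y).trans (List.sublist_append_right C _)
  have m0 : Model I mk br ⟨k, n, X.map ends ++ []⟩ φ X := h.model.sub hXsub (by simp)
  obtain ⟨r, hr, φ₁, S₁, m1, hφa, hr1, hr2, hφ₁, hU₁, hseg₁⟩ := m0.exists_attach hN
    (N := (nodesOn mask true n).filter fun v => !(C.map Prod.fst).any v.beq) (z := a) (y := w) (by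
      rcases mem_shore.1 haA with ⟨v, hv, hvt, rfl⟩ | ⟨e, he, hae⟩
      · refine Or.inl ⟨v, List.mem_filter.2 ⟨mem_nodesOn.2 ⟨hv, hvt⟩, hnotAny _ _ fun hv' => ?_⟩, rfl⟩
        obtain ⟨e, he, rfl⟩ := List.mem_map.1 hv'
        exact haC e he rfl
      · exact Or.inr ⟨e, he, List.mem_map_of_mem he, hae⟩)
    (fun v hv => (mem_nodesOn.1 (List.mem_filter.1 hv).1).1) haw
    (fun e he _ hw => hwA (h.seg_left he hw))
  have hlt : ∀ e ∈ Y, e.1 < n ∧ e.2.2 < n := fun e he => h.model.lt e (h.mem_right he)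
  have m2 := m1.add (T := Y) rfl (fun e he => ⟨(hlt e he).1.trans_le hr2, (hlt e he).2.trans_le hr2⟩)
    (fun e he => h.model.ne e (h.mem_right he))
    (fun e he => by
      rw [seg_congr hφ₁ (hlt e he)]; exact h.model.chain e (h.mem_right he))
    (by
      have := (List.nodup_append'.1 h.model.nodup).2.1
      rw [List.flatMap_append, List.flatMap_append] at this
      exact (List.nodup_append'.1 (List.nodup_append'.1 this).2.1).2.1)
    (fun e he x hx hxU => by
      rcases mem_used.1 (hU₁.subset hxU) with ⟨v, hv, rfl⟩ | ⟨f, hf, hxf⟩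
      · exact h.model.notMem_mid hv (h.mem_right he) hx
      · have := h.model.eq_of_mem (h.mem_right he) (h.mem_left hf) hx hxf
        subst this
        simpa [h.left e hf] using h.right e he)
  obtain ⟨t, ht, φ₂, S₂, m3, hφb, ht1, ht2, hφ₂, hU₂, hseg₂⟩ := m2.exists_attach hN
    (N := (nodesOn mask false n).filter fun v => !(C.map fun e => e.2.2).any v.beq) (z := b) (y := y)
    (by
      rcases mem_shore.1 hbB with ⟨v, hv, hvt, rfl⟩ | ⟨e, he, hbe⟩
      · refine Or.inl ⟨v, List.mem_filter.2 ⟨mem_nodesOn.2 ⟨hv, hvt⟩, hnotAny _ _ fun hv' => ?_⟩,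
          hφ₁ v hv⟩
        obtain ⟨e, he, rfl⟩ := List.mem_map.1 hv'
        exact hbC e he rfl
      · exact Or.inr ⟨e, List.mem_append_left _ he, List.mem_map_of_mem he, hbe⟩)
    (fun v hv => (mem_nodesOn.1 (List.mem_filter.1 hv).1).1.trans_le hr2) hby
    (fun e he hbe hye => by
      rcases List.mem_append.1 he with he | he
      · rw [seg_congr hφ₁ (hlt e he)] at hye
        exact hyB (h.seg_right he hye)
      · obtain ⟨f, hf, hsub⟩ := hseg₁ e he
        exact h.disjoint (h.seg_left hf (hsub hbe)) hbB)
  have hφ : ∀ i < n, φ₂ i = φ i := fun i hi => (hφ₂ i (hi.trans_le hr2)).trans (hφ₁ i hi)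
  have hltC := fun e he => h.model.lt e (h.mem_cross he)
  obtain ⟨p, hp, hp'⟩ : ∃ p : List ℕ, p.Perm ((C.map fun e => e.2.2) ++ [t.2.2]) ∧
      p.map (some ∘ φ₂) = Q.map List.getLast? := by
    refine List.exists_perm_of_map_perm (List.Perm.trans ?_ hlast.symm)
    rw [List.map_append, List.map_map, List.map_singleton, Function.comp, hφb]
    refine List.Perm.append_right _ (List.Perm.of_eq (List.map_congr_left fun e he => ?_))
    simp [hφ _ (hltC e he).2]
  obtain ⟨T, hT1, hT2, hT3⟩ := exists_segments (φ := φ₂) (X := C.map Prod.fst ++ [r.2.2]) (by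
    rw [hhead, List.map_append, List.map_map, List.map_singleton, Function.comp, hφ₂ _ hr1, hφa]
    congr 1
    refine List.map_congr_left fun e he => ?_
    simp [hφ _ (hltC e he).1]) hp' hQ'
  have hTQ : ∀ e ∈ T, seg φ₂ e ∈ Q := fun e he => hT2 ▸ List.mem_map_of_mem he
  have m4 := m3.add hT1 (fun e he => by
      constructor
      · have := (hT3 e he).1
        simp only [List.mem_append, List.mem_map, List.mem_singleton] at this
        rcases this with ⟨f, hf, h'⟩ | h'
        · exact h' ▸ ((hltC f hf).1.trans_le hr2).trans_le ht2
        · exact h' ▸ hr1.trans_le ht2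
      · have := hp.subset (hT3 e he).2
        simp only [List.mem_append, List.mem_map, List.mem_singleton] at this
        rcases this with ⟨f, hf, h'⟩ | h'
        · exact h' ▸ ((hltC f hf).2.trans_le hr2).trans_le ht2
        · exact h' ▸ ht1)
    (fun e he heq => by
      have := (hQ _ (hTQ e he)).nodup
      simp [seg, heq] at this)
    (fun e he => (hQ _ (hTQ e he)).chain)
    (by
      rw [← hT2, ← List.flatMap_def] at hn
      exact hn.sublist (sublist_flatMap fun e _ =>
        (List.sublist_append_left _ _).trans (List.sublist_cons_self _ _)))
    (fun e he x hx hxU => by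
      have hx' := (hQ _ (hTQ e he)).notMem_of_mem_mid hx
      have hxnode : ∀ v < n, φ v ≠ x := by
        rintro v hv rfl
        cases hvt : mask.testBit v
        · exact hx'.2 (mem_shore.2 (Or.inl ⟨v, hv, hvt, rfl⟩))
        · exact hx'.1 (mem_shore.2 (Or.inl ⟨v, hv, hvt, rfl⟩))
      have hxU1 : x ∈ used r.1 φ₁ (Y ++ S₁) := hU₂.subset hxU
      have : (∃ f ∈ Y, x ∈ f.2.1) ∨ x ∈ used r.1 φ₁ S₁ := by
        rw [mem_used] at hxU1 ⊢
        rcases hxU1 with h' | ⟨f, hf, h'⟩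
        · exact Or.inr (Or.inl h')
        · rcases List.mem_append.1 hf with hf | hf
          exacts [Or.inl ⟨f, hf, h'⟩, Or.inr (Or.inr ⟨f, hf, h'⟩)]
      rcases this with h' | h'
      · exact hx'.2 (mem_shore.2 (Or.inr h'))
      · rcases mem_used.1 (hU₁.subset h') with ⟨v, hv, h'⟩ | h'
        · exact hxnode v hv h'
        · exact hx'.1 (mem_shore.2 (Or.inr h')))
  obtain ⟨L, hL1, hL2, hL3⟩ := hc r hr t ht p hp _ _ m4
  exact ⟨L, hL1, hL2, fun i hi => hφ i (hi.trans_le h.model.marks_le) ▸ hL3 i hi⟩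

end CutModel

theorem good_of_cut (hN : Net I mk br) {s : Skeleton} {mask : ℕ} (hs : cutOk s mask = true)
    (hc : ∀ c ∈ cutChildren s mask, Good I mk br c) : Good I mk br s := by
  intro φ S₀ h₀
  obtain ⟨S, hS, hSE⟩ := List.exists_perm_of_map_perm h₀.perm
  have h := h₀.congr hS (.refl _)
  obtain ⟨k, n, E⟩ := s
  simp only at hSE h
  subst hSE
  simp only [cutOk, crossing_map_ends, ← within_map_orient mask _ S, within_map_ends] at hs
  simp only [List.map_map] at hs
  simp only [cutChildren, crossing_map_ends, ← within_map_orient mask _ S, within_map_ends] at hc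
  simp only [List.map_map] at hc
  have horient : ∀ e ∈ S.map (orient mask), mask.testBit e.2.2 = true → mask.testBit e.1 = true := by
    intro e he
    obtain ⟨f, hf, rfl⟩ := List.mem_map.1 he
    cases h1 : mask.testBit f.1 <;> cases h2 : mask.testBit f.2.2 <;>
      simp [orient, h1, h2, flip]
  have hm := (h.map_flip (orient mask) fun e _ => by
    rw [orient]; cases !mask.testBit e.1 && mask.testBit e.2.2 <;> simp).congr
      (side_split mask horient) ((side_split mask horient).map ends).symm
  set C := (S.map (orient mask)).filter fun e => mask.testBit e.1 && !mask.testBit e.2.2 with hC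
  set X := (S.map (orient mask)).filter fun e =>
    (mask.testBit e.1 == true) && (mask.testBit e.2.2 == true) with hX
  set Y := (S.map (orient mask)).filter fun e =>
    (mask.testBit e.1 == false) && (mask.testBit e.2.2 == false) with hY
  have h : CutModel I mk br k n mask φ C X Y := by
    refine ⟨hm, fun e he => ?_, fun e he => ?_, fun e he => ?_⟩ <;>
      simpa using (List.mem_filter.1 he).2
  have hlen : ∀ b (Z : List (ℕ × List W × ℕ)), (∀ e ∈ Z, e.2.1 ≠ []) →
      (nodesOn mask b n).length + Z.length ≤ (shore mask b n φ Z).length := by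
    intro b Z hZ
    rw [shore, List.length_append, List.length_map]
    exact Nat.add_le_add_left (length_le_length_flatMap hZ) _
  have hlX := hlen true X fun e he => hm.mid_ne_nil hN (h.mem_left he)
  have hlY := hlen false Y fun e he => hm.mid_ne_nil hN (h.mem_right he)
  have hnd : ∀ b (Z : List (ℕ × List W × ℕ)), Z.Sublist (C ++ (X ++ Y)) →
      (shore mask b n φ Z).Nodup := fun b Z hZ => hm.nodup.sublist
    ((List.filter_sublist.map φ).append (hZ.flatMap _))
  have hnX := hnd true X ((List.sublist_append_left X Y).trans (List.sublist_append_right C _))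
  have hnY := hnd false Y ((List.sublist_append_right X Y).trans (List.sublist_append_right C _))
  simp only [Bool.and_eq_true, Bool.or_eq_true, Nat.beq_eq, Nat.ble_eq, List.length_map] at hs
  obtain ⟨⟨hd1, hd2⟩, hs⟩ := hs
  refine h.exists_path hN (nodup_of_distinct hd1) (nodup_of_distinct hd2) ?_ ?_
  · intro T hT
    rcases hs with ⟨⟨h1, h2⟩, h3⟩ | ⟨⟨h1, h2⟩, h3⟩
    · obtain ⟨a, ha, haT⟩ := exists_mem_notMem hnX (T := T) (by omega)
      obtain ⟨b, hb, hbT⟩ := exists_mem_notMem hnY (T := T) (by omega)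
      exact ⟨a, ha, b, hb, hN.conn_one T (by omega) a b haT hbT⟩
    · exact hN.conn_two T (by omega) _ _ hnX hnY (by omega) (by omega)
  · intro r hr q hq p hp
    exact hc _ (List.mem_flatMap.2 ⟨r, hr, List.mem_flatMap.2 ⟨q, hq, List.mem_map.2
      ⟨p, List.mem_permutations'.2 hp, rfl⟩⟩⟩)

end Skeleton

namespace Skeleton

variable {W : Type*} {I : SimpleGraph W} {mk br : W → Prop} {s t : Skeleton} {φ : ℕ → W}
  {S : List (ℕ × List W × ℕ)}

theorem exists_of_extract {a b : ℕ} {E' : List (ℕ × ℕ)} (h : extract a b (S.map ends) = some E') :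
    ∃ r S', (r :: S').Perm S ∧ S'.map ends = E' ∧ (ends r = (a, b) ∨ ends r = (b, a)) := by
  induction S generalizing E' with
  | nil => simp [extract] at h
  | cons e S ih =>
    simp only [List.map_cons, extract] at h
    rcases hb : ((ends e).1.beq a && (ends e).2.beq b) || ((ends e).1.beq b && (ends e).2.beq a)
    · rw [hb, cond_false, Option.map_eq_some_iff] at h
      obtain ⟨E'', h1, rfl⟩ := h
      obtain ⟨r, S', hp, hm, hr⟩ := ih h1
      exact ⟨r, e :: S', (List.Perm.swap _ _ _).trans (hp.cons e), by simp [hm], hr⟩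
    · rw [hb, cond_true, Option.some_inj] at h
      refine ⟨e, S, .refl _, h, ?_⟩
      simpa [Prod.ext_iff] using hb

theorem exists_of_hasImage {σ : ℕ → ℕ} {T : List (ℕ × ℕ)} (h : hasImage σ T (S.map ends) = true) :
    ∃ R : List (ℕ × List W × ℕ), R.map ends = T ∧
      (R.flatMap fun e => e.2.1).Subperm (S.flatMap fun e => e.2.1) ∧
      ∀ r ∈ R, ∃ q ∈ S, (σ r.1, r.2.1, σ r.2.2) = q ∨ (σ r.1, r.2.1, σ r.2.2) = flip q := by
  induction T generalizing S with
  | nil => exact ⟨[], rfl, List.nil_subperm, by simp⟩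
  | cons e T ih =>
    rw [hasImage] at h
    rcases hx : extract (σ e.1) (σ e.2) (S.map ends) with _ | E'
    · simp [hx] at h
    · obtain ⟨q, S', hp, rfl, hq⟩ := exists_of_extract hx
      obtain ⟨R, hR, hs, hR'⟩ := ih (by simpa [hx] using h)
      have key : ∀ m : List W, m.Perm q.2.1 →
          ((σ e.1, m, σ e.2) = q ∨ (σ e.1, m, σ e.2) = flip q) →
          ∃ R : List (ℕ × List W × ℕ), R.map ends = e :: T ∧
            (R.flatMap fun e => e.2.1).Subperm (S.flatMap fun e => e.2.1) ∧ ∀ r ∈ R, ∃ q ∈ S,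
              (σ r.1, r.2.1, σ r.2.2) = q ∨ (σ r.1, r.2.1, σ r.2.2) = flip q := by
        intro m hm hm'
        refine ⟨(e.1, m, e.2) :: R, by simp [hR, ends], ?_, ?_⟩
        · refine List.Subperm.trans ?_ (hp.flatMap_right _).subperm
          exact hm.subperm.append hs
        · intro r hr
          rcases List.mem_cons.1 hr with rfl | hr
          · exact ⟨q, hp.mem_iff.1 (by simp), hm'⟩
          · obtain ⟨q', hq', hr'⟩ := hR' r hr
            exact ⟨q', hp.mem_iff.1 (by simp [hq']), hr'⟩
      rcases hq with hq | hq <;> simp only [ends, Prod.mk.injEq] at hq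
      · exact key q.2.1 (.refl _) (Or.inl (by rw [← hq.1, ← hq.2]))
      · exact key q.2.1.reverse (List.reverse_perm _) (Or.inr (by rw [flip, ← hq.1, ← hq.2]))

theorem Model.of_embeds {c : ℕ} (h : Model I mk br s φ S) (hw : t.wellFormed = true)
    (hc : embeds t s c = true) : ∃ R, Model I mk br t (φ ∘ digit c) R := by
  obtain ⟨S', hS', hm⟩ := List.exists_perm_of_map_perm h.perm
  replace h := h.congr hS' (.refl _)
  simp only [embeds, Bool.and_eq_true, List.all_eq_true, Nat.beq_eq, List.mem_range, beq_iff_eq,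
    Nat.blt_eq, ← hm] at hc
  obtain ⟨⟨⟨⟨hmk, hd⟩, hlt⟩, -⟩, hi⟩ := hc
  simp only [wellFormed, Bool.and_eq_true, List.all_eq_true, Nat.ble_eq, Nat.blt_eq] at hw
  obtain ⟨R, hR, hs, hR'⟩ := exists_of_hasImage hi
  have hRlt : ∀ e ∈ R, e.1 < t.nodes ∧ e.2.2 < t.nodes := fun e he =>
    hw.2 (ends e) (hR ▸ List.mem_map_of_mem he)
  have hiff : ∀ i < t.nodes, digit c i < s.marks ↔ i < t.marks := fun i hi => by
    have := (hlt i hi).2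
    rw [Bool.eq_iff_iff, Nat.blt_eq, Nat.blt_eq] at this
    exact this
  refine ⟨R, by rw [hR], hw.1, hRlt, fun e he => ?_, ?_, fun i hi => ?_, fun i hi hi' => ?_,
    fun e he => ?_⟩
  · obtain ⟨q, hq, h1 | h1⟩ := hR' e he
    · have : seg (φ ∘ digit c) e = seg φ q := by rw [← h1]; rfl
      exact this ▸ h.chain q hq
    · have : seg (φ ∘ digit c) e = seg φ (flip q) := by rw [← h1]; rfl
      rw [this, seg_flip, List.isChain_reverse]
      exact (h.chain q hq).imp fun _ _ h => h.symm
  · have : (used t.nodes (φ ∘ digit c) R).Subperm (used s.nodes φ S') := by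
      refine List.Subperm.append ?_ hs
      rw [← List.map_map]
      have : ((List.range t.nodes).map (digit c)).Subperm (List.range s.nodes) := by
        refine List.subperm_of_subset (nodup_of_distinct hd) fun i hi => ?_
        obtain ⟨j, hj, rfl⟩ := List.mem_map.1 hi
        exact List.mem_range.2 (hlt j (List.mem_range.1 hj)).1
      obtain ⟨l, hl, hl'⟩ := this
      exact ⟨l.map φ, hl.map φ, hl'.map φ⟩
    obtain ⟨l, hl, hl'⟩ := this
    exact hl.nodup_iff.1 (h.nodup.sublist hl')
  · exact h.mark _ ((hiff i (hi.trans_le hw.1)).2 hi)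
  · exact h.branch _ (not_lt.1 fun h' => hi.not_gt ((hiff i hi').1 h')) (hlt i hi').1
  · intro h0
    obtain ⟨q, hq, h1 | h1⟩ := hR' e he
    · exact h.ne q hq (by rw [← h1, h0])
    · have h2 := congrArg Prod.fst h1
      have h3 := congrArg (fun p : ℕ × List W × ℕ => p.2.2) h1
      simp only [flip] at h2 h3
      exact h.ne q hq (by rw [← h2, ← h3, h0])

theorem good_of_embeds {c : ℕ} (hw : t.wellFormed = true) (ht : Good I mk br t)
    (hc : embeds t s c = true) : Good I mk br s := by
  intro φ S h
  obtain ⟨R, hR⟩ := h.of_embeds hw hc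
  obtain ⟨l, hl, hl', hm⟩ := ht _ _ hR
  refine ⟨l, hl, hl', fun j hj => ?_⟩
  simp only [embeds, Bool.and_eq_true, List.all_eq_true, Nat.beq_eq, List.mem_range,
    List.any_eq_true] at hc
  obtain ⟨i, hi, rfl⟩ := hc.1.2 j hj
  exact hm i (by rw [hc.1.1.1.1]; exact hi)

end Skeleton

namespace Skeleton

variable {W : Type*} {I : SimpleGraph W} {mk br : W → Prop} {s t : Skeleton} {φ : ℕ → W}
  {S : List (ℕ × List W × ℕ)}

theorem mem_of_testBit_packed {E : List (ℕ × ℕ)} (hE : ∀ e ∈ E, e.1 < 32 ∧ e.2 < 32) {v w : ℕ}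
    (hv : v < 32) (hw : w < 32) (h : (packed E).testBit (32 * v + w) = true) :
    (v, w) ∈ E ∨ (w, v) ∈ E := by
  induction E with
  | nil => simp [packed] at h
  | cons e E ih =>
    have key : ∀ a b : ℕ, a < 32 → b < 32 →
        (Nat.shiftLeft 1 ((Nat.mul 32 a).add b)).testBit (32 * v + w) = true →
        a = v ∧ b = w := by
      intro a b ha hb hab
      have : ((1 : ℕ) <<< (32 * a + b)).testBit (32 * v + w) = true := hab
      rw [Nat.one_shiftLeft, Nat.testBit_two_pow, decide_eq_true_iff] at this
      omega
    obtain ⟨he, he'⟩ := hE e (by simp)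
    have h' : ((packed E ||| Nat.shiftLeft 1 ((Nat.mul 32 e.1).add e.2)) |||
      Nat.shiftLeft 1 ((Nat.mul 32 e.2).add e.1)).testBit (32 * v + w) = true := h
    rw [Nat.testBit_or, Nat.testBit_or, Bool.or_eq_true, Bool.or_eq_true] at h'
    rcases h' with (h' | h') | h'
    · have := ih (fun e he => hE e (by simp [he])) h'
      simp only [List.mem_cons]
      tauto
    · obtain ⟨rfl, rfl⟩ := key _ _ he he' h'
      simp
    · obtain ⟨rfl, rfl⟩ := key _ _ he' he h'
      simp

theorem testBit_eq (m i : ℕ) : m.testBit i = ((m.shiftRight i).land 1).beq 1 := by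
  have h : (m.shiftRight i).land 1 = (m >>> i) % 2 := Nat.and_one_is_mod _
  rw [h, Nat.testBit_eq_decide_div_mod_eq, Nat.shiftRight_eq_div_pow, Bool.eq_iff_iff,
    decide_eq_true_iff, Nat.beq_eq]

theorem exists_of_follow {adj full fuel seen v code : ℕ}
    (h : follow adj full fuel seen v code = true) :
    ∃ vs : List ℕ, (v :: vs).Nodup ∧ (∀ x ∈ v :: vs, seen.testBit x = false) ∧
      (v :: vs).IsChain (fun x y => adj.testBit (32 * x + y) = true ∧ y < 32) ∧
      ∀ i, full.testBit i = true → seen.testBit i = true ∨ i ∈ v :: vs := by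
  induction fuel generalizing seen v code with
  | zero => simp [follow] at h
  | succ fuel ih =>
    have hor : ∀ i, (seen.lor (Nat.shiftLeft 1 v)).testBit i = (seen.testBit i || decide (v = i)) := by
      intro i
      have : (seen ||| 1 <<< v).testBit i = _ := Nat.testBit_or _ _ _
      rw [Nat.one_shiftLeft, Nat.testBit_two_pow] at this
      rw [← this, ← Nat.one_shiftLeft]
      rfl
    simp only [follow, Bool.and_eq_true, Bool.or_eq_true] at h
    obtain ⟨hv, h⟩ := h
    have hv' : seen.testBit v = false := by
      rw [testBit_eq, Nat.beq_eq.mp hv]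
      rfl
    rcases h with h | ⟨hadj, h⟩
    · refine ⟨[], by simp, by simpa using hv', by simp, fun i hi => ?_⟩
      have h1 : (seen.lor (Nat.shiftLeft 1 v) &&& full).testBit i = true := by
        have h2 : seen.lor (Nat.shiftLeft 1 v) &&& full = full := Nat.beq_eq.mp h
        rw [h2, hi]
      rw [Nat.testBit_and, hor] at h1
      simp only [Bool.and_eq_true, Bool.or_eq_true, decide_eq_true_eq] at h1
      rcases h1.1 with h1 | rfl <;> simp_all
    · obtain ⟨vs, hn, hs, hc, hf⟩ := ih h
      refine ⟨code.land 31 :: vs, List.nodup_cons.2 ⟨fun hm => ?_, hn⟩, fun x hx => ?_,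
        List.isChain_cons_cons.2 ⟨⟨?_, ?_⟩, hc⟩, fun i hi => ?_⟩
      · simpa [hor] using hs v hm
      · rcases List.mem_cons.1 hx with rfl | hx
        · exact hv'
        · have := hs x hx
          rw [hor, Bool.or_eq_false_iff] at this
          exact this.1
      · rw [testBit_eq]
        exact hadj
      · exact Nat.lt_of_le_of_lt Nat.and_le_right (by norm_num)
      · have := hf i hi
        rw [hor, Bool.or_eq_true, decide_eq_true_eq] at this
        rw [List.mem_cons]
        tauto

theorem Model.exists_path (h : Model I mk br s φ S) {v : ℕ} {vs : List ℕ} (hn : (v :: vs).Nodup)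
    (hv : v < s.nodes) (hc : (v :: vs).IsChain fun x y => (x, y) ∈ s.edges ∨ (y, x) ∈ s.edges) :
    ∃ l : List W, (φ v :: l).Nodup ∧ (φ v :: l).IsChain I.Adj ∧ (∀ i ∈ v :: vs, φ i ∈ φ v :: l) ∧
      ∀ x ∈ φ v :: l, (∃ i ∈ v :: vs, i < s.nodes ∧ x = φ i) ∨
        ∃ e ∈ S, e.1 ∈ v :: vs ∧ e.2.2 ∈ v :: vs ∧ x ∈ e.2.1 := by
  induction vs generalizing v with
  | nil => exact ⟨[], by simp, by simp, by simp, fun x hx => Or.inl ⟨v, by simp, hv, by simpa using hx⟩⟩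
  | cons w vs ih =>
    obtain ⟨hvw, hc⟩ := List.isChain_cons_cons.1 hc
    obtain ⟨hvn, hn⟩ := List.nodup_cons.1 hn
    have key : ∃ q ∈ S, ∃ m : List W, (∀ x, x ∈ m ↔ x ∈ q.2.1) ∧ m.Nodup ∧
        (φ v :: (m ++ [φ w])).IsChain I.Adj ∧
        (q.1 = v ∧ q.2.2 = w ∨ q.1 = w ∧ q.2.2 = v) := by
      rcases hvw with hvw | hvw <;>
        obtain ⟨q, hq, hqe⟩ := List.mem_map.1 (h.perm.mem_iff.2 hvw) <;>
        simp only [ends, Prod.mk.injEq] at hqe <;> obtain ⟨rfl, rfl⟩ := hqe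
      · exact ⟨q, hq, q.2.1, by simp, h.mid_nodup hq, h.chain q hq, Or.inl ⟨rfl, rfl⟩⟩
      · refine ⟨q, hq, q.2.1.reverse, by simp, by simpa using h.mid_nodup hq, ?_, Or.inr ⟨rfl, rfl⟩⟩
        have := List.isChain_reverse.2 ((h.chain q hq).imp fun _ _ h => h.symm)
        simpa [seg] using this
    obtain ⟨q, hq, m, hmem, hmn, hmc, hqe⟩ := key
    have hlt : w < s.nodes := by
      have := h.lt q hq
      omega
    obtain ⟨l, hl, hlc, hmem', hof⟩ := ih hn hlt hc
    have hmid : ∀ i < s.nodes, φ i ∉ m := fun i hi hm => h.notMem_mid hi hq ((hmem _).1 hm)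
    refine ⟨m ++ φ w :: l, ?_, ?_, ?_, ?_⟩
    · rw [List.nodup_cons, List.mem_append, not_or, List.nodup_append']
      refine ⟨⟨hmid v hv, fun hm => ?_⟩, hmn, hl, fun x hx hx' => ?_⟩
      · rcases hof _ hm with ⟨i, hi, hi', hvi⟩ | ⟨e, he, -, -, hx⟩
        · exact hvn (h.inj hv hi' hvi ▸ hi)
        · exact h.notMem_mid hv he hx
      · rcases hof _ hx' with ⟨i, hi, hi', rfl⟩ | ⟨e, he, h1, h2, hxe⟩
        · exact hmid i hi' hx
        · obtain rfl := h.eq_of_mem he hq hxe ((hmem x).1 hx)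
          rcases hqe with ⟨rfl, -⟩ | ⟨-, rfl⟩
          exacts [hvn h1, hvn h2]
    · have := (List.isChain_split (l₁ := φ v :: m)).2 ⟨hmc, hlc⟩
      simpa using this
    · intro i hi
      rcases List.mem_cons.1 hi with rfl | hi
      · simp
      · have := hmem' i hi
        simp only [List.mem_cons, List.mem_append] at this ⊢
        tauto
    · intro x hx
      rcases List.mem_cons.1 hx with rfl | hx
      · exact Or.inl ⟨v, by simp, hv, rfl⟩
      rcases List.mem_append.1 hx with hx | hx
      · refine Or.inr ⟨q, hq, ?_, ?_, (hmem x).1 hx⟩ <;> rcases hqe with ⟨rfl, rfl⟩ | ⟨rfl, rfl⟩ <;> simp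
      · rcases hof x hx with ⟨i, hi, hi'⟩ | ⟨e, he, h1, h2, hx⟩
        · exact Or.inl ⟨i, List.mem_cons_of_mem _ hi, hi'⟩
        · exact Or.inr ⟨e, he, List.mem_cons_of_mem _ h1, List.mem_cons_of_mem _ h2, hx⟩

theorem good_of_isTraversal {c : ℕ} (hc : s.isTraversal c = true) : Good I mk br s := by
  intro φ S h
  simp only [isTraversal, Bool.and_eq_true, Nat.ble_eq, Nat.blt_eq] at hc
  obtain ⟨⟨hs, hlt⟩, hf⟩ := hc
  obtain ⟨vs, hn, -, hch, hfull⟩ := exists_of_follow hf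
  have hE : ∀ e ∈ s.edges, e.1 < 32 ∧ e.2 < 32 := fun e he => by
    obtain ⟨q, hq, rfl⟩ := List.mem_map.1 (h.perm.mem_iff.2 he)
    have := h.lt q hq
    simp only [ends]
    omega
  have hch' : ∀ (v : ℕ) (vs : List ℕ), v < 32 → (v :: vs).IsChain (fun x y =>
      (packed s.edges).testBit (32 * x + y) = true ∧ y < 32) →
      (v :: vs).IsChain fun x y => (x, y) ∈ s.edges ∨ (y, x) ∈ s.edges := by
    intro v vs
    induction vs generalizing v with
    | nil => simp
    | cons w vs ih =>
      intro hv hc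
      obtain ⟨⟨h1, hw⟩, h2⟩ := List.isChain_cons_cons.1 hc
      exact List.isChain_cons_cons.2 ⟨mem_of_testBit_packed hE hv hw h1, ih w hw h2⟩
  obtain ⟨l, hl, hlc, hmem, -⟩ := h.exists_path hn hlt (hch' _ _ (hlt.trans_le hs) hch)
  refine ⟨_, hl, hlc, fun i hi => hmem i ?_⟩
  have hbit : ((Nat.shiftLeft 1 s.marks).sub 1).testBit i = true := by
    have h1 : (Nat.shiftLeft 1 s.marks).sub 1 = 2 ^ s.marks - 1 :=
      congrArg (· - 1) (Nat.one_shiftLeft s.marks)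
    rw [h1, Nat.testBit_two_pow_sub_one]
    simpa using hi
  simpa using hfull i hbit

theorem good_of_children (hN : Net I mk br) {m : Move}
    (h : ∀ c ∈ s.children m, Good I mk br c) : Good I mk br s := by
  cases m with
  | leaf t =>
    rcases hs : leafOk s t
    · exact h s (by simp [children, hs])
    · exact good_of_leaf hN hs (by simpa [children, hs] using h)
  | ear =>
    rcases hs : earOk s
    · exact h s (by simp [children, hs])
    · exact good_of_ear hN hs (by simpa [children, hs] using h)
  | cut k =>
    rcases hs : cutOk s k
    · exact h s (by simp [children, hs])
    · exact good_of_cut hN hs (by simpa [children, hs] using h)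

def Sound (I : SimpleGraph W) (mk br : W → Prop) (T : List Entry) : Prop :=
  ∀ e ∈ T, e.skel.wellFormed = true ∧ Good I mk br e.skel

theorem Sound.good_of_checkCert {T : List Entry} (hT : Sound I mk br T) {c : ℕ}
    (h : checkCert T s c = true) : Good I mk br s := by
  unfold checkCert at h
  rcases hb : (c.land 1).beq 1
  · rw [hb, cond_false] at h
    rcases ht : T[(c.shiftRight 1).land 255]? with _ | t
    · rw [ht] at h
      exact (Bool.false_ne_true h).elim
    · rw [ht] at h
      obtain ⟨hw, hg⟩ := hT t (List.mem_of_getElem? ht)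
      exact good_of_embeds hw hg h
  · rw [hb, cond_true] at h
    exact good_of_isTraversal h

theorem Sound.good_of_checkCerts {T : List Entry} (hT : Sound I mk br T) {l : List Skeleton}
    {cs : List ℕ} (h : checkCerts T l cs = true) : ∀ s ∈ l, Good I mk br s := by
  induction l generalizing cs with
  | nil => simp
  | cons s l ih =>
    cases cs with
    | nil => simp [checkCerts] at h
    | cons c cs =>
      simp only [checkCerts, Bool.and_eq_true] at h
      exact List.forall_mem_cons.2 ⟨hT.good_of_checkCert h.1, ih h.2⟩

theorem Sound.cons (hN : Net I mk br) {T : List Entry} (hT : Sound I mk br T) {e : Entry}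
    (h : checkEntry e T = true) : Sound I mk br (e :: T) := by
  rw [checkEntry, Bool.and_eq_true] at h
  exact List.forall_mem_cons.2 ⟨⟨h.1, good_of_children hN (hT.good_of_checkCerts h.2)⟩, hT⟩

theorem Sound.append (hN : Net I mk br) {A T : List Entry} (hT : Sound I mk br T)
    (h : checkEntries A T = true) : Sound I mk br (A ++ T) := by
  induction A with
  | nil => exact hT
  | cons e A ih =>
    rw [checkEntries, Bool.and_eq_true] at h
    exact (ih h.2).cons hN h.1

theorem Sound.of_drop (hN : Net I mk br) {T : List Entry} {i n : ℕ}
    (hT : Sound I mk br (T.drop (i + n))) (h : checkRange T i n = true) :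
    Sound I mk br (T.drop i) := by
  have := hT.append hN h
  rwa [← List.drop_drop, List.take_append_drop] at this

end Skeleton

namespace Skeleton

variable {W : Type*} {I : SimpleGraph W} {mk br : W → Prop}

/-- A path together with an isolated marked node. -/
def start (k : ℕ) : Skeleton := ⟨k, k, (List.range' 0 (k - 2)).map fun i => (i, i + 1)⟩

theorem _root_.List.exists_append_cons_of_first {α : Type*} {p : α → Prop} {l : List α}
    (h : ∃ x ∈ l, p x) : ∃ s x t, l = s ++ x :: t ∧ p x ∧ ∀ y ∈ s, ¬ p y := by
  obtain ⟨s, x, t, hl, hx, hs⟩ := List.exists_append_cons_of_last (l := l.reverse) (p := p)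
    (by simpa using h)
  refine ⟨t.reverse, x, s.reverse, ?_, hx, fun y hy => hs y (by simpa using hy)⟩
  rw [← List.reverse_reverse l, hl]
  simp

theorem exists_segments_of_chain (p : W → Bool) (φ : ℕ → W) (a : W) (l : List W) (j : ℕ)
    (hc : (a :: l).IsChain I.Adj)
    (hφ : (List.range' j ((l.filter p).length + 1)).map φ = a :: l.filter p) :
    ∃ S : List (ℕ × List W × ℕ),
      S.map ends = (List.range' j (l.filter p).length).map (fun i => (i, i + 1)) ∧
      (∀ e ∈ S, (seg φ e).IsChain I.Adj) ∧
      (S.flatMap fun e => e.2.1).Sublist (l.filter fun x => !p x) := by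
  induction hn : l.length using Nat.strong_induction_on generalizing l a j with
  | _ n ih =>
  by_cases h : ∃ b ∈ l, p b = true
  · obtain ⟨u, b, t, rfl, hb, hu⟩ := List.exists_append_cons_of_first h
    have hu' : u.filter p = [] := List.filter_eq_nil_iff.2 fun x hx => by simp [hu x hx]
    have hu'' : (u.filter fun x => !p x) = u := List.filter_eq_self.2 fun x hx => by simp [hu x hx]
    rw [List.filter_append, hu', List.filter_cons_of_pos hb, List.nil_append] at hφ ⊢
    have hc' := (List.isChain_split (l₁ := a :: u)).1 hc
    rw [List.length_cons, List.range'_succ, List.map_cons, List.cons.injEq] at hφ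
    obtain ⟨S, hS, hSc, hSl⟩ := ih t.length (by simp at hn; omega) b t (j + 1) hc'.2 hφ.2 rfl
    have hjb : φ (j + 1) = b := by
      have := hφ.2
      rw [List.range'_succ, List.map_cons, List.cons.injEq] at this
      exact this.1
    refine ⟨(j, u, j + 1) :: S, ?_, ?_, ?_⟩
    · rw [List.length_cons, List.range'_succ]
      simp [ends, hS]
    · refine List.forall_mem_cons.2 ⟨?_, hSc⟩
      simpa [seg, hφ.1, hjb] using hc'.1
    · rw [List.flatMap_cons, List.filter_append, hu'', List.filter_cons_of_neg (by simp [hb])]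
      exact hSl.append_left u
  · push Not at h
    have : l.filter p = [] := List.filter_eq_nil_iff.2 h
    exact ⟨[], by simp [this], by simp, by simp⟩

theorem map_getD_range (l : List W) (d : W) : (List.range l.length).map (l.getD · d) = l := by
  refine List.ext_getElem (by simp) fun i h1 h2 => ?_
  simp [h2]

/-- A path can be extended to a further marked node. -/
theorem exists_chain_cons {x : W} {M l : List W} (hg : Good I mk br (start (M.length + 1)))
    (hM : (x :: M).Nodup) (hmk : ∀ y ∈ x :: M, mk y) (hl : l.Nodup) (hc : l.IsChain I.Adj)
    (hMl : ∀ y ∈ M, y ∈ l) : ∃ l' : List W, l'.Nodup ∧ l'.IsChain I.Adj ∧ ∀ y ∈ x :: M, y ∈ l' := by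
  classical
  by_cases hxl : x ∈ l
  · exact ⟨l, hl, hc, List.forall_mem_cons.2 ⟨hxl, hMl⟩⟩
  rw [List.nodup_cons] at hM
  set p : W → Bool := fun y => decide (y ∈ M) with hp
  have hperm : (l.filter p).Perm M := by
    refine (List.perm_ext_iff_of_nodup (hl.filter _) hM.2).2 fun y => ?_
    simp only [List.mem_filter, hp, decide_eq_true_eq]
    exact ⟨fun h => h.2, fun h => ⟨hMl y h, h⟩⟩
  have hlen : (l.filter p ++ [x]).length = M.length + 1 := by simp [hperm.length_eq]
  set φ : ℕ → W := ((l.filter p ++ [x]).getD · x) with hφ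
  have hrange : (List.range (M.length + 1)).map φ = l.filter p ++ [x] := by
    rw [← hlen]
    exact map_getD_range _ _
  have hmem : ∀ y ∈ x :: M, ∃ i < M.length + 1, φ i = y := by
    intro y hy
    have : y ∈ (List.range (M.length + 1)).map φ := by
      rw [hrange, List.mem_append, hperm.mem_iff, List.mem_singleton]
      exact (List.mem_cons.1 hy).symm
    simpa using this
  obtain ⟨S, hS, hSc, hSl⟩ : ∃ S : List (ℕ × List W × ℕ), S.map ends = (start (M.length + 1)).edges ∧
      (∀ e ∈ S, (seg φ e).IsChain I.Adj) ∧
      (S.flatMap fun e => e.2.1).Sublist (l.filter fun x => !p x) := by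
    rcases hM0 : M with _ | ⟨m, M'⟩
    · exact ⟨[], by simp [start], by simp, by simp⟩
    · obtain ⟨u, a, t, rfl, ha, hu⟩ := List.exists_append_cons_of_first (p := fun x => p x = true)
        ⟨m, hMl m (by simp [hM0]), by simp [hp, hM0]⟩
      have hu' : u.filter p = [] := List.filter_eq_nil_iff.2 fun x hx => by simp [hu x hx]
      rw [List.filter_append, hu', List.filter_cons_of_pos ha, List.nil_append] at hrange hperm
      have h1 : (t.filter p).length + 1 = M.length := by simpa using hperm.length_eq
      obtain ⟨S, hS, hSc, hSl⟩ := exists_segments_of_chain p φ a t 0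
        (hc.suffix (List.suffix_append _ _)) (by
          rw [← List.range_eq_range', h1]
          rw [List.range_succ, List.map_append] at hrange
          exact (List.append_inj hrange (by simp [h1])).1)
      refine ⟨S, ?_, hSc, hSl.trans ?_⟩
      · rw [hS, start, ← hM0, ← h1]
        rfl
      · exact ((List.sublist_cons_self _ _).trans (List.sublist_append_right _ _)).filter _
  have hSe : ∀ e ∈ S, e.1 + 1 = e.2.2 ∧ e.2.2 < M.length := by
    intro e he
    have : ends e ∈ (start (M.length + 1)).edges := hS ▸ List.mem_map_of_mem he
    simp only [start, List.mem_map, List.mem_range'_1, ends, Prod.mk.injEq] at this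
    omega
  have hm : Model I mk br (start (M.length + 1)) φ S := by
    refine ⟨by rw [hS], le_rfl, fun e he => ?_, hSc, ?_, fun i hi => hmk _ ?_, fun i hi hi' => ?_,
      fun e he => ?_⟩
    · have := hSe e he
      simp only [start]
      omega
    · simp only [used, start, hrange]
      refine List.nodup_append'.2 ⟨?_, (hl.filter _).sublist hSl, fun y hy hy' => ?_⟩
      · exact (hl.filter _).append (by simp) (by simp [hxl])
      · have := hSl.subset hy'
        rw [List.mem_filter] at this
        rcases List.mem_append.1 hy with hy | hy
        · have := (List.mem_filter.1 hy).2
          simp_all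
        · exact hxl (List.mem_singleton.1 hy ▸ this.1)
    · have : φ i ∈ (List.range (M.length + 1)).map φ := List.mem_map_of_mem (List.mem_range.2 hi)
      rw [hrange, List.mem_append, hperm.mem_iff, List.mem_singleton] at this
      exact List.mem_cons.2 this.symm
    · simp only [start] at hi hi'
      omega
    · have := hSe e he
      omega
  obtain ⟨l', hl', hc', hl''⟩ := hg φ S hm
  refine ⟨l', hl', hc', fun y hy => ?_⟩
  obtain ⟨i, hi, rfl⟩ := hmem y hy
  exact hl'' i hi

theorem exists_chain_of_marks (hg : ∀ k, 2 ≤ k → k ≤ 6 → Good I mk br (start k)) {M : List W}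
    (hM : M.Nodup) (hmk : ∀ y ∈ M, mk y) (hlen : M.length ≤ 6) :
    ∃ l : List W, l.Nodup ∧ l.IsChain I.Adj ∧ ∀ y ∈ M, y ∈ l := by
  induction M with
  | nil => exact ⟨[], by simp⟩
  | cons x M ih =>
    obtain ⟨l, hl, hc, hMl⟩ := ih (List.nodup_cons.1 hM).2 (fun y hy => hmk y (by simp [hy]))
      (by simp at hlen; omega)
    rcases M with _ | ⟨m, M⟩
    · exact ⟨[x], by simp⟩
    · exact exists_chain_cons (hg _ (by simp) hlen) hM hmk hl hc hMl

end Skeleton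

namespace Skeleton

set_option maxRecDepth 100000 in
/-- Skeletons that are good, listed so that each refers only to later ones. -/
def table : List Entry := [
  ⟨⟨6, 6, [(0, 1), (1, 2), (2, 3), (3, 4)]⟩, .leaf 5, [335614153, 344133697, 3368899133474, 3367305251328, 3300700752384, 3299106965538]⟩,
  ⟨⟨6, 7, [(3, 5), (2, 4), (1, 3), (2, 6), (1, 6), (0, 6)]⟩, .leaf 0, [10941239553, 8736807233, 126513648844906, 126531366060110, 126515276169216, 350119540873, 350121635977, 126531935420444]⟩,
  ⟨⟨6, 8, [(3, 5), (2, 4), (3, 6), (2, 7), (1, 6), (1, 7), (0, 6), (0, 7)]⟩, .cut 60, [11214174429699, 11216391246209, 11216391119233, 11214174556675, 11218536632705, 11218536505729, 11214243762625, 11216319816195, 11216319943171, 11214243635649, 11218534408641, 11218534535617, 11214241538561, 11216386925057, 11216387052033, 11214241665537, 11218469523843, 11218469396867, 11214241538561, 11216386925057, 11216387052033, 11214241665537, 11218467299779, 11218467426755, 8948648581505, 8946431764995, 8950793841025, 8950793968001, 8946431891971, 8948648454529, 8948577151491, 8946501097921, 8950791870913, 8950791743937, 8946500970945, 8948577278467,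 8948644260353, 8946498873857, 8950726732163, 8950726859139, 8946499000833, 8948644387329, 8948644260353, 8946498873857, 8950724762051, 8950724635075, 8946499000833, 8948644387329, 165651941962040832, 166742657496826392, 112752238527037464, 369654965029001, 369661474517129, 113297596294366720, 166759699927056920, 166214342159648256, 369657110415497, 130766087280705560, 131311445048034816, 369661472422025, 165651941962548736, 166742657497350168, 112752238526513688, 369655032072329, 369661407473801, 113297596293858816, 166759699927580696, 166214342160156160, 369657177458825, 130766087280181784, 131311445047526912, 369661405378697, 166742675196772888, 165651959662003200, 113297613994329088, 358853579969033, 359061883589129, 112752256226983960, 166214359859610624, 166759717627003416, 358922232336905, 131311462747997184, 130766104980652056, 359061816545801, 166742675197296664, 165651959662511104, 113297613993821184, 358855725355529, 359059738202633, 112752256226460184, 166214359860118528, 166759717627527192, 358924377723401, 131311462747489280, 130766104980128280, 359059671159305]⟩,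
  ⟨⟨6, 10, [(4, 5), (4, 6), (3, 7), (2, 6), (2, 8), (1, 6), (1, 9), (0, 7), (0, 8), (7, 9), (8, 9)]⟩, .leaf 5, [9146603147651, 5336313713447157772, 5335768389484839424, 7470369912928835, 226516730716547, 7248549813430917, 226516722264707, 226516722264707, 7267853743555077, 7248678863651395, 7248535112471107, 7248535112471107]⟩,
  ⟨⟨6, 11, [(4, 5), (5, 6), (4, 6), (3, 7), (2, 7), (2, 9), (1, 8), (1, 9), (0, 8), (0, 10), (6, 8), (7, 10), (9, 10)]⟩, .cut 112, [11690770457758209, 12042270581262849, 4323624108402063967238, 4323621296401075930118, 11971368410866012615, 12331304537334763975, 5539990601074830475778, 5539900617043213287938, 4949657723978536468480, 4949660450767373352960, 11971368339936711111, 12331304466405462471, 7237056715907357753344, 7237053989118520868864, 374105258477556167, 385353262429704647, 11971368941750129095, 12331305068218880455, 11971368941750129095, 12331305068218880455, 293232924232193, 361059047770625, 7807351023443524225, 7796024198251559553, 300289976535372231, 369743927038726599, 7427304752326724225, 7427293690973997697, 232096004745474561, 232096004407908865, 300289905606070727, 369743856109425095, 232095995817974529, 232095996155540225, 9384057404723655,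 11554493357953479, 300290507419488711, 369744457922843079, 300290507419488711, 369744457922843079, 361402645154305, 292889326848513, 7807282853722602113, 7796092367972481665, 370095770759614919, 299938132814483911, 7427304685754731137, 7427293757545990785, 232096004743442945, 232096004409940481, 370095699830313415, 299938061885182407, 232095995820006145, 232095996153508609, 11565488474231239, 9373062288445895, 370096301643731399, 299938663698600391, 370096301643731399, 299938663698600391]⟩,
  ⟨⟨6, 13, [(5, 6), (4, 6), (4, 9), (3, 7), (3, 8), (2, 7), (2, 8), (1, 9), (1, 11), (0, 10), (0, 12), (6, 10), (7, 11), (8, 12), (9, 10), (11, 12)]⟩, .cut 396, [162369636889877249, 92618833210260225, 11971204111321414401, 7870199035274025729, 234343668044094209, 234343668044094209, 402160755577861714561, 402160755579944313411, 401658672668435692289, 401658672655483759361, 401726160827243176515, 401726160825160577665, 383491384172383902213, 383491375442793734723, 383788389347029564161, 383788389334077631233, 383491388705573052995, 383491384172383506951, 383090617048304274049, 383090617048306307651, 383090331404787137281, 383090331391835204353, 383090192639368122947, 383090192639366089345, 383079140639743220229, 383079140631207177091, 383079424249439599361, 383079424236487666433, 383079140644159110019, 383079140639742824967, 383078538159355026177,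 11971204317479844609, 383078538043067611905, 383078538030115678977, 11971204304527911681, 383078537744893172481, 11971204098369481601, 11971204108985899525, 11971204111321414401, 11971204098369481473, 11971204108985504263, 11971204111321414529, 11971204098369481601, 383078531501765389185, 383078531562285261697, 383078531147823408001, 383078531514717322113, 11971204111321414529, 383078531147823411841, 383078531487283091973, 11971204111321414401, 11971204098369481473, 383078531487282696711, 383078531562285265537, 383078531147823411841, 383078531487283091973, 11971204111321414401, 11971204098369481473, 383078531487282696711, 383078531562285265537, 383078531147823411969, 383078531652156275457, 11971204111321414401, 11971204098369481473, 383078531639204342529, 383078531562285265665, 92618833208165121, 160117837076192001, 232094067253664513, 232094067253664513, 7872448636064455425, 11971204111319319297, 402160685279919612483, 402160685277837013633, 401798148050454327937, 401798148052536926787, 401658672657629145857, 401658672668433597185, 383491377639669506627, 383491384172383902149, 383491384172383572423, 383491388703427666499, 383788389336223017729, 383788389347027469057, 383090616979653939779, 383090616979651906177, 383090262939390790273, 383090262939392823875, 383090331393980590849, 383090331404785042177, 383079140633352563587, 383079140639743220165, 383079140639742890439, 383079140644157014915, 383079424238633052929, 383079424249437504257, 11971204317477749505, 383078538159287982849, 383078537813545540353,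 11971204306673298177, 383078538032261065473, 383078538043065516801, 11971204108985899461, 11971204100514868097, 11971204111319319425, 11971204108985569735, 11971204100514867969, 11971204111319319297, 383078531503910775681, 11971204100514868097, 11971204111319319425, 383078531514715227009, 383078531216475775873, 383078531562218218369, 383078531487283091909, 383078531216475779713, 383078531562218222209, 383078531487282762183, 11971204100514867969, 11971204111319319297, 383078531487283091909, 383078531216475779713, 383078531562218222209, 383078531487282762183, 11971204100514867969, 11971204111319319297, 383078531652154180353, 383078531216475779841, 383078531562218222337, 383078531641349729025, 11971204100514867969, 11971204111319319297, 234356862183627521, 92618833143216897, 11971204111254371073, 7451364269928569601, 162356442750343937, 162356442750343937, 402158505977071284865, 402158505979153883715, 401658672668368648961, 401658672655550802689, 401728410428033606211, 401728410425951007361, 383491384172383900167, 383491375511446102595, 383788389346962520833, 383788389334144674561, 383491388636920685123, 383491384172383508997, 383090614851428502145, 383090614851430535747, 383090331404720093953, 383090331391902247681, 383090194836243894851, 383090194836241861249, 383079140639743218183, 383079140631274220419, 383079424249372556033, 383079424236554709761, 383079140644092066691, 383079140639742827013, 383078538157209639681, 11971204317412801281, 383078538043000568577, 383078538030182722305, 11971204304594955009,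 383078537747038558977, 11971204098436524929, 11971204108985897479, 11971204111254371073, 11971204098436524801, 11971204108985506309, 11971204111254371201, 11971204098436524929, 383078531501832432513, 383078531560139875201, 383078531149968794497, 383078531514650278785, 11971204111254371201, 383078531149968798337, 383078531487283089927, 11971204111254371073, 11971204098436524801, 383078531487282698757, 383078531560139879041, 383078531149968798337, 383078531487283089927, 11971204111254371073, 11971204098436524801, 383078531487282698757, 383078531560139879041, 383078531149968798465, 383078531652089232129, 11971204111254371073, 11971204098436524801, 383078531639271385857, 383078531560139879169, 92618833141121793, 232105062369942273, 160106841959914241, 160106841959914241, 7523419664943241985, 11971204111252275969, 402158435679129182787, 402158435677046583937, 401800397651244757633, 401800397653327356483, 401658672657696189185, 401658672668366553857, 383491377708321874499, 383491384172383900103, 383491384172383574469, 383491388634775298627, 383788389336290061057, 383788389346960425729, 383090614782778167875, 383090614782776134273, 383090265136266562177, 383090265136268595779, 383090331394047634177, 383090331404717998849, 383079140633419606915, 383079140639743218119, 383079140639742892485, 383079140644089971587, 383079424238700096257, 383079424249370460929, 11971204317410706177, 383078538157142596353, 383078537815690926849, 11971204306740341505, 383078538032328108801, 383078538042998473473, 11971204108985897415,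 11971204100581911425, 11971204111252276097, 11971204108985571781, 11971204100581911297, 11971204111252275969, 383078531503977819009, 11971204100581911425, 11971204111252276097, 383078531514648183681, 383078531218621162369, 383078531560072831873, 383078531487283089863, 383078531218621166209, 383078531560072835713, 383078531487282764229, 11971204100581911297, 11971204111252275969, 383078531487283089863, 383078531218621166209, 383078531560072835713, 383078531487282764229, 11971204100581911297, 11971204111252275969, 383078531652087137025, 383078531218621166337, 383078531560072835841, 383078531641416772353, 11971204100581911297, 11971204111252275969]⟩,
  ⟨⟨6, 13, [(5, 6), (4, 7), (4, 9), (3, 7), (3, 9), (2, 6), (2, 11), (1, 8), (1, 10), (0, 8), (0, 12), (6, 10), (7, 8), (9, 11), (10, 12), (11, 12)]⟩, .leaf 5, [196095469970194268439552, 236749399356342787, 232245799728972291, 308736624650093059, 304233025022722563, 9735188268219763201, 311526045686019009349, 9735188253201486593, 304224632912546305, 9735188253201425027, 304224632912544259, 9735188253202057729, 9879167307789107715, 9735192857201607171, 9735188253202057729, 9735188253202186755]⟩,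
  ⟨⟨6, 14, [(5, 6), (5, 8), (4, 6), (4, 8), (3, 9), (3, 9), (2, 7), (2, 12), (1, 7), (1, 13), (0, 10), (0, 11), (6, 7), (8, 10), (9, 11), (10, 12), (11, 13), (12, 13)]⟩, .cut 520, [313989706622064923075, 313989355121941418435, 309378020603637535171, 309377669103514030531, 387704625322865201603, 387704273822741696963, 383092939304437813699, 383092587804314309059, 12405883597518608222913, 12405883597518597747393, 383076888767049437635, 383076888777776370115, 12405883665754901138113, 12405883665754890662593, 383076888767049435589, 383076888777776368069, 12258461265037493304199, 12258461265037493303879, 12258460449684929186245, 12258460449341667346885, 12405902504532713935299, 12405902153032590430659, 12258472667131113378243, 12258472315630989873603, 12258460440545582649795, 12258460440888844489155, 12258460440545582713285, 12258460440888844552645, 12258460440545582649795, 12258460440888844489155]⟩,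
  ⟨⟨6, 13, [(5, 10), (4, 6), (4, 8), (3, 6), (3, 8), (2, 7), (2, 9), (1, 7), (1, 11), (0, 9), (0, 12), (6, 7), (8, 10), (9, 11), (10, 12), (11, 12)]⟩, .leaf 5, [196188766521899079974912, 234497608780419523, 229994009153049027, 306484834074169795, 301981234446799299, 9663058312377164483, 9663058312373033537, 9807025951019248451, 301970572259562049, 9663058312249936325, 301970572257595843, 9807039354244764099, 9663064903657263555, 9663058312964805185, 9663058313029947843, 9663058312964805185]⟩,
  ⟨⟨6, 14, [(5, 7), (5, 8), (4, 6), (4, 9), (3, 6), (3, 9), (2, 10), (2, 10), (1, 7), (1, 11), (0, 8), (0, 12), (6, 7), (8, 11), (9, 13), (10, 13), (11, 12), (12, 13)]⟩, .cut 1028, [316130671405205650309, 316130671405205650053, 9895050853360003537409, 9895051134560102341121, 242436513617177749955, 242436232417078946243, 180946055285225040323, 171722683248370264515, 316151432317978028483, 316151151117879224771, 180943805684434610627, 171720433647579834819, 316130679970181774213, 316130679970181773957, 309220339167491729921, 309220347954994817537, 12325550573331791028615, 12325550573057181557127, 309220339167489698243, 309220347954992785859, 10116200394258291108291, 10116200113058192304579,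 9895050853360393988609, 9895051134560492792321, 9895055638155890272707, 9895055356955791468995, 9895050853360393988609, 9895051134560492792321, 9895050853360459065795, 9895051134560557869507]⟩,
  ⟨⟨6, 11, [(5, 8), (4, 6), (4, 6), (3, 6), (3, 7), (2, 7), (2, 9), (1, 7), (1, 10), (0, 8), (0, 9), (8, 10), (9, 10)]⟩, .cut 80, [7187175188271555, 7538675311776195, 12418970862934311555, 12407722858982163075, 6720491640207696250880, 3769102660406715402240, 378322323864164803, 378322323528948163, 12106331191268104965, 12106331191278580485, 378322312593955587, 378322312604431107, 378322312593955587, 378322312604431107, 12128279777751335493, 12128279788478267973, 12106544700536801923, 12106533716157942403, 12106314003006579331, 12106314003341795971, 12106314003006579331, 12106314003341795971]⟩,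
  ⟨⟨6, 13, [(5, 6), (4, 6), (4, 7), (3, 7), (3, 8), (2, 8), (2, 10), (1, 9), (1, 11), (0, 9), (0, 12), (6, 10), (7, 10), (8, 11), (9, 12), (11, 12)]⟩, .cut 3582, [162356374106300995, 5073636690821891, 162356374098739971, 162356374104205891, 5073636690756419, 162356374098674499, 5073636690821699, 162356374106294979, 162356374097914563, 162356374105031235, 162356374104769347, 5073636690559811, 162356374107062851, 162356374106866435, 5073636690559747, 5073636690756163, 162356374104197827, 162356374097912515, 12797456359024796906117, 399920494307763827333, 12786909139803727737477, 12792849176605996888709, 399776519857176326789, 12786765165353140236933, 399920283201531294341, 12797449814731588383365, 12785931858684588339845, 12793826457725136286341, 12793466521598667534981, 399560347075062542981, 12798294028555487818373, 12798078066879606567557, 399560206337574187653, 399776168013455438469, 12792838269450649350789, 12785927495822449324677, 383495589107031106115, 11984237159594722051, 383495589107021513475, 383495589107026915907, 11984237159594591107, 383495589107021382531, 11984237159594721859, 383495589107031100099, 383495589107020624579, 383495589107027804739, 383495589107027477379, 11984237159594394499, 383495589107031867971, 383495589107031671555, 11984237159594394371, 11984237159594590787, 383495589107026905795, 383495589107020620483,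 12258829737909538732677, 383088429293157694085, 12258819437890768157317, 12258825238707957873285, 383088288693108292229, 12258819297290718755461, 383088429086999263877, 12258829731518627396229, 12258818483514675247749, 12258826193084050782853, 12258825841583927278213, 383088077586875759237, 12258830555946189798021, 12258830345046115695237, 383088077449436805765, 383088288349510908549, 12258825228056438979205, 12258818479254067690117, 383074641146909057603, 11971082535840908035, 383074641146899464963, 383074641146904867395, 11971082535840777091, 383074641146899334019, 11971082535840907843, 383074641146909051587, 383074641146898576067, 383074641146905756227, 383074641146905428867, 11971082535840580483, 383074641146909819459, 383074641146909623043, 11971082535840580355, 11971082535840776771, 383074641146904857283, 383074641146898571971, 383074173160752503301, 11971067911273011717, 383074172846420875781, 383074173023447767557, 11971067906982238725, 383074172842130102789, 11971067911266720261, 383074173160557468165, 383074172817295628805, 383074173052573014533, 383074173041846082053, 11971067900539787781, 383074173185717000709, 383074173179280841221, 11971067900535593477, 11971067906971752965, 383074173023122708997, 383074172817165605381, 383074161961430184773, 11971067561300226885, 383074161961607252805, 383074161961434374981, 11971067561304417093, 383074161961741339461, 11971067561293935429, 383074161961625219909, 383074161961635695429, 383074161961405932357, 383074161961741148997, 11971067561304410949,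 383074161961405805381, 383074161961606935365, 11971067561300216645, 11971067561293931333, 383074161961759433541, 383074161961765718853, 11971067542782370371, 374095860711949059, 11971067542772777731, 11971067542778180163, 374095860711818115, 11971067542772646787, 374095860711948867, 11971067542782364355, 11971067542771888835, 11971067542779068995, 11971067542778741635, 374095860711621507, 11971067542783132227, 11971067542782935811, 374095860711621379, 374095860711817795, 11971067542778170051, 11971067542771884739, 6901912890635298771304964, 5656460247940512489684994, 5656460247940512489684992, 6921445110305595669364740, 5655279692348592097345538, 5655851541414877093429760, 7469848923319260723298306, 6900197343436443783004676, 6921391499455631450980356, 7469848923319260723298304, 7469184930604599726834176, 7466897534339459742449666, 8678166000379457482785280, 8678110714190431882576384, 8675823317925291898191874, 8677594151313172486701058, 6900233084003086595260932, 6902002242051905801945604, 383074161362554872387, 11971067542579839747, 383074161362545279747, 383074161362550682179, 11971067542579708803, 383074161362545148803, 11971067542579839555, 383074161362554866371, 383074161362544390851, 383074161362551571011, 383074161362551243651, 11971067542579512195, 383074161362555634243, 383074161362555437827, 11971067542579512067, 11971067542579708483, 383074161362550672067, 383074161362544386755, 383074161362554872387, 11971067542579839747, 383074161362545279747, 383074161362550682179,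 11971067542579708803, 383074161362545148803, 11971067542579839555, 383074161362554866371, 383074161362544390851, 383074161362551571011, 383074161362551243651, 11971067542579512195, 383074161362555634243, 383074161362555437827, 11971067542579512067, 11971067542579708483, 383074161362550672067, 383074161362544386755, 8129190338299507432767492, 5694202286315322232291328, 5694202286315322232291330, 8091448299924697690161156, 5693021730723401839951872, 5693021730723401839951874, 7507590961694070465904640, 8129136727449543214383108, 8071344231188115796001284, 7507590961694070465904642, 7504639572714269485056002, 7505783270846839477240320, 8715336189687982229307394, 8713565356300101640798210, 8714709054432671632982528, 8715336189687982229307392, 8091358948508090659520516, 8071379971754758608257540]⟩,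
  ⟨⟨6, 15, [(5, 6), (4, 6), (4, 7), (3, 7), (3, 8), (2, 8), (2, 10), (1, 9), (1, 11), (0, 9), (0, 12), (6, 10), (7, 10), (8, 13), (9, 14), (11, 13), (11, 14), (12, 13), (12, 14)]⟩, .cut 1532, [5195403971537891905, 5195403971423992385, 5073636690954817, 162356374107062851, 5195403971535860291, 5195403971423980481, 5073636690952771, 162356374106999361, 5195403971565128257, 162356374106999361, 162356374111193665, 162356374107062851, 162356374111193665, 162356374106999361, 162356374111257155, 162356374106999361, 162356374111257155, 162356374106999361, 13260505264247173831471749, 13254207658710113200648837, 12949706690835494744709, 12943562138479547921029, 13260433783182057927881349, 13254136177644997297058437, 12949634701411177738885, 12943492330486300422789, 13261465792043869131780741, 13254207629465302925062789, 414413115496004107645573, 414193988420910648144517, 414413115496004107645573, 414193988420910648144517, 414415349349589004333701, 414191754567325751456389, 414415349349589004333701, 414191754567325751456389, 12271858851429426623041, 12271858851429245616705, 11984237159599049281, 383495589107163988547, 12271858851429424591427, 12271858851429245602817, 11984237159599047235, 383495589107163925057, 12271858851429453859393, 383495589107163925057, 383495589107170216513, 383495589107163988547, 383495589107170216513, 383495589107163925057,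 383495589107170280003, 383495589107163925057, 383495589107170280003, 383495589107163925057, 12553193907432459245664901, 12553187757427051959892613, 12258978419874197617285, 12258972419334787512965, 12553193837626731593415301, 12553187687621324307643013, 12258978349572025432709, 12258972351162919107205, 12553194845447885705919109, 12553187757398492574857861, 392287331409987281042053, 392287117418703010085509, 392287331409987281042053, 392287117418703010085509, 392287333591484922542725, 392287115237205368584837, 392287333591484922542725, 392287115237205368584837, 12258388516705521070657, 12258388516705340064321, 11971082535845235265, 383074641147041940035, 12258388516705519039043, 12258388516705340050433, 11971082535845233219, 383074641147041876545, 12258388516705548307009, 383074641147041876545, 383074641147048168001, 383074641147041940035, 383074641147048168001, 383074641147041876545, 383074641147048231491, 383074641147041876545, 383074641147048231491, 383074641147041876545, 392267957963089234389509, 392267957775405963903493, 383074177698165975557, 383074177515044045317, 392267957960958932642309, 392267957773275662156293, 383074177696020523525, 383074177512963604997, 392267957991715193448965, 392267957775405092340229, 12258373687011904875013, 12258373680481409139205, 12258373687011904875013, 12258373680481409139205, 12258373687078478899717, 12258373680414835114501, 12258373687078478899717, 12258373680414835114501, 392267942012807268107205, 392267942200490538593221, 383074162121881256901, 383074162305003187141,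 392267942010676966360005, 392267942198360236846021, 383074162119800816581, 383074162302857735109, 392267942012806396543941, 392267942229116497652677, 12258373187900199896005, 12258373194430695631813, 12258373187900199896005, 12258373194430695631813, 12258373187833625871301, 12258373194497269656517, 12258373187833625871301, 12258373194497269656517, 383074161373467079233, 383074161373286072897, 374095860716276289, 11971067542915252803, 383074161373465047619, 383074161373286059009, 374095860716274243, 11971067542915189313, 383074161373494315585, 11971067542915189313, 11971067542921480769, 11971067542915252803, 11971067542921480769, 11971067542915189313, 11971067542921544259, 11971067542915189313, 11971067542921544259, 11971067542915189313, 12258373163606187143745, 12258373163606006137409, 11971067542584166977, 383074161362687754819, 12258373163606185112131, 12258373163606006123521, 11971067542584164931, 383074161362687691329, 12258373163606214380097, 383074161362687691329, 383074161362693982785, 383074161362687754819, 383074161362693982785, 383074161362687691329, 383074161362694046275, 383074161362687691329, 383074161362694046275, 383074161362687691329, 12258373163606187143745, 12258373163606006137409, 11971067542584166977, 383074161362687754819, 12258373163606185112131, 12258373163606006123521, 11971067542584164931, 383074161362687691329, 12258373163606214380097, 383074161362687691329, 383074161362693982785, 383074161362687754819, 383074161362693982785, 383074161362687691329, 383074161362694046275,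 383074161362687691329, 383074161362694046275, 383074161362687691329]⟩,
  ⟨⟨6, 15, [(5, 6), (4, 6), (4, 7), (3, 7), (3, 8), (2, 8), (2, 10), (1, 9), (1, 11), (0, 9), (0, 12), (6, 10), (7, 10), (8, 13), (9, 14), (11, 12), (11, 13), (12, 14), (13, 14)]⟩, .cut 1532, [162356374110558977, 5195403971423992385, 5073636690954817, 5195403971424881217, 162356374110495427, 5195403971423980481, 5073636690952771, 162356374106999361, 5195403971554007809, 162356374106999361, 162356374111193665, 162356374106999361, 162356374111193665, 5195403971433007681, 162356374111257155, 162356374106999361, 5195403971563031105, 162356374106999361, 13260505100503504176558725, 13254375332227839831585413, 414390614102691857838725, 414192527543791287284357, 13260433783182057927881349, 13254375402101803776750213, 12949634701411177738885, 12943492330486300422789, 13261465792043869131780741, 13254136146150586231042693, 414415349349589004333701, 414191754567325751456389, 13261219695874684540433029, 13254382242319770822390405, 414415349349589004333701, 414191754567325751456389, 13261465792043869131780741, 13254136146150586231042693, 383495589107169581825, 12271858851429245616705, 11984237159599049281, 12271858851429246569025, 383495589107169518275, 12271858851429245602817, 11984237159599047235, 383495589107163925057, 12271858851429442738945, 383495589107163925057,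 383495589107170216513, 383495589107163925057, 383495589107170216513, 12271858851429256727105, 383495589107170280003, 383495589107163925057, 12271858851429451762241, 383495589107163925057, 12553193907272553318267525, 12553187921170721614805637, 392287309435970374548101, 392287115992065198209669, 12553193837626731593415301, 12553187921238957907720837, 12258978349572025432709, 12258972351162919107205, 12553194845447885705919109, 12553187687590568046836357, 392287333591484922542725, 392287115237205368584837, 12553194605119595486591621, 12553187927918858266163845, 392287333591484922542725, 392287115237205368584837, 12553194845447885705919109, 12553187687590568046836357, 383074641147047533313, 12258388516705340064321, 11971082535845235265, 12258388516705341016641, 383074641147047469763, 12258388516705340050433, 11971082535845233219, 383074641147041876545, 12258388516705537186561, 383074641147041876545, 383074641147048168001, 383074641147041876545, 383074641147048168001, 12258388516705351174721, 383074641147048231491, 383074641147041876545, 12258388516705546209857, 383074641147041876545, 392267957963084354447877, 392267957780403024134661, 12258373686341311097349, 12258373680437871608325, 392267957960958932642309, 392267957780405106541061, 383074177696020523525, 383074177512963604997, 392267957991715193448965, 392267957773274723549701, 12258373687078478899717, 12258373680414835114501, 392267957984380956076549, 392267957780608960922117, 12258373687078478899717, 12258373680414835114501, 392267957991715193448965,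 392267957773274723549701, 392267942017804328338373, 392267942200485658651589, 12258373187856662365125, 12258373193760101854149, 392267942017806410744773, 392267942198360236846021, 383074162119800816581, 383074162302857735109, 392267942010676027753413, 392267942229116497652677, 12258373187833625871301, 12258373194497269656517, 392267942018010265125829, 392267942221782260280261, 12258373187833625871301, 12258373194497269656517, 392267942010676027753413, 392267942229116497652677, 11971067542920846081, 383074161373286072897, 374095860716276289, 383074161373287025217, 11971067542920782531, 383074161373286059009, 374095860716274243, 11971067542915189313, 383074161373483195137, 11971067542915189313, 11971067542921480769, 11971067542915189313, 11971067542921480769, 383074161373297183297, 11971067542921544259, 11971067542915189313, 383074161373492218433, 11971067542915189313, 383074161362693348097, 12258373163606006137409, 11971067542584166977, 12258373163606007089729, 383074161362693284547, 12258373163606006123521, 11971067542584164931, 383074161362687691329, 12258373163606203259649, 383074161362687691329, 383074161362693982785, 383074161362687691329, 383074161362693982785, 12258373163606017247809, 383074161362694046275, 383074161362687691329, 12258373163606212282945, 383074161362687691329, 383074161362693348097, 12258373163606006137409, 11971067542584166977, 12258373163606007089729, 383074161362693284547, 12258373163606006123521, 11971067542584164931, 383074161362687691329, 12258373163606203259649,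 383074161362687691329, 383074161362693982785, 383074161362687691329, 383074161362693982785, 12258373163606017247809, 383074161362694046275, 383074161362687691329, 12258373163606212282945, 383074161362687691329]⟩,
  ⟨⟨6, 15, [(5, 6), (4, 6), (4, 7), (3, 7), (3, 8), (2, 8), (2, 9), (1, 10), (1, 12), (0, 11), (0, 13), (6, 9), (7, 9), (8, 14), (10, 11), (10, 13), (11, 12), (12, 14), (13, 14)]⟩, .cut 1020, [162356374110560961, 5195403971495222019, 162356374110556865, 5195403971495221891, 162356374110497411, 5195403971493188417, 162356374110493315, 5195403971493188289, 5195403971556106945, 5195403971493188417, 5195403971556106945, 5195403971493188289, 5195403971560297153, 5195403971493188289, 5195403971560297153, 5195403971495221891, 5195403971562330755, 5195403971493188289, 414390854205313758016069, 414270086495880280814149, 414390710090125682160197, 414270086355142792458821, 414388618236268489486917, 414267850526835012284997, 414388474121080413631045, 414267850386097523929669, 13261217700001664102314565, 13256642767855535077470789, 13261365129839065702871621, 13256642767855535077470789, 13261217700001664102314565, 13256571216848285507793477, 13261293578831816133194309, 13256642763356333496611397, 13261365129839065702871621, 13256571212349083926934085, 383423531513131655873, 12269553008420103150339, 383423531513131651777,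 12269553008420103150211, 383423531513131592323, 12269553008420101116737, 383423531513131588227, 12269553008420101116609, 12269553008420231144129, 12269553008420101116737, 12269553008420231144129, 12269553008420101116609, 12269553008420235334337, 12269553008420101116609, 12269553008420235334337, 12269553008420103150211, 12269553008420237367939, 12269553008420101116609, 392287309670445591247429, 392287191733229347617349, 392287309529708102892101, 392287191733091908663877, 392287307486882070477381, 392287189549665826847301, 392287307346144582122053, 392287189549528387893829, 12553194603170500740069957, 12553190135463326785944133, 12553194747144951327570501, 12553190135463326785944133, 12553194603170500740069957, 12553190065589296268786245, 12553194677270920810412613, 12553190135458933034400325, 12553194747144951327570501, 12553190065584902517242437, 383074570778303357633, 12258386264905597606659, 383074570778303353537, 12258386264905597606531, 383074570778303294083, 12258386264905595573057, 383074570778303289987, 12258386264905595572929, 12258386264905725600449, 12258386264905595573057, 12258386264905725600449, 12258386264905595572929, 12258386264905729790657, 12258386264905595572929, 12258386264905729790657, 12258386264905597606531, 12258386264905731824259, 12258386264905595572929, 12258373686348466713093, 12258373682749308502533, 12258373686344171745797, 12258373682749304308229, 12258373686281829642757, 12258373682682671432197, 12258373686277534675461, 12258373682682667237893, 392267957984321474425349,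 392267957847977871704581, 392267957988715225969157, 392267957847977871704581, 392267957984321474425349, 392267957845845485519365, 392267957986582839783941, 392267957847977737617925, 392267957988715225969157, 392267957845845351432709, 12258373190168099259333, 12258373193767257469893, 12258373190168095065029, 12258373193762962502597, 12258373190101462188997, 12258373193700620399557, 12258373190101457994693, 12258373193696325432261, 392267942085379175908293, 392267942221722778629061, 392267942085379175908293, 392267942226116530172869, 392267942083246789723077, 392267942221722778629061, 392267942085379041821637, 392267942223984143987653, 392267942083246655636421, 392267942226116530172869, 11971067542920848065, 383074161373357300483, 11971067542920843969, 383074161373357300355, 11971067542920784515, 383074161373355266881, 11971067542920780419, 383074161373355266753, 383074161373485294273, 383074161373355266881, 383074161373485294273, 383074161373355266753, 383074161373489484481, 383074161373355266753, 383074161373489484481, 383074161373357300355, 383074161373491518083, 383074161373355266753, 383074161360545866433, 12258373163537357888259, 383074161360545862337, 12258373163537357888131, 383074161360545802883, 12258373163537355854657, 383074161360545798787, 12258373163537355854529, 12258373163537485882049, 12258373163537355854657, 12258373163537485882049, 12258373163537355854529, 12258373163537490072257, 12258373163537355854529, 12258373163537490072257, 12258373163537357888131, 12258373163537492105859, 12258373163537355854529,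 383074161360545866433, 12258373163537357888259, 383074161360545862337, 12258373163537357888131, 383074161360545802883, 12258373163537355854657, 383074161360545798787, 12258373163537355854529, 12258373163537485882049, 12258373163537355854657, 12258373163537485882049, 12258373163537355854529, 12258373163537490072257, 12258373163537355854529, 12258373163537490072257, 12258373163537357888131, 12258373163537492105859, 12258373163537355854529]⟩,
  ⟨⟨6, 10, [(4, 5), (4, 7), (3, 8), (2, 6), (2, 7), (1, 6), (1, 8), (0, 6), (0, 9), (7, 9), (8, 9)]⟩, .leaf 3, [4888015145345, 5336313747253248112, 11562687695829569, 4779571636464535112, 361125823121793, 11556486090725891, 11556017551186563, 11556017620075073, 361125550496385, 361125550496385, 11556017615884865, 11556017615884865]⟩,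
  ⟨⟨6, 8, [(3, 5), (2, 4), (1, 3), (2, 6), (1, 6), (0, 7), (0, 7), (6, 7)]⟩, .cut 126, [350119666177, 350119666113, 279577831937, 279577831873, 166214342094176264, 131311444982054920, 166214359811391494, 131311462699270150, 166214343721500672, 131311446609379328, 358522865401993, 358522999488649, 358527294451849, 358527160365193]⟩,
  ⟨⟨6, 10, [(3, 5), (2, 4), (3, 6), (2, 7), (1, 6), (1, 7), (0, 8), (0, 9), (6, 8), (7, 9), (8, 9)]⟩, .cut 254, [11214241538689, 11214241538689, 358855729234497, 11214241538625, 11214241538625, 358855729234497, 11214241538689, 11214241538689, 11214241538561, 358855729236481, 358855729236481, 11214241538561, 358855729238529, 358855729238529, 11214241538561, 11214241538625, 11214241538625, 11214241538561, 8948644260481, 8948644260481, 286356616331841, 8948644260417, 8948644260417, 286356616331841, 8948644260481, 8948644260481, 8948644260353, 286356616333825, 286356616333825, 8948644260353, 286356616335873, 286356616335873, 8948644260353, 8948644260417, 8948644260417, 8948644260353, 154080707991348756488, 152963815283760873492, 152963815283760873486, 152963815283760873480, 154080707991348756500, 154080707991348756494, 170834098605167001620, 172509437666548826120, 170834098605167001608,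 170834098605167001614, 172509437666548826126, 172509437666548826132, 207691557955567140878, 208250004309361082382, 208250004309361082388, 207691557955567140884, 208250004309361082376, 207691557955567140872, 152964377701658427412, 154081270409246310408, 154081270409246310414, 154081270409246310420, 152964377701658427400, 152964377701658427406, 172510000084446380040, 170834661023064555540, 172510000084446380052, 172510000084446380046, 170834661023064555534, 170834661023064555528, 208250566727258636302, 207692120373464694798, 207692120373464694792, 208250566727258636296, 207692120373464694804, 208250566727258636308, 367771266205169801, 11492852064401545, 367765405789403273, 367766872453625993, 11492714759665801, 367765268484667529, 11492851997292681, 367771264124795017, 367764673497479305, 367767604745549961, 367767398788446345, 11492646040189065, 367771865353107593, 367771796700739721, 11492645905971337, 11492714558339209, 367766866212501641, 367764669336729737, 11483383797076105, 367468279939944585, 367468285797093513, 11483383931162761, 367468280074031241, 367468281506320521, 367468282020319369, 11483383729967241, 11483383931097225, 367468285795061897, 367468279358902409, 367468282221449353, 367468281500225673, 367468279354839177, 367468286382198921, 367468286315155593, 11483383729836169, 11483383796879497, 367483793516345481, 11483918675032201, 367485397485303945, 367483930821081225, 11484055979767945, 367489791236847753, 11483849955555465, 367485923820124297, 367486129777227913,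 367483198529157257, 367489789156472969, 11484055912659081, 367483194368407689, 367485391244179593, 11483918473705609, 11483849821337737, 367490321732417673, 367490390384785545, 11483390373607561, 367468491955517577, 367468486098368649, 11483390239520905, 367468487664744585, 367468486232455305, 367468491953485961, 11483390373542025, 11483390172412041, 367468488178743433, 367468488379873417, 367468485517326473, 367468492473579657, 367468492540622985, 367468485513263241, 367468487658649737, 11483390239324297, 11483390172280969]⟩,
  ⟨⟨6, 7, [(4, 5), (3, 4), (2, 3), (2, 6), (1, 6), (0, 6)]⟩, .leaf 1, [11012288577, 4505012609, 126496517735006, 109489505174088, 109489504158252, 352393300353, 126531935404544, 352393234881]⟩,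
  ⟨⟨6, 8, [(4, 5), (3, 4), (2, 3), (2, 6), (1, 6), (0, 7), (0, 7), (6, 7)]⟩, .cut 126, [352393234945, 352393234881, 81745160705, 81745160641, 166214324963590166, 131311427851468822, 131277378408169474, 166180275520290818, 131277378407661568, 166180275519782912, 360850823068035, 360850818877827, 360850684660227, 360850688850435]⟩,
  ⟨⟨6, 10, [(4, 5), (3, 4), (3, 6), (2, 7), (1, 6), (1, 7), (0, 8), (0, 9), (6, 8), (7, 9), (8, 9)]⟩, .cut 254, [11276841849473, 11276841849473, 360858939179585, 11276841849409, 11276841849409, 360858939179585, 11276841849473, 11276841849473, 11276841849345, 360858939181569, 360858939181569, 11276841849345, 360858939183617, 360858939183617, 11276841849345, 11276841849409, 11276841849409, 11276841849345, 4881639549569, 4881639549569, 156212465582657, 4881639549505, 4881639549505, 156212465582657, 4881639549569, 4881639549569, 4881639549441, 156212465584641, 156212465584641, 4881639549441, 156212465586689, 156212465586689, 4881639549441, 4881639549505, 4881639549505, 4881639549441, 152964309514774921244, 152964309514774921250, 154081202222362804246, 154081202222362804252, 154081202222362804258, 152964309514774921238, 170834592836181049378, 170834592836181049372, 172509931897562873884,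 172509931897562873878, 170834592836181049366, 172509931897562873890, 208250498540375130134, 207692052186581188630, 208250498540375130146, 207692052186581188642, 207692052186581188636, 208250498540375130140, 152963764174674477058, 152963764174674477064, 152963764174674477070, 154080656882262360066, 154080656882262360072, 154080656882262360078, 170834047496080605192, 170834047496080605186, 172509386557462429698, 170834047496080605198, 172509386557462429710, 172509386557462429704, 207691506846480744462, 208249953200274685966, 208249953200274685960, 207691506846480744456, 207691506846480744450, 208249953200274685954, 369529022444865989, 11547781951261125, 369528839306873285, 369528885140130245, 11547777660488133, 369528835016100293, 11547781949163973, 369529022379854277, 369528816422750661, 369528908024252869, 369528901588093381, 11547775513004485, 369529041168239045, 369529039022852549, 11547775508810181, 11547777654196677, 369528884945095109, 369528816292727237, 11547486067907205, 369519554124077701, 369519554307113605, 11547486072097413, 369519554128267909, 369519554173026949, 369519554189089413, 11547486065810053, 11547486072095365, 369519554307050117, 369519554105920133, 369519554195374725, 369519554172836485, 369519554105793157, 369519554325398149, 369519554323303045, 11547486065805957, 11547486067901061, 369520038923340229, 11547502782843333, 369520089047370181, 369520043214113221, 11547507073616325, 369520226352105925, 11547500635359685, 369520105495333317, 369520111931492805,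 369520020329990597, 369520226287094213, 11547507071519173, 369520020199967173, 369520088852335045, 11547502776551877, 11547500631165381, 369520242930092485, 369520245075478981, 11547486273423813, 369519560749564357, 369519560566528453, 11547486269233605, 369519560615477701, 369519560570718661, 369519560749500869, 11547486273421765, 11547486267136453, 369519560631540165, 369519560637825477, 369519560548370885, 369519560765753797, 369519560767848901, 369519560548243909, 369519560615287237, 11547486269227461, 11547486267132357]⟩,
  ⟨⟨6, 10, [(4, 5), (4, 6), (2, 3), (3, 6), (2, 7), (1, 7), (0, 8), (0, 9), (6, 8), (7, 9), (8, 9)]⟩, .cut 254, [11283085068929, 11283085068929, 361058722202177, 11283085068865, 11283085068865, 361058722202177, 11283085068929, 11283085068929, 11283085068801, 361058722204161, 361058722204161, 11283085068801, 361058722206209, 361058722206209, 11283085068801, 11283085068865, 11283085068865, 11283085068801, 2684568742529, 2684568742529, 85906199757377, 2684568742465, 2684568742465, 85906199757377, 2684568742529, 2684568742529, 2684568742401, 85906199759361, 85906199759361, 2684568742401, 85906199761409, 85906199761409, 2684568742401, 2684568742465, 2684568742465, 2684568742401, 154082889388530401306, 154082889388530401300, 152965996680942518304, 152965996680942518298,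 152965996680942518292, 154082889388530401312, 172511619063730470932, 172511619063730470938, 170836280002348646426, 170836280002348646432, 172511619063730470944, 170836280002348646420, 207693739352748785696, 208252185706542727200, 207693739352748785684, 208252185706542727188, 208252185706542727194, 207693739352748785690, 370023066018976195, 11563220808700355, 370017205603209667, 370018672267432387, 11563083503964611, 370017068298473923, 11563220741591491, 370023063938601411, 370016473311285699, 370019404559356355, 370019198602252739, 11563014784487875, 370023665166913987, 370023596514546115, 11563014650270147, 11563083302638019, 370018666026308035, 370016469150536131, 154082906483036028940, 154082906483036028934, 154082906483036028928, 152966013775448145932, 152966013775448145926, 152966013775448145920, 172511636158236098566, 172511636158236098572, 170836297096854274060, 172511636158236098560, 170836297096854274048, 170836297096854274054, 208252202801048354816, 207693756447254413312, 207693756447254413318, 208252202801048354822, 208252202801048354828, 207693756447254413324, 369735593330151875, 11554287419331011, 369737197299110339, 369735730634887619, 11554424724066755, 369741591050654147, 11554218699854275, 369737723633930691, 369737929591034307, 369734998342963651, 369741588970279363, 11554424656957891, 369734994182214083, 369737191057985987, 11554287218004419, 11554218565636547, 369742121546224067, 369742190198591939, 11553879332243907, 369724138631807427, 369724138448771523,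 11553879328053699, 369724138497720771, 369724138452961731, 369724138631743939, 11553879332241859, 11553879325956547, 369724138513783235, 369724138520068547, 369724138430613955, 369724138647996867, 369724138650091971, 369724138430486979, 369724138497530307, 11553879328047555, 11553879325952451, 11553879126727299, 369724132006320771, 369724132189356675, 11553879130917507, 369724132010510979, 369724132055270019, 369724132071332483, 11553879124630147, 11553879130915459, 369724132189293187, 369724131988163203, 369724132077617795, 369724132055079555, 369724131988036227, 369724132207641219, 369724132205546115, 11553879124626051, 11553879126721155]⟩,
  ⟨⟨6, 12, [(4, 5), (4, 6), (3, 7), (2, 6), (2, 8), (1, 7), (1, 8), (0, 9), (0, 10), (6, 9), (7, 10), (8, 11), (9, 11), (10, 11)]⟩, .leaf 3, [292691367834177, 6683057669529622560880, 11567083599049281, 6683040320335631630336, 369737195070427651, 369722611504536129, 11553822895979137, 11831115326039726851, 361056965171969, 361056965171969, 11553822885503553, 11553822885503617, 369722332336118337, 11553822885503553, 11553822885503617]⟩,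
  ⟨⟨6, 13, [(4, 5), (4, 6), (3, 6), (3, 8), (2, 7), (2, 7), (1, 8), (1, 9), (0, 10), (0, 11), (6, 10), (7, 9), (8, 12), (9, 11), (10, 12), (11, 12)]⟩, .cut 132, [5429676398955201, 5007463933889217, 7465643137714854843416576, 7469184804490616020434944, 11849890311780381313, 11849468511632175745, 11831660683869778757, 11831660683869778373, 378598368377513206401, 378598355196258574977, 378597944500898853701, 378597944500898853317, 11831185019182205633, 11831185018779945665, 369724531501329281, 369724531513899905, 369724531501329281, 369724531513899905, 11831185008042537601, 11831185008444797569, 378597920257361207937, 378597920270233526913, 11831185008042537665, 11831185008444797633, 11831185008042537601, 11831185008444797569, 11831185008042537665, 11831185008444797633]⟩,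
  ⟨⟨6, 15, [(5, 6), (4, 6), (4, 7), (3, 7), (3, 8), (2, 8), (2, 11), (1, 9), (1, 12), (0, 10), (0, 13), (6, 9), (7, 10), (8, 14), (9, 12), (10, 14), (11, 12), (11, 13), (13, 14)]⟩, .cut 4610, [106199919232179009, 106199919232179009, 99444519791123265, 99444519791123265, 3191165663980968769, 3191165663980968769, 13021195199024497580865, 406912343241190955841, 406696381565309705025, 13014284425396297554753, 13008344388594028403521, 13008128426918147152705, 12270258685959997643585, 383637973463405321025, 383853935139286571841, 12270474647635878894401, 12276414684438148045633, 12283325458066348071745, 383095257281237039745, 12259048232881081236097, 12259041484078709947009, 383095046381162936961, 12259035472361446128257, 12259035683261520231041, 383074637108889224131, 383074637108889224131, 383074637108889223939, 383074637108889223939, 12258388387484455160579, 12258388387484455160579, 12258373754518191501953, 392267960144578424107649, 392267959933678350004865, 12258373747927564186241, 392267959745812185510529, 392267959752402812826241, 12258373189962073015235, 12258373189962073015235, 12258373189962073015043, 12258373189962073015043, 392267942078786336475907, 392267942078786336475907, 383074161375547513665, 12258373164017520302913, 12258373164011084143425, 383074161375346383681, 12258373164005350923073, 12258373164005552053057, 11971067542644030465,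 11971067542646064067, 11971067542646063875, 11971067542650315777, 383074161364810091521, 383074161364608961537, 11971067542644030465, 383074161364429798401, 383074161364436083713, 11971067542650315777, 383074161364810091521, 383074161364608961537, 383074161364608975489, 383074161364673659843, 383074161364673659651, 383074161364810105473, 12258373163673922929281, 12258373163667486769793, 12258373163667487224449, 12258373163669556986819, 12258373163669556986627, 12258373163673923383937, 392267941237565533745793, 392267941237359576642177, 383074161364608975489, 383074161364673659843, 383074161364673659651, 383074161364810105473, 12258373163673922929281, 12258373163667486769793, 383074161364608975681, 12258373163661753549633, 12258373163661954679617, 383074161364810105665, 12258373163673922929473, 12258373163667486769985, 383074161364608975681, 12258373163661753549633, 12258373163661954679617, 383074161364810105665, 12258373163673922929473, 12258373163667486769985, 106199919232179009, 106199919232179009, 2981748281308240705, 2981748281308240705, 92689120350067521, 92689120350067521, 406912132134958422849, 13021188654731289058113, 13014829783163674450753, 13015261706515436952385, 13007367107474889005889, 406480208783195921217, 383421800681291537217, 12276960042205524941633, 12283318913773139548993, 12269497366516739496769, 12277391965557287443265, 383853724033054038849, 12259048226490169899649, 383095257075078609537, 12259042438454802856577, 12259042016654654651009, 383094835274930403969,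 12259034728885427321473, 383074637108889224131, 383074637108889224131, 12258388387484455166531, 12258388387484455166531, 383074637108889223747, 383074637108889223747, 392267960144378708128385, 12258373754511749051009, 392267959963502602908289, 392267959950321348276865, 12258373741330494419585, 392267959722578559922817, 12258373189962073015235, 12258373189962073015235, 392267942078786336481859, 392267942078786336481859, 12258373189962073014851, 12258373189962073014851, 12258373164017514208065, 383074161375547317057, 12258373164011994307393, 12258373164011592047425, 383074161375145057089, 12258373164004641889089, 11971067542646064067, 11971067542637739009, 383074161364407641089, 383074161364809901057, 11971067542650309633, 11971067542646063683, 383074161364624833537, 11971067542637739009, 383074161364407641089, 383074161364809901057, 11971067542650309633, 383074161364637404161, 383074161364673659843, 383074161364407648897, 12258373163661044515457, 12258373163673916834433, 383074161364809908865, 383074161364673659459, 12258373163669556986819, 12258373163661044773505, 392267941237153424503425, 392267941237565338710657, 12258373163673917092481, 12258373163669556986435, 383074161364673659843, 383074161364407648897, 12258373163661044515457, 12258373163673916834433, 383074161364809908865, 383074161364673659459, 12258373163667994673985, 383074161364407649089, 12258373163661044515649, 12258373163673916834625, 383074161364809909057, 12258373163668396933953, 12258373163667994673985, 383074161364407649089,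 12258373163661044515649, 12258373163673916834625, 383074161364809909057, 12258373163668396933953, 2988503680749296449, 2988503680749296449, 99444519791123265, 99444519791123265, 92689120350067521, 92689120350067521, 13021963062760964250433, 13021747101085082999617, 13014271336809880509249, 406695959352844639041, 406479997676963388225, 13007360563181680483137, 12269490822223530974017, 12276401595851731000129, 12283877360126933490497, 383421589575059004225, 383637551250940255041, 12284093321802814741313, 12259048771847937276545, 12259048982748011379329, 383095045968846076545, 12259041471296887274113, 12259034722494515985025, 383094835068771973761, 12258388387484455172675, 12258388387484455172675, 383074637108889223939, 383074637108889223939, 383074637108889223747, 383074637108889223747, 392267960161421138358913, 392267960168011765674625, 12258373747914679284353, 392267959933278918046337, 392267959722378843943553, 12258373741324051968641, 392267942078786336488003, 392267942078786336488003, 12258373189962073015043, 12258373189962073015043, 12258373189962073014851, 12258373189962073014851, 12258373164018034301761, 12258373164018235431745, 383074161375345990465, 12258373164011071953729, 12258373164004635794241, 383074161375144860481, 383074161364608580609, 383074161364407450625, 11971067542637732865, 11971067542646063875, 11971067542646063683, 11971067542644018177, 383074161364608580609, 383074161364407450625, 11971067542637732865, 383074161364826153985, 383074161364832439297, 11971067542644018177,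 12258373163667474580097, 12258373163661038420609, 383074161364407452289, 383074161364673659651, 383074161364673659459, 383074161364608582273, 392267941237359186571905, 392267941237153229468289, 12258373163661038482049, 12258373163669556986627, 12258373163669556986435, 12258373163667474641537, 12258373163667474580097, 12258373163661038420609, 383074161364407452289, 383074161364673659651, 383074161364673659459, 383074161364608582273, 12258373163667474580289, 12258373163661038420801, 383074161364407452481, 12258373163674436928321, 12258373163674638058305, 383074161364608582465, 12258373163667474580289, 12258373163661038420801, 383074161364407452481, 12258373163674436928321, 12258373163674638058305, 383074161364608582465]⟩,
  ⟨⟨6, 12, [(4, 5), (4, 6), (3, 7), (2, 6), (2, 8), (1, 7), (1, 8), (0, 9), (0, 10), (6, 9), (7, 11), (8, 10), (9, 11), (10, 11)]⟩, .leaf 3, [292691367834177, 6683040218081066500206, 11567083599049281, 6683040320335631630336, 369737195135441347, 11553831609516673, 369722332671334977, 11831115238598974211, 361056965171969, 361056965171969, 11553822885503553, 369722332336118337, 11553822885503617, 11553822885503553, 11553822885503617]⟩,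
  ⟨⟨6, 13, [(4, 5), (4, 6), (3, 6), (3, 8), (2, 7), (2, 7), (1, 8), (1, 9), (0, 10), (0, 11), (6, 10), (7, 9), (8, 11), (9, 12), (10, 12), (11, 12)]⟩, .cut 132, [300409067388744321, 299987267240538753, 7427901099340045100810240, 7431442766115806277828608, 11849890311780381313, 11849468511632175745, 378613141819831237187, 378613141819818666563, 11831199011797287617, 11831198599883080385, 378597941636222776133, 378597941636222775749, 378597920613830582913, 378597920600958263937, 369724531501329281, 369724531513899905, 369724531501329281, 369724531513899905, 11831185008042537601, 11831185008444797569, 11831185008042537665, 11831185008444797633, 378597920257361207937, 378597920270233526913, 11831185008042537601, 11831185008444797569, 11831185008042537665, 11831185008444797633]⟩,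
  ⟨⟨6, 15, [(5, 6), (4, 6), (4, 7), (3, 7), (3, 8), (2, 8), (2, 13), (1, 9), (1, 12), (0, 10), (0, 11), (6, 9), (7, 10), (8, 11), (9, 12), (10, 14), (11, 14), (12, 13), (13, 14)]⟩, .cut 4610, [9668035183038904961, 3398397415429862017, 3182224633316078209, 9667824282964802177, 309364365085961828993, 309364575986035931777, 416678246368783922721409, 13021194983718110720641, 13014284210089910694529, 416457101612681521885825, 416267020435008909046401, 416260109661380709020289, 392648277950719924728449, 12276415150828970406529, 12283325924457170432641, 392655188724348124754561, 392845269902020737593985, 393066414658123138429569, 383095257285532007041, 12259048232885376203393, 12259041484083004914305, 383095046385457904257, 12259035472365741095553, 12259035683265815198337, 12258388383315796394947, 12258388383315796394947, 12258388383315796394755, 12258388383315796394755, 392268428266105484626691, 392268428266105484626691, 383074179828697678529, 12258373754518079947457, 12258373747927452631745, 383074179622740574913, 12258373742056634991297, 12258373742262592094913, 12258373182699354620867, 12258373182699354620867, 12258373182699354620675, 12258373182699354620675, 392267941846379347856131, 392267941846379347856131, 12258373164017520571009, 392267941248560649826945, 392267941248354692723329, 12258373164011084411521, 392267941248171229672065,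 392267941248177665831553, 11971067542778248193, 383074161368724765697, 383074161368731051009, 11971067542784533505, 383074161369105058817, 383074161368903928833, 11971067542778248193, 383074161368724765697, 383074161368731051009, 11971067542784533505, 383074161369105058817, 383074161368903928833, 383074161368903942785, 12258373163799192502913, 12258373163799393632897, 383074161369105072769, 12258373163811361882753, 12258373163804925723265, 383074161368903942849, 12258373163799192502977, 12258373163799393632961, 383074161369105072833, 12258373163811361882817, 12258373163804925723329, 383074161368903942785, 12258373163799192502913, 12258373163799393632897, 383074161369105072769, 12258373163811361882753, 12258373163804925723265, 383074161368903942849, 12258373163799192502977, 12258373163799393632961, 383074161369105072833, 12258373163811361882817, 12258373163804925723329, 12258373163804926177921, 392267941241574160102017, 392267941241580596261505, 12258373163811362337409, 392267941241963580256897, 392267941241757623153281, 3398397415429862017, 9668034976880474753, 309371331179318557313, 309370909379170351745, 9667613176732269185, 2966051851202294401, 13021188228318669664897, 416678036951401249993345, 416474553061237582557825, 416488374608493982610049, 416235747439196448322177, 13007366681062269612673, 12269497621801329324673, 392862721350576798265985, 393066205240740465701505, 392623915728535664030337, 392876542897833198318209, 12283319169057729376897, 12259048226494464866945, 383095257079373576833,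 12259042438459097823873, 12259042016658949618305, 383094835279225371265, 12259034728889722288769, 12258388383315796394947, 12258388383315796394947, 392268428266105484632643, 392268428266105484632643, 12258388383315796394563, 12258388383315796394563, 12258373754511838823105, 383074179828496351937, 12258373748859460534977, 12258373748447546327745, 383074179416582144705, 12258373741330584191681, 12258373182699354620867, 12258373182699354620867, 392267941846379347862083, 392267941846379347862083, 12258373182699354620483, 12258373182699354620483, 392267941248560454791809, 12258373164017514279553, 392267941248383817970305, 392267941248370945651329, 12258373164004641960577, 392267941248148540584577, 383074161368919800833, 11971067542771956737, 383074161368702608385, 383074161369104868353, 11971067542784527361, 383074161368932371457, 383074161368919800833, 11971067542771956737, 383074161368702608385, 383074161369104868353, 11971067542784527361, 383074161368932371457, 12258373163805433627265, 383074161368702616193, 12258373163798483468929, 12258373163811355787905, 383074161369104876161, 12258373163805835887233, 12258373163805433627329, 383074161368702616257, 12258373163798483468993, 12258373163811355787969, 383074161369104876225, 12258373163805835887297, 12258373163805433627265, 383074161368702616193, 12258373163798483468929, 12258373163811355787905, 383074161369104876161, 12258373163805835887233, 12258373163805433627329, 383074161368702616257, 12258373163798483468993, 12258373163811355787969, 383074161369104876225,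 12258373163805835887297, 392267941241773876081281, 12258373163798483726977, 392267941241551471014529, 392267941241963385221761, 12258373163811356045953, 392267941241786748400257, 309377664572452977281, 309377875472527080065, 9667823870647941761, 3182224633316078209, 2966051851202294401, 9667612970573838977, 416702818008350856147585, 416695907234722656121473, 416456682777916176429697, 13014270699291028583041, 13007359925662828556929, 416235538021813775594113, 392623706311152991302273, 392844851067255392137857, 393084075524061871829633, 12269490866401888268929, 12276401640030088295041, 393090986297690071855745, 12259048771852232243841, 12259048982752306346625, 383095045973141043841, 12259041471301182241409, 12259034722498810952321, 383094835073066941057, 392268428266105484638787, 392268428266105484638787, 12258388383315796394755, 12258388383315796394755, 12258388383315796394563, 12258388383315796394563, 12258373755044414767809, 12258373755250371871425, 383074179622337921729, 12258373747914970383041, 12258373741324343067329, 383074179416380818113, 392267941846379347868227, 392267941846379347868227, 12258373182699354620675, 12258373182699354620675, 12258373182699354620483, 12258373182699354620483, 392267941248577097790081, 392267941248583533949569, 12258373164011071828609, 392267941248354302653057, 392267941248148345549441, 12258373164004635669121, 383074161368903547905, 383074161368702417921, 11971067542771950593, 383074161369121121281, 383074161369127406593, 11971067542778235905, 383074161368903547905,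 383074161368702417921, 11971067542771950593, 383074161369121121281, 383074161369127406593, 11971067542778235905, 12258373163804913533569, 12258373163798477374081, 383074161368702419585, 12258373163811875881601, 12258373163812077011585, 383074161368903549569, 12258373163804913533633, 12258373163798477374145, 383074161368702419649, 12258373163811875881665, 12258373163812077011649, 383074161368903549633, 12258373163804913533569, 12258373163798477374081, 383074161368702419585, 12258373163811875881601, 12258373163812077011585, 383074161368903549569, 12258373163804913533633, 12258373163798477374145, 383074161368702419649, 12258373163811875881665, 12258373163812077011649, 383074161368903549633, 392267941241757233083009, 392267941241551275979393, 12258373163798477435521, 392267941241980028220033, 392267941241986464379521, 12258373163804913595009]⟩,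
  ⟨⟨6, 12, [(4, 5), (4, 6), (3, 7), (2, 6), (2, 8), (1, 7), (1, 8), (0, 9), (0, 10), (6, 11), (7, 9), (8, 10), (9, 11), (10, 11)]⟩, .leaf 3, [222389262694977, 6683022221274222461032, 370146675169581633, 6665170037014225502208, 11831750090514241987, 11553831609516673, 11553822895979073, 369722351205948163, 361056965171969, 361056965171969, 369722332336118337, 11553822885503553, 11553822885503617, 11553822885503553, 11553822885503617]⟩,
  ⟨⟨6, 13, [(4, 5), (4, 6), (3, 6), (3, 8), (2, 7), (2, 7), (1, 8), (1, 9), (0, 10), (0, 11), (6, 12), (7, 9), (8, 10), (9, 11), (10, 12), (11, 12)]⟩, .cut 132, [5429676398955201, 5007463933889217, 7465643136624139308662784, 7469184803399900485681152, 379196489976972206721, 379182992372229628545, 378618325135805084485, 378618325135805084101, 11831199011797287553, 11831198599883080321, 11831185607472804677, 11831185607472804293, 11831185019182205633, 11831185018779945665, 369724531501329281, 369724531513899905, 369724531501329281, 369724531513899905, 378597920257361207937, 378597920270233526913, 11831185008042537601, 11831185008444797569, 11831185008042537665, 11831185008444797633, 11831185008042537601, 11831185008444797569, 11831185008042537665,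 11831185008444797633]⟩,
  ⟨⟨6, 15, [(5, 6), (4, 6), (4, 8), (3, 7), (3, 8), (2, 7), (2, 11), (1, 9), (1, 12), (0, 10), (0, 13), (6, 9), (7, 10), (8, 14), (9, 12), (10, 14), (11, 12), (11, 13), (13, 14)]⟩, .cut 4610, [106199921377565505, 106199921377565505, 99444521936509761, 99444521936509761, 3191165666126355265, 3191165666126355265, 13021195199026642967361, 406912343243336342337, 406696381567455091521, 13014284425398442941249, 13008344388596173790017, 13008128426920292539201, 12270258685962143030081, 383637973465550707521, 383853935141431958337, 12270474647638024280897, 12276414684440293432129, 12283325458068493458241, 12259048232999518237313, 392289543452194532520577, 392289327490518651269761, 12259041484197146948225, 392289135115566209069697, 392289141864368580358785, 383076431628507167361, 12258445812112113678977, 12258445805521486363265, 383076431422550063745, 12258445799650668722817, 12258445799856625826433, 12258470127534258488259, 12258470127534258488259, 12258470127534258488067, 12258470127534258488067, 392271044081096271612675, 392271044081096271612675, 383076411491620127683, 383076411491620127683, 383076411491620127491, 383076411491620127491, 12258445167731844074243, 12258445167731844074243, 383076410976337943361, 12258445151242814053185, 12258445151236377893697, 383076410976136813377, 12258445151230644673345,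 12258445151230845803329, 11971137842668731393, 11971137842670764995, 11971137842670764803, 11971137842675016705, 383076410965600521217, 383076410965399391233, 11971137842668731393, 383076410965220228097, 383076410965226513409, 11971137842675016705, 383076410965600521217, 383076410965399391233, 383076410965399405185, 383076410965464089539, 383076410965464089347, 383076410965600535169, 12258445150899216679553, 12258445150892780520065, 12258445150892780974721, 12258445150894850737091, 12258445150894850736899, 12258445150899217134209, 392270244828774933754497, 392270244828568976650881, 383076410965399405185, 383076410965464089539, 383076410965464089347, 383076410965600535169, 12258445150899216679553, 12258445150892780520065, 383076410965399405377, 12258445150887047299905, 12258445150887248429889, 383076410965600535361, 12258445150899216679745, 12258445150892780520257, 383076410965399405377, 12258445150887047299905, 12258445150887248429889, 383076410965600535361, 12258445150899216679745, 12258445150892780520257, 106199921377565505, 106199921377565505, 2981748283453627201, 2981748283453627201, 92689122495454017, 92689122495454017, 406912132137103809345, 13021188654733434444609, 13014829783165819837249, 13015261706517582338881, 13007367107477034392385, 406480208785341307713, 383421800683436923713, 12276960042207670328129, 12283318913775284935489, 12269497366518884883265, 12277391965559432829761, 383853724035199425345, 392289543247685369754241, 12259048226402448470657, 392289358030553624375937,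 392289344532948881797761, 12259034728797705892481, 392289111324333607252609, 12258445812105872554625, 383076431628305840769, 12258445806453494266497, 12258445806041580059265, 383076431216391633537, 12258445798924617923201, 12258470127534258488259, 12258470127534258488259, 392271044081096271618627, 392271044081096271618627, 12258470127534258487875, 12258470127534258487875, 383076411491620127683, 383076411491620127683, 12258445167731844080195, 12258445167731844080195, 383076411491620127299, 383076411491620127299, 12258445151242807958337, 383076410976337746753, 12258445151237288057665, 12258445151236885797697, 383076410975935486785, 12258445151229935639361, 11971137842670764995, 11971137842662439937, 383076410965198070785, 383076410965600330753, 11971137842675010561, 11971137842670764611, 383076410965415263233, 11971137842662439937, 383076410965198070785, 383076410965600330753, 11971137842675010561, 383076410965427833857, 383076410965464089539, 383076410965198078593, 12258445150886338265729, 12258445150899210584705, 383076410965600338561, 383076410965464089155, 12258445150894850737091, 12258445150886338523777, 392270244828362824512129, 392270244828774738719361, 12258445150899210842753, 12258445150894850736707, 383076410965464089539, 383076410965198078593, 12258445150886338265729, 12258445150899210584705, 383076410965600338561, 383076410965464089155, 12258445150893288424257, 383076410965198078785, 12258445150886338265921, 12258445150899210584897, 383076410965600338753, 12258445150893690684225,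 12258445150893288424257, 383076410965198078785, 12258445150886338265921, 12258445150899210584897, 383076410965600338753, 12258445150893690684225, 2988503682894682945, 2988503682894682945, 99444521936509761, 99444521936509761, 92689122495454017, 92689122495454017, 13021963062763109636929, 13021747101087228386113, 13014271336812025895745, 406695959354990025537, 406479997679108774721, 13007360563183825869633, 12269490822225676360513, 12276401595853876386625, 12283877360129078876993, 383421589577204390721, 383637551253085641537, 12284093321804960127809, 392289560699133925814913, 392289567447936297104001, 12259041471003007414913, 392289327081500325737089, 392289111119824444486273, 12259034722200636125825, 12258445812638448499329, 12258445812844405602945, 383076431422147410561, 12258445805509004114561, 12258445798918376798849, 383076431216190306945, 392271044081096271624771, 392271044081096271624771, 12258470127534258488067, 12258470127534258488067, 12258470127534258487875, 12258470127534258487875, 12258445167731844086339, 12258445167731844086339, 383076411491620127491, 383076411491620127491, 383076411491620127299, 383076411491620127299, 12258445151243328052033, 12258445151243529182017, 383076410976136420161, 12258445151236365704001, 12258445151229929544513, 383076410975935290177, 383076410965399010305, 383076410965197880321, 11971137842662433793, 11971137842670764803, 11971137842670764611, 11971137842668719105, 383076410965399010305, 383076410965197880321, 11971137842662433793, 383076410965616583681,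 383076410965622868993, 11971137842668719105, 12258445150892768330369, 12258445150886332170881, 383076410965197881985, 383076410965464089347, 383076410965464089155, 383076410965399011969, 392270244828568586580609, 392270244828362629476993, 12258445150886332232321, 12258445150894850736899, 12258445150894850736707, 12258445150892768391809, 12258445150892768330369, 12258445150886332170881, 383076410965197881985, 383076410965464089347, 383076410965464089155, 383076410965399011969, 12258445150892768330561, 12258445150886332171073, 383076410965197882177, 12258445150899730678593, 12258445150899931808577, 383076410965399012161, 12258445150892768330561, 12258445150886332171073, 383076410965197882177, 12258445150899730678593, 12258445150899931808577, 383076410965399012161]⟩,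
  ⟨⟨6, 10, [(4, 5), (3, 5), (4, 6), (3, 7), (2, 6), (1, 7), (0, 8), (0, 9), (6, 8), (7, 9), (8, 9)]⟩, .cut 254, [4819295603329, 4819295603329, 154217459302977, 4819295603265, 4819295603265, 154217459302977, 4819295603329, 4819295603329, 4819295603201, 154217459304961, 154217459304961, 4819295603201, 154217459307009, 154217459307009, 4819295603201, 4819295603265, 4819295603265, 4819295603201, 2686846374529, 2686846374529, 85979083981377, 2686846374465, 2686846374465, 85979083981377, 2686846374529, 2686846374529, 2686846374401, 85979083983361, 85979083983361, 2686846374401, 85979083985409, 85979083985409, 2686846374401, 2686846374465, 2686846374465, 2686846374401, 154080707975712931852, 152963815268125048832, 152963815268125048838, 152963815268125048844, 154080707975712931840, 154080707975712931846, 170834098589531176960, 172509437650913001484, 170834098589531176972, 170834098589531176966, 172509437650913001478, 172509437650913001472, 207691557939931316230, 208250004293725257734, 208250004293725257728, 207691557939931316224, 208250004293725257740, 207691557939931316236, 152964377685518761984, 154081270393106645004, 154081270393106644998, 154081270393106644992, 152964377685518761996, 152964377685518761990, 172510000068306714636, 170834661006924890112, 172510000068306714624, 172510000068306714630, 170834661006924890118,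 170834661006924890124, 208250566711118970886, 207692120357325029382, 207692120357325029388, 208250566711118970892, 207692120357325029376, 208250566711118970880, 158208752422820291, 4945627603868099, 158260079429491139, 158213146174364099, 4950021355411907, 158400679478892995, 4943428580612547, 158276922143742403, 158283512771058115, 158189712832797123, 158400612906899907, 4950019207928259, 158189579688810947, 158259879713511875, 4945621161417155, 4943424285645251, 158417655337130435, 158419852212902339, 4934958919469507, 157918685423026627, 157918685239990723, 4934958915279299, 157918685288939971, 157918685244180931, 157918685422963139, 4934958919467459, 4934958913182147, 157918685305002435, 157918685311287747, 157918685221833155, 157918685439216067, 157918685441311171, 157918685221706179, 157918685288749507, 4934958915273155, 4934958913178051, 167407878465198531, 5231496063687107, 167220345160669635, 167267278415796675, 5227102312143299, 167215951409125827, 5231493916203459, 167407811893205443, 167196911819102659, 167290711757363651, 167284121130047939, 5224903288887747, 167427051199207875, 167424854323435971, 5224898993920451, 5227095869692355, 167267078699817411, 167196778675116483, 4934958713952899, 157918678797539971, 157918678980575875, 4934958718143107, 157918678801730179, 157918678846489219, 157918678862551683, 4934958711855747, 4934958718141059, 157918678980512387, 157918678779382403, 157918678868836995, 157918678846298755, 157918678779255427,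 157918678998860419, 157918678996765315, 4934958711851651, 4934958713946755]⟩,
  ⟨⟨6, 12, [(4, 5), (5, 6), (4, 7), (3, 6), (2, 8), (1, 7), (1, 8), (0, 9), (0, 10), (6, 11), (7, 9), (8, 10), (9, 11), (10, 11)]⟩, .leaf 2, [292889003375169, 6683057669495816470586, 7375278413051142595, 7188907821185601, 243352793583606337, 6683060498573040828416, 230044721194996483, 7188897025114753, 224653031772929, 224653031772929, 230044704535501377, 7188897016734273, 7188897016734337, 7188897016734273, 7188897016734337]⟩,
  ⟨⟨6, 13, [(4, 5), (5, 6), (4, 7), (3, 6), (2, 8), (2, 8), (1, 7), (1, 9), (0, 10), (0, 11), (6, 12), (7, 10), (8, 9), (9, 11), (10, 12), (11, 12)]⟩, .cut 260, [5425413708925633, 5073569988037313, 7466233433098569231400960, 7469184822078370212249600, 236083220876745864005, 236083220876745863685, 7361446750443354753, 7361446407181515393, 254584566160820691585, 254224630034351940225, 7361431147028509509, 7361431147028509189, 7361430558737976001, 7361430558402759361, 230044704614542209, 230044704625017729, 230044704614542209, 230044704625017729, 235565777525291246209, 235565777536018178689, 7361430547665351297, 7361430548000567937, 7361430547665351361,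 7361430548000568001, 7361430547665351297, 7361430548000567937, 7361430547665351361, 7361430548000568001]⟩,
  ⟨⟨6, 15, [(5, 6), (4, 6), (4, 7), (3, 7), (3, 8), (2, 8), (2, 11), (1, 9), (1, 12), (0, 10), (0, 13), (6, 14), (7, 9), (8, 10), (9, 12), (10, 14), (11, 12), (11, 13), (13, 14)]⟩, .cut 4610, [106199919232179009, 106199919232179009, 99444519791123265, 99444519791123265, 3191165663980968769, 3191165663980968769, 13021195331232441201281, 416678246716298253202049, 416457101960195852366465, 13014284557604241175169, 416260110008895039500929, 416267020782523239527041, 12281641382150278513603, 12281641382150278513603, 12281641382150278513411, 12281641382150278513411, 393012524228808912423683, 393012524228808912423683, 12259048232872558353217, 383095257272714156865, 383095046372640054081, 12259041484070187064129, 12259035683252997348161, 12259035472352923245377, 12258386954025909246785, 383074780193644239681, 383074991093718342465, 12258387164925983349569, 12258392965743173065537, 12258399714545544354625, 383074179828693484161, 12258373754518075753089, 12258373747927448437377, 383074179622736380545, 12258373742056630796929, 12258373742262587900545, 383074161890829697987, 383074161890829697987, 383074161890829697795, 383074161890829697795, 12258373180506550323971, 12258373180506550323971, 383074161375547513665, 12258373164017520302913,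 12258373164011084143425, 383074161375346383681, 12258373164005350923073, 12258373164005552053057, 11971067542644030465, 11971067542646064067, 11971067542646063875, 11971067542650315777, 383074161364810091521, 383074161364608961537, 11971067542644030465, 383074161364429798401, 383074161364436083713, 11971067542650315777, 383074161364810091521, 383074161364608961537, 12258373163667487224449, 12258373163669556986819, 12258373163669556986627, 12258373163673923383937, 392267941237565533745793, 392267941237359576642177, 383074161364608975489, 383074161364673659843, 383074161364673659651, 383074161364810105473, 12258373163673922929281, 12258373163667486769793, 383074161364608975489, 383074161364673659843, 383074161364673659651, 383074161364810105473, 12258373163673922929281, 12258373163667486769793, 383074161364608975681, 12258373163661753549633, 12258373163661954679617, 383074161364810105665, 12258373163673922929473, 12258373163667486769985, 383074161364608975681, 12258373163661753549633, 12258373163661954679617, 383074161364810105665, 12258373163673922929473, 12258373163667486769985, 106199919232179009, 106199919232179009, 2981748281308240705, 2981748281308240705, 92689120350067521, 92689120350067521, 416678037298915580473985, 13021188575833000145537, 416488374956008313090689, 416474553408751913038465, 13007367028576600093313, 416235747786710778802817, 12281641382150278513603, 12281641382150278513603, 393012524228808912429635, 393012524228808912429635, 12281641382150278513219, 12281641382150278513219,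 383095257066555726657, 12259048226481647016769, 12259042016646131768129, 12259042438446279973697, 12259034728876904438593, 383094835266407521089, 383074569087411706689, 12258393498319117769537, 12258399708154633018177, 12258386210549890440001, 12258393920119265975105, 383074990887559912257, 12258373754511834628737, 383074179828492157569, 12258373748859456340609, 12258373748447542133377, 383074179416577950337, 12258373741330579997313, 383074161890829697987, 383074161890829697987, 12258373180506550329923, 12258373180506550329923, 383074161890829697603, 383074161890829697603, 12258373164017514208065, 383074161375547317057, 12258373164011994307393, 12258373164011592047425, 383074161375145057089, 12258373164004641889089, 11971067542646064067, 11971067542637739009, 383074161364407641089, 383074161364809901057, 11971067542650309633, 11971067542646063683, 383074161364624833537, 11971067542637739009, 383074161364407641089, 383074161364809901057, 11971067542650309633, 383074161364637404161, 12258373163669556986819, 12258373163661044773505, 392267941237153424503425, 392267941237565338710657, 12258373163673917092481, 12258373163669556986435, 383074161364673659843, 383074161364407648897, 12258373163661044515457, 12258373163673916834433, 383074161364809908865, 383074161364673659459, 383074161364673659843, 383074161364407648897, 12258373163661044515457, 12258373163673916834433, 383074161364809908865, 383074161364673659459, 12258373163667994673985, 383074161364407649089, 12258373163661044515649, 12258373163673916834625,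 383074161364809909057, 12258373163668396933953, 12258373163667994673985, 383074161364407649089, 12258373163661044515649, 12258373163673916834625, 383074161364809909057, 12258373163668396933953, 2988503680749296449, 2988503680749296449, 99444519791123265, 99444519791123265, 92689120350067521, 92689120350067521, 416695907582236986602113, 416702818355865186628225, 13014271046805359063681, 416456683125430506910337, 416235538369328106074753, 13007360273177159037569, 393012524228808912435779, 393012524228808912435779, 12281641382150278513411, 12281641382150278513411, 12281641382150278513219, 12281641382150278513219, 12259048982739488496449, 12259048771839414393665, 12259041471288364391233, 383095045960323193665, 383094835060249090881, 12259034722485993102145, 12258386204158979103553, 12258392952961350392641, 12258400253512400395073, 383074568881253276481, 383074779781327379265, 12258400464412474497857, 12258373755044410573441, 12258373755250367677057, 383074179622333727361, 12258373747914966188673, 12258373741324338872961, 383074179416376623745, 12258373180506550336067, 12258373180506550336067, 383074161890829697795, 383074161890829697795, 383074161890829697603, 383074161890829697603, 12258373164018034301761, 12258373164018235431745, 383074161375345990465, 12258373164011071953729, 12258373164004635794241, 383074161375144860481, 383074161364608580609, 383074161364407450625, 11971067542637732865, 11971067542646063875, 11971067542646063683, 11971067542644018177, 383074161364608580609, 383074161364407450625,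 11971067542637732865, 383074161364826153985, 383074161364832439297, 11971067542644018177, 392267941237359186571905, 392267941237153229468289, 12258373163661038482049, 12258373163669556986627, 12258373163669556986435, 12258373163667474641537, 12258373163667474580097, 12258373163661038420609, 383074161364407452289, 383074161364673659651, 383074161364673659459, 383074161364608582273, 12258373163667474580097, 12258373163661038420609, 383074161364407452289, 383074161364673659651, 383074161364673659459, 383074161364608582273, 12258373163667474580289, 12258373163661038420801, 383074161364407452481, 12258373163674436928321, 12258373163674638058305, 383074161364608582465, 12258373163667474580289, 12258373163661038420801, 383074161364407452481, 12258373163674436928321, 12258373163674638058305, 383074161364608582465]⟩,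
  ⟨⟨6, 12, [(4, 5), (5, 6), (4, 7), (3, 6), (2, 8), (1, 7), (1, 8), (0, 9), (0, 10), (6, 9), (7, 11), (8, 10), (9, 11), (10, 11)]⟩, .leaf 2, [361123539006017, 6683040218047227904056, 230317604227850691, 230045050277943873, 7604774799487553, 6683060498573040828416, 7361431234339672835, 7188897025114753, 224653031772929, 224653031772929, 7188897016734273, 230044704535501377, 7188897016734337, 7188897016734273, 7188897016734337]⟩,
  ⟨⟨6, 13, [(4, 5), (5, 6), (4, 7), (3, 6), (2, 8), (2, 8), (1, 7), (1, 9), (0, 10), (0, 11), (6, 10), (7, 12), (8, 9), (9, 11), (10, 12), (11, 12)]⟩, .cut 260, [5425413708925633, 5073569988037313, 7466233433098569231400960, 7469184822078370212249600, 7372417400362595141, 7372417400362594821, 235566296014187356801, 235566285029808497281, 7955767692525646465, 7944519688573497985, 235565801766681408325, 235565801766681408005, 7361430558737976001, 7361430558402759361, 230044704614542209, 230044704625017729, 230044704614542209, 230044704625017729, 7361430547665351297, 7361430548000567937, 235565777525291246209, 235565777536018178689, 7361430547665351361, 7361430548000568001, 7361430547665351297, 7361430548000567937, 7361430547665351361,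 7361430548000568001]⟩,
  ⟨⟨6, 15, [(5, 6), (4, 6), (4, 7), (3, 7), (3, 8), (2, 8), (2, 11), (1, 9), (1, 12), (0, 10), (0, 13), (6, 10), (7, 9), (8, 14), (9, 12), (10, 14), (11, 12), (11, 13), (13, 14)]⟩, .cut 4610, [106199919232179009, 106199919232179009, 99444519791123265, 99444519791123265, 3191165663980968769, 3191165663980968769, 406912354101013787265, 13021195209884320412289, 13014284436256120386177, 406696392425132536449, 13008128437777969984129, 13008344399453851234945, 383491454607617721283, 383491454607617721283, 383491454607617721091, 383491454607617721091, 12271726547443767069443, 12271726547443767069443, 12259048232872558353217, 383095257272714156865, 383095046372640054081, 12259041484070187064129, 12259035683252997348161, 12259035472352923245377, 12258386954025909246785, 383074780193644239681, 383074991093718342465, 12258387164925983349569, 12258392965743173065537, 12258399714545544354625, 12258373754518191501953, 392267960144578424107649, 392267959933678350004865, 12258373747927564186241, 392267959745812185510529, 392267959752402812826241, 12258373189962073015235, 12258373189962073015235, 12258373189962073015043, 12258373189962073015043, 392267942078786336475907, 392267942078786336475907, 383074161375547513665, 12258373164017520302913, 12258373164011084143425, 383074161375346383681, 12258373164005350923073,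 12258373164005552053057, 11971067542644030465, 11971067542646064067, 11971067542646063875, 11971067542650315777, 383074161364810091521, 383074161364608961537, 11971067542644030465, 383074161364429798401, 383074161364436083713, 11971067542650315777, 383074161364810091521, 383074161364608961537, 383074161364608975489, 383074161364673659843, 383074161364673659651, 383074161364810105473, 12258373163673922929281, 12258373163667486769793, 12258373163667487224449, 12258373163669556986819, 12258373163669556986627, 12258373163673923383937, 392267941237565533745793, 392267941237359576642177, 383074161364608975489, 383074161364673659843, 383074161364673659651, 383074161364810105473, 12258373163673922929281, 12258373163667486769793, 383074161364608975681, 12258373163661753549633, 12258373163661954679617, 383074161364810105665, 12258373163673922929473, 12258373163667486769985, 383074161364608975681, 12258373163661753549633, 12258373163661954679617, 383074161364810105665, 12258373163673922929473, 12258373163667486769985, 106199919232179009, 106199919232179009, 2981748281308240705, 2981748281308240705, 92689120350067521, 92689120350067521, 13021188665591111889537, 406912142994781254273, 13015261717375259783809, 13014829794023497282177, 406480219643018752641, 13007367118334711837313, 383491454607617721283, 383491454607617721283, 12271726547443767075395, 12271726547443767075395, 383491454607617720899, 383491454607617720899, 383095257066555726657, 12259048226481647016769, 12259042016646131768129, 12259042438446279973697,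 12259034728876904438593, 383094835266407521089, 383074569087411706689, 12258393498319117769537, 12258399708154633018177, 12258386210549890440001, 12258393920119265975105, 383074990887559912257, 392267960144378708128385, 12258373754511749051009, 392267959963502602908289, 392267959950321348276865, 12258373741330494419585, 392267959722578559922817, 12258373189962073015235, 12258373189962073015235, 392267942078786336481859, 392267942078786336481859, 12258373189962073014851, 12258373189962073014851, 12258373164017514208065, 383074161375547317057, 12258373164011994307393, 12258373164011592047425, 383074161375145057089, 12258373164004641889089, 11971067542646064067, 11971067542637739009, 383074161364407641089, 383074161364809901057, 11971067542650309633, 11971067542646063683, 383074161364624833537, 11971067542637739009, 383074161364407641089, 383074161364809901057, 11971067542650309633, 383074161364637404161, 383074161364673659843, 383074161364407648897, 12258373163661044515457, 12258373163673916834433, 383074161364809908865, 383074161364673659459, 12258373163669556986819, 12258373163661044773505, 392267941237153424503425, 392267941237565338710657, 12258373163673917092481, 12258373163669556986435, 383074161364673659843, 383074161364407648897, 12258373163661044515457, 12258373163673916834433, 383074161364809908865, 383074161364673659459, 12258373163667994673985, 383074161364407649089, 12258373163661044515649, 12258373163673916834625, 383074161364809909057, 12258373163668396933953, 12258373163667994673985,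 383074161364407649089, 12258373163661044515649, 12258373163673916834625, 383074161364809909057, 12258373163668396933953, 2988503680749296449, 2988503680749296449, 99444519791123265, 99444519791123265, 92689120350067521, 92689120350067521, 13021747111944905831041, 13021963073620787081857, 406695970212667470465, 13014271347669703340673, 13007360574041503314561, 406480008536786219649, 12271726547443767081539, 12271726547443767081539, 383491454607617721091, 383491454607617721091, 383491454607617720899, 383491454607617720899, 12259048982739488496449, 12259048771839414393665, 12259041471288364391233, 383095045960323193665, 383094835060249090881, 12259034722485993102145, 12258386204158979103553, 12258392952961350392641, 12258400253512400395073, 383074568881253276481, 383074779781327379265, 12258400464412474497857, 392267960161421138358913, 392267960168011765674625, 12258373747914679284353, 392267959933278918046337, 392267959722378843943553, 12258373741324051968641, 392267942078786336488003, 392267942078786336488003, 12258373189962073015043, 12258373189962073015043, 12258373189962073014851, 12258373189962073014851, 12258373164018034301761, 12258373164018235431745, 383074161375345990465, 12258373164011071953729, 12258373164004635794241, 383074161375144860481, 383074161364608580609, 383074161364407450625, 11971067542637732865, 11971067542646063875, 11971067542646063683, 11971067542644018177, 383074161364608580609, 383074161364407450625, 11971067542637732865, 383074161364826153985, 383074161364832439297,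 11971067542644018177, 12258373163667474580097, 12258373163661038420609, 383074161364407452289, 383074161364673659651, 383074161364673659459, 383074161364608582273, 392267941237359186571905, 392267941237153229468289, 12258373163661038482049, 12258373163669556986627, 12258373163669556986435, 12258373163667474641537, 12258373163667474580097, 12258373163661038420609, 383074161364407452289, 383074161364673659651, 383074161364673659459, 383074161364608582273, 12258373163667474580289, 12258373163661038420801, 383074161364407452481, 12258373163674436928321, 12258373163674638058305, 383074161364608582465, 12258373163667474580289, 12258373163661038420801, 383074161364407452481, 12258373163674436928321, 12258373163674638058305, 383074161364608582465]⟩,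
  ⟨⟨6, 12, [(4, 5), (5, 6), (4, 7), (3, 6), (2, 8), (1, 7), (1, 8), (0, 9), (0, 10), (6, 9), (7, 10), (8, 11), (9, 11), (10, 11)]⟩, .leaf 2, [361123539006017, 6683057669495816470578, 230317602200359427, 7188907821185665, 7604774799487553, 6683060498573040828416, 7361431146898920195, 230044704803674689, 224653031772929, 224653031772929, 7188897016734273, 7188897016734337, 230044704535501377, 7188897016734273, 7188897016734337]⟩,
  ⟨⟨6, 13, [(4, 5), (5, 6), (4, 7), (3, 6), (2, 8), (2, 8), (1, 7), (1, 9), (0, 10), (0, 11), (6, 10), (7, 11), (8, 9), (9, 12), (10, 12), (11, 12)]⟩, .cut 260, [369790585493729921, 369790596220662401, 7428491394723759488794624, 7431442783703560469643264, 235917352616107065923, 235917352616096590403, 7361446750443354817, 7361446407181515457, 7955767692525646465, 7944519688573497985, 235565798902005330757, 235565798902005330437, 235565777879615234689, 235565777868888302209, 230044704614542209, 230044704625017729, 230044704614542209, 230044704625017729, 7361430547665351297, 7361430548000567937, 7361430547665351361, 7361430548000568001, 235565777525291246209, 235565777536018178689, 7361430547665351297, 7361430548000567937, 7361430547665351361,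 7361430548000568001]⟩,
  ⟨⟨6, 15, [(5, 6), (4, 6), (4, 7), (3, 7), (3, 8), (2, 8), (2, 13), (1, 9), (1, 12), (0, 10), (0, 11), (6, 10), (7, 9), (8, 11), (9, 12), (10, 14), (11, 14), (12, 13), (13, 14)]⟩, .cut 4610, [12613203923518632577, 3398397415429862017, 3182224633316078209, 12397242247637381761, 390555495758683189889, 390771457434564440705, 406912358499060298369, 13021195214282366923393, 13014284440654166897281, 406696396823179047553, 13008128442176016495233, 13008344403851897746049, 12271722278737785684931, 12271722278737785684931, 12271722278737785684739, 12271722278737785684739, 392695112919609141906179, 392695112919609141906179, 392289543451921867436673, 12259048232726853153409, 12259041483924481864321, 392289327490245986185857, 392289141864095915274881, 392289135115293543985793, 392268382528829096030849, 12258392966196615803521, 12258399714998987092609, 392268389277631467319937, 392268574903781538230913, 392268790865457419481729, 383074179828697678529, 12258373754518079947457, 12258373747927452631745, 383074179622740574913, 12258373742056634991297, 12258373742262592094913, 12258373182699354620867, 12258373182699354620867, 12258373182699354620675, 12258373182699354620675, 392267941846379347856131, 392267941846379347856131, 12258373164017520571009, 392267941248560649826945, 392267941248354692723329, 12258373164011084411521,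 392267941248171229672065, 392267941248177665831553, 11971067542778248193, 383074161368724765697, 383074161368731051009, 11971067542784533505, 383074161369105058817, 383074161368903928833, 11971067542778248193, 383074161368724765697, 383074161368731051009, 11971067542784533505, 383074161369105058817, 383074161368903928833, 383074161368903942785, 12258373163799192502913, 12258373163799393632897, 383074161369105072769, 12258373163811361882753, 12258373163804925723265, 383074161368903942849, 12258373163799192502977, 12258373163799393632961, 383074161369105072833, 12258373163811361882817, 12258373163804925723329, 383074161368903942785, 12258373163799192502913, 12258373163799393632897, 383074161369105072769, 12258373163811361882753, 12258373163804925723265, 383074161368903942849, 12258373163799192502977, 12258373163799393632961, 383074161369105072833, 12258373163811361882817, 12258373163804925723329, 12258373163804926177921, 392267941241574160102017, 392267941241580596261505, 12258373163811362337409, 392267941241963580256897, 392267941241757623153281, 3398397415429862017, 12612992817286099585, 397688775355972989569, 397256852004210487937, 12181069465523597953, 2966051851202294401, 13021188669989158400641, 406912147392827765377, 13015261721773306294913, 13014829798421543793281, 406480224041065263745, 13007367122732758348417, 12271722278737785684931, 12271722278737785684931, 392695112919609141912131, 392695112919609141912131, 12271722278737785684547, 12271722278737785684547, 12259048226129783386753,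 392289543247412704670337, 392289344532676216713857, 392289358030280959292033, 392289111324060942168705, 12259034728525040808577, 12258386210797174747777, 392268591946211768758913, 392268790660948256715393, 392268358737596494213761, 392268605443816511337089, 12258399708401917325953, 12258373754511838823105, 383074179828496351937, 12258373748859460534977, 12258373748447546327745, 383074179416582144705, 12258373741330584191681, 12258373182699354620867, 12258373182699354620867, 392267941846379347862083, 392267941846379347862083, 12258373182699354620483, 12258373182699354620483, 392267941248560454791809, 12258373164017514279553, 392267941248383817970305, 392267941248370945651329, 12258373164004641960577, 392267941248148540584577, 383074161368919800833, 11971067542771956737, 383074161368702608385, 383074161369104868353, 11971067542784527361, 383074161368932371457, 383074161368919800833, 11971067542771956737, 383074161368702608385, 383074161369104868353, 11971067542784527361, 383074161368932371457, 12258373163805433627265, 383074161368702616193, 12258373163798483468929, 12258373163811355787905, 383074161369104876161, 12258373163805835887233, 12258373163805433627329, 383074161368702616257, 12258373163798483468993, 12258373163811355787969, 383074161369104876225, 12258373163805835887297, 12258373163805433627265, 383074161368702616193, 12258373163798483468929, 12258373163811355787905, 383074161369104876161, 12258373163805835887233, 12258373163805433627329, 383074161368702616257, 12258373163798483468993, 12258373163811355787969,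 383074161369104876225, 12258373163805835887297, 392267941241773876081281, 12258373163798483726977, 392267941241551471014529, 392267941241963385221761, 12258373163811356045953, 392267941241786748400257, 404174169925619036801, 404390131601500287617, 12396820035172315777, 3182224633316078209, 2966051851202294401, 12180858359291064961, 13021747116342952342145, 13021963078018833592961, 406695974610713981569, 13014271352067749851777, 13007360578439549825665, 406480012934832730753, 392695112919609141918275, 392695112919609141918275, 12271722278737785684739, 12271722278737785684739, 12271722278737785684547, 12271722278737785684547, 392289567447663632020097, 392289560698861260731009, 392289327081227660653185, 12259041470730342331009, 12259034721927971041921, 392289111119551779402369, 392268358533087331447425, 392268574494763212698241, 392268808112396812776065, 12258386204200104981121, 12258392953002476270209, 392268814861199184065153, 12258373755044414767809, 12258373755250371871425, 383074179622337921729, 12258373747914970383041, 12258373741324343067329, 383074179416380818113, 392267941846379347868227, 392267941846379347868227, 12258373182699354620675, 12258373182699354620675, 12258373182699354620483, 12258373182699354620483, 392267941248577097790081, 392267941248583533949569, 12258373164011071828609, 392267941248354302653057, 392267941248148345549441, 12258373164004635669121, 383074161368903547905, 383074161368702417921, 11971067542771950593, 383074161369121121281, 383074161369127406593, 11971067542778235905,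 383074161368903547905, 383074161368702417921, 11971067542771950593, 383074161369121121281, 383074161369127406593, 11971067542778235905, 12258373163804913533569, 12258373163798477374081, 383074161368702419585, 12258373163811875881601, 12258373163812077011585, 383074161368903549569, 12258373163804913533633, 12258373163798477374145, 383074161368702419649, 12258373163811875881665, 12258373163812077011649, 383074161368903549633, 12258373163804913533569, 12258373163798477374081, 383074161368702419585, 12258373163811875881601, 12258373163812077011585, 383074161368903549569, 12258373163804913533633, 12258373163798477374145, 383074161368702419649, 12258373163811875881665, 12258373163812077011649, 383074161368903549633, 392267941241757233083009, 392267941241551275979393, 12258373163798477435521, 392267941241980028220033, 392267941241986464379521, 12258373163804913595009]⟩,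
  ⟨⟨6, 8, [(4, 5), (3, 4), (3, 6), (2, 7), (1, 6), (1, 7), (0, 6), (0, 7)]⟩, .leaf 2, [215088564609, 4050671251767354, 4050688934952988, 11276978162049, 4630131562251264, 11276839752195, 11276841914817, 11276841849345, 11276841849345]⟩,
  ⟨⟨6, 9, [(4, 5), (3, 4), (3, 6), (2, 6), (2, 7), (1, 6), (1, 7), (0, 8), (0, 8), (7, 8)]⟩, .cut 198, [160881098963457, 220265399267841, 360865448669697, 360858939181569, 220258889779713, 160743794227713, 5318862281013462022, 3625577523956432908, 11971708237984257, 11971701728496129, 5300916585337749516, 3589532800661848582, 5300320134605325312, 3625577558282616850, 11562689912451585, 11562683402963457, 5300916619663933458, 3624981073223516672, 360858939181697, 11547557071176067, 360865448669697, 360858939181569, 11547557066985859, 360865448669825, 220265397172737, 160881101058561, 160743796322817, 220261035166209, 360861084568065, 360865446574593, 4202037726504042508, 5300865474690024454, 4147979154455790086, 5318930434091417612, 11971703873882625, 11971708235889153, 4202037760830226450, 5317771583161385984, 4200878875573518848, 5318930468417601554, 11562685548349953, 11562689910356481, 11547488351699395, 360861084568193, 360865446574721, 11547488347509187, 360861084568065,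 360865446574593, 154146730752513, 220265332224513, 360865381626369, 360859006224897, 220258956823041, 154284035488257, 5318862281013985798, 3625577523955925004, 11971708170940929, 11971701795539457, 5300916585338257420, 3589532800661324806, 5300320134605341184, 3625577558282108946, 11562689845408257, 11562683470006785, 5300916619664441362, 3624981073223500800, 360859006225025, 11547556865659459, 360865381626369, 360859006224897, 11547556869849667, 360865381626497, 220265330129409, 156345754006017, 156483058741761, 220261102209537, 360861151611393, 360865379531265, 4202037726503534604, 5300865474690548230, 4147979154455266310, 5318930434091925516, 11971703940925953, 11971708168845825, 4202037760829718546, 5317771583161401856, 4200878875573502976, 5318930468418109458, 11562685615393281, 11562689843313153, 11547488213291587, 360861151611521, 360865379531393, 11547488217481795, 360861151611393, 360865379531265]⟩,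
  ⟨⟨6, 11, [(4, 5), (4, 6), (3, 6), (3, 9), (2, 7), (2, 7), (1, 8), (1, 9), (0, 8), (0, 10), (6, 10), (7, 8), (9, 10)]⟩, .cut 132, [165279341021697, 156483247999489, 4340898758820719232000, 6628295023960703632384, 11845245972519268993, 11844964772420465281, 369739389408076485, 369739389408076229, 11831194476309727873, 11831194201700256385, 369724600430508545, 369724600422128129, 369724618946208453, 369724618946208197, 369724600153692929, 369724600162073345, 11553893754364613, 11553893754364357, 369724600139539141, 369724600139538885, 369724600139539141, 369724600139538885]⟩,
  ⟨⟨6, 13, [(5, 6), (4, 6), (4, 7), (3, 7), (3, 8), (2, 8), (2, 9), (1, 9), (1, 10), (0, 11), (0, 12), (6, 11), (7, 10), (8, 10), (9, 12), (11, 12)]⟩, .leaf 5, [214984286345919570968576, 92482343522349761, 399213356669301111427, 12473287137311339201, 399143071400633451139, 12471103590500676289, 9667896348560673537, 101696319604804353, 389651682556129985, 2890073234615105, 2890073234615105, 92482343507684033, 12488572081486967489, 12488572081486967489, 92482343507684097, 92482343507684033]⟩,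
  ⟨⟨6, 14, [(5, 6), (5, 8), (4, 6), (4, 9), (3, 7), (3, 7), (2, 9), (2, 10), (1, 8), (1, 11), (0, 12), (0, 13), (6, 10), (7, 11), (8, 10), (9, 12), (11, 13), (12, 13)]⟩, .cut 136, [8151533435391284884101, 7635024601327417438853, 254735285555159980865, 238594384490664123201, 254733240540506184513, 238592339476010326849, 254733035883580121669, 238592134819084264005, 183177676300566678273, 182673765723510426369, 7960273158190226241, 7455869999924730689, 8151252780600313332357, 7634743946536445887109, 168628650385418443585, 168628650384949140289, 5269645324261225409, 5269645324275891137, 5269645324261225409, 5269645324275891137, 254746273739024980801, 238605372674529123137, 254746273739024980801, 238605372674529123137, 168628650376359213825, 168628650376828517121, 168628650376359213889, 168628650376828517185, 168628650376359213825, 168628650376828517121]⟩,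
  ⟨⟨6, 11, [(4, 5), (5, 6), (4, 7), (3, 6), (2, 7), (2, 9), (1, 8), (1, 8), (0, 9), (0, 10), (6, 10), (7, 10), (8, 9)]⟩, .cut 258, [94777387717185, 88180317950529, 4931214286687640224256, 6646761485542628524544, 230387891686433475, 230387891686433283, 7361442212810472065, 7361442006853368449, 7807078538225726081, 7800329735854436993, 230044723340010179, 230044723340009987, 230044706969567809, 230044706963282497, 230044706761956097, 230044706768241409, 7188897085809347, 7188897085809155, 230044706745770691, 230044706745770499, 230044706745770691, 230044706745770499]⟩,
  ⟨⟨6, 13, [(5, 6), (4, 6), (4, 8), (3, 7), (3, 8), (2, 7), (2, 9), (1, 9), (1, 10), (0, 11), (0, 12), (6, 10), (7, 10), (8, 11), (9, 12), (11, 12)]⟩, .leaf 5, [233354938060505534709760, 10171824049309827777, 12475415258709836481, 309372754057559685763, 92480157436363457, 9667896413180347073, 12470967105237371649, 101696321750190849, 302121694252974785, 2890004582247233, 2890004582247233, 9667913472253575873, 9667913472253575873, 92480146631912129, 92480146631912193, 92480146631912129]⟩,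
  ⟨⟨6, 14, [(5, 6), (5, 6), (4, 7), (4, 8), (3, 7), (3, 9), (2, 8), (2, 10), (1, 9), (1, 11), (0, 12), (0, 13), (6, 10), (7, 11), (8, 12), (9, 13), (10, 11), (12, 13)]⟩, .cut 96, [338694205431071000181443, 338104486081464597953219, 94771814192130441985, 383860310438957957889, 9986698641761684833025, 9986698641212465890049, 402304804845240011585, 383858060771530459969, 402302779078339740417, 383856035004630188801, 9968810895447397909249, 9968810895996616852225, 109395131106242808641, 383853851441176464193, 311525349551612510977, 311525349002393568001, 2961618687033177025, 2961618687049937857, 2961618687033177025, 2961618687049937857, 9968810906991722644225, 9968810906442503701249, 94771797985061665537, 94771797985598012161, 94771797985061665601, 94771797985598012225, 9968810906991722644225, 9968810906442503701249, 94771797985061665537, 94771797985598012161]⟩,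
  ⟨⟨6, 11, [(4, 5), (5, 6), (4, 7), (3, 7), (2, 6), (2, 9), (1, 6), (1, 10), (0, 8), (0, 8), (7, 9), (8, 10), (9, 10)]⟩, .cut 257, [5158990506302145, 5158990506301953, 4913344003366200082432, 6682502052185406767104, 232228699176044933, 232228692739885445, 7442352668873343619, 7442352668867058307, 7807008235988466245, 7800259433617177157, 232228266057032385, 232228266057032193, 232228268342788739, 232228268336503427, 232228268139438785, 232228268139438593, 7431304580475935491, 7431304580482220803, 7431304580616438403, 7431304580610153091, 7431304580616438403, 7431304580610153091]⟩,
  ⟨⟨6, 13, [(5, 7), (4, 6), (4, 8), (3, 6), (3, 9), (2, 6), (2, 11), (1, 7), (1, 8), (0, 10), (0, 12), (7, 9), (8, 10), (9, 11), (10, 12), (11, 12)]⟩, .leaf 5, [233338763959120502996992, 12475536617370704641, 7590971406706360961, 245813502755887873, 306330908296895233, 229982732273474305, 9802589063355128577, 9803010878340225793, 314316093958172126019, 237217856115649345, 237217856115649345, 9802589078192020225, 7590971395700779649, 9802589078192020225, 7590971395700779649, 7590971395700779777]⟩,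
  ⟨⟨6, 14, [(5, 6), (5, 7), (4, 6), (4, 11), (3, 6), (3, 12), (2, 8), (2, 8), (1, 7), (1, 9), (0, 10), (0, 13), (7, 10), (8, 9), (9, 11), (10, 13), (11, 12), (12, 13)]⟩, .cut 260, [180948373050916823873, 167113314995634660161, 10284289890470064110209, 10284289890058149902977, 330749443058979529537, 167111361704705090369, 385168674673614086977, 385169096473762292545, 309359104518495888193, 309359104930410095425, 12325397589553505329985, 12325411087158247908161, 12345513596171359189893, 12345513596171359189509, 12325843432327207936833, 12325829934722465358657, 321384058499985732545, 321384058499998303169, 321384058499985732545, 321384058499998303169, 10284289871999543442049, 10284289871999945702017, 12325397589570554651457, 12325411087175297229633, 10284289871999543442049, 10284289871999945702017, 12325397589570554651457, 12325411087175297229633, 10284289871999543442241, 10284289871999945702209]⟩,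
  ⟨⟨6, 11, [(4, 5), (4, 7), (3, 6), (3, 7), (2, 6), (2, 9), (1, 6), (1, 10), (0, 8), (0, 8), (7, 9), (8, 10), (9, 10)]⟩, .cut 257, [5158990378183361, 5158990378183169, 4913341276610649194496, 6682499325429855879168, 11845241647480912453, 11845030747406809669, 369795195996866949, 369795189560707461, 11833846157247791747, 11833846157241506435, 369794762877854401, 369794762877854209, 369794765163610755, 369794765157325443, 369794764960260801, 369794764960260609, 11833432478742240003, 11833432478748525315, 11833432478882742915, 11833432478876457603, 11833432478882742915, 11833432478876457603]⟩,
  ⟨⟨6, 13, [(5, 7), (4, 6), (4, 8), (3, 6), (3, 9), (2, 6), (2, 11), (1, 7), (1, 8), (0, 10), (0, 12), (7, 10), (8, 9), (9, 11), (10, 12), (11, 12)]⟩, .leaf 5, [232783668283449325142016, 10171875107945995009, 10171875107945995009, 245813502755887873, 306330908296895233, 229982732273474305, 9802589063355128577, 7590971395713350273, 314250350391061850947, 237217856115649345, 237217856115649345, 7590971395700779649, 9802589078192020225, 9802589078192020225, 7590971395700779649, 7590971395700779777]⟩,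
  ⟨⟨6, 14, [(5, 6), (5, 7), (4, 6), (4, 9), (3, 6), (3, 11), (2, 8), (2, 8), (1, 7), (1, 10), (0, 12), (0, 13), (7, 9), (8, 10), (9, 11), (10, 12), (11, 13), (12, 13)]⟩, .cut 260, [309224821454564326277, 309224821454564325893, 12945165489699373144897, 12931343942442973092673, 180946283555838841601, 167111225500556677889, 385170926473427770177, 385171348273575975745, 180944168164186477313, 167109110108904313601, 12325469647147543124801, 12325483144752285702977, 12343479605685605464965, 12343479605685605464581, 10134410076413940486913, 10134410076413538226945, 316700314887587525569, 316700314887600096193, 316700314887587525569, 316700314887600096193, 12325469647160297610049, 12325483144765040188225, 12325469647160297610049, 12325483144765040188225, 10134410076402800818945, 10134410076403203078913, 10134410076402800819009, 10134410076403203078977, 10134410076402800818945, 10134410076403203078913]⟩,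
  ⟨⟨6, 8, [(4, 5), (4, 6), (2, 3), (3, 6), (2, 7), (1, 7), (0, 6), (0, 7)]⟩, .leaf 1, [285697251713, 4630096161866262, 11287255980417, 4084773794382336, 11282893904387, 11283085134273, 4630131562775046, 11283085068801, 11283085068801]⟩,
  ⟨⟨6, 9, [(4, 5), (4, 6), (3, 6), (3, 7), (2, 6), (2, 8), (1, 7), (1, 8), (0, 7), (0, 8)]⟩, .cut 124, [293091257227713, 293091259322817, 228786612480449, 293022604859841, 293022606954945, 230983488252353, 293091192214017, 293091190118913, 292953885383169, 226587589224961, 230981340768769, 292953887478273, 226585441741377, 228782317513281, 292953820369473, 293022472737345, 293022470642241, 292953818274369, 226585441741377, 228782317513281, 292953820369473, 293022472737345, 293022470642241, 292953818274369, 5895918985246409216, 5895918985782755840, 4220579924400947200, 11901533088647813, 11901533292069317, 4220579923864600576, 5913915792106193408, 5913915791569846784, 11901533155691141, 4797023084518326272, 4797023083981979648, 11901533292003845, 5895918985246425088, 5895918985782771712, 4220579924400931328, 11901533090742917, 11901533289974213, 4220579923864584704, 5913915792106209280, 5913915791569862656, 11901533157786245, 4797023084518310400, 4797023083981963776, 11901533289908741,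 11560955138152897, 11560955140248001, 11560746834334339, 11560817833417153, 11560817835512257, 11560746832239235, 11560955073139201, 11560955071044097, 11560749113940481, 11560815486702211, 11560815484607107, 11560749116035585, 11560952990669251, 11560952992764355, 11560748981817985, 11560817634185857, 11560817632090753, 11560748979722881, 11560952925655555, 11560952923560451, 11560748981817985, 11560817634185857, 11560817632090753, 11560748979722881, 11553822892169665, 11553820673002115, 11553827182561729, 361057099448775, 361056896027271, 11553822891788737, 11553822818388611, 11553820744686081, 361057099383303, 11553827180464641, 11553820744305153, 361056963070599, 11553822885497473, 11553820740110977, 11553827115452867, 361057097353671, 361056898122375, 11553822885878401, 11553822885497473, 11553820740110977, 361057097288199, 11553827113355779, 11553820740491905, 361056965165703, 11553889392413315, 11553891611644353, 11553891611199937, 361059043510917, 361059246932421, 11553895901972929, 11553889464160769, 11553891537799811, 361059110554245, 11553889463716353, 11553895899875841, 361059246866949, 11553889459522177, 11553891604908673, 11553891605353089, 361059045606021, 361059244837317, 11553895834864067, 11553889459522177, 11553891604908673, 361059112649349, 11553889459966593, 11553895832766979, 361059244771845]⟩,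
  ⟨⟨6, 11, [(5, 8), (4, 6), (4, 7), (3, 6), (3, 8), (2, 6), (2, 9), (1, 7), (1, 9), (0, 7), (0, 10), (8, 10), (9, 10)]⟩, .leaf 5, [153541894516592658944, 9792807162677697, 9792807162677697, 385287154232070723, 304083285349581441, 9436570025789889, 234563364207020673, 7330103181058497, 304087893838809729, 9502602666977985, 9502602666977985, 304083285343296129, 304083285343296129]⟩,
  ⟨⟨6, 12, [(5, 6), (5, 7), (4, 6), (4, 8), (3, 7), (3, 8), (2, 6), (2, 10), (1, 7), (1, 11), (0, 9), (0, 9), (8, 10), (9, 11), (10, 11)]⟩, .cut 513, [7503424300610054913, 7503424300610054721, 9807083746367990529, 9807083746367990337, 11966792170591251201, 11966792170591251009, 385310678226602838723, 385310678226596553411, 12036666201175452417, 12036666201175452225, 314320162489026759363, 314320162489020474051, 11971137840517114625, 11971137840517114433, 12040945767330892483, 12040945767324607171, 12040945767127542529, 12040945767127542337, 385310264548097286979, 385310264548103572291, 385310264548237789891, 385310264548231504579, 385310264548237789891, 385310264548231504579]⟩,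
  ⟨⟨6, 9, [(4, 5), (4, 6), (2, 3), (3, 6), (2, 7), (1, 6), (1, 7), (0, 8), (0, 8), (7, 8)]⟩, .cut 254, [6749621070401, 6749621070337, 5913915757225902082, 4797023049638019074, 11560953000892803, 11560815696157059, 4795932369503158272, 5912825077091041280, 361054752426625, 361054752426497, 11553879263035843, 11553879258845635, 361058722204289, 361058722204161, 11553879124628035, 11553879128818243]⟩,
  ⟨⟨6, 11, [(4, 5), (4, 6), (3, 6), (3, 7), (2, 6), (2, 8), (1, 7), (1, 8), (0, 9), (0, 10), (7, 9), (8, 10), (9, 10)]⟩, .cut 510, [226585441741505, 226585441741505, 7250734135724673, 226585441741441, 226585441741441, 7250734135724673, 226585441741505, 226585441741505, 226585441741377, 7250734135726657, 7250734135726657, 226585441741377, 7250734135728705, 7250734135728705, 226585441741377, 226585441741441, 226585441741441, 226585441741377, 5504178064282944552966, 5504195515731516866566, 5539936082374329122818, 5539918630925756809222, 5539936082374329122822, 5504195515731516866562, 6076044582016512966662, 6076027130567940653062, 6129637980532159037446, 6129655431980731351042, 6076044582016512966658, 6129655431980731351046, 7273353564550723551234, 7255483281229317423106, 7273353564550723551238,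 7255483281229317423110, 7255465829780745109510, 7273336113102151237638, 370095635925703107, 370095635860689411, 11842870555412142531, 370091242174159299, 370091242109145603, 11842874949163686339, 370095633713205763, 370095633778219459, 370089043150903747, 11842938725133064643, 11842945315760380355, 370089043085890051, 11843079458326452675, 11843081655202224579, 370089038790922755, 370091235666694659, 370091235731708355, 370089038855936451, 11553822885501697, 11553822885501697, 369722332336048769, 11553822885501569, 11553822885501569, 369722332336048769, 11553822885501697, 11553822885501697, 11553822885501505, 369722332336050753, 369722332336050753, 11553822885501505, 369722332336054849, 369722332336054849, 11553822885501505, 11553822885501569, 11553822885501569, 11553822885501505, 11831192341914782213, 369724760684694021, 11831192160857164293, 11831192204610046469, 369724756393921029, 11831192156566391301, 369724760682596869, 11831192341849770501, 11831192135892666885, 11831192229574543877, 11831192223138384389, 369724754246437381, 11831192362718530053, 11831192360573143557, 369724754242243077, 369724756387629573, 11831192204415011333, 11831192135762643461, 11553889459526401, 11553889459526401, 369724462704839297, 11553889459526273, 11553889459526273, 369724462704839297, 11553889459526401, 11553889459526401, 11553889459526209, 369724462704841281, 369724462704841281, 11553889459526209, 369724462704845377, 369724462704845377, 11553889459526209,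 11553889459526273, 11553889459526273, 11553889459526209, 369724462720901829, 11831182807021937349, 11831182807202941637, 369724462725092037, 11831182807026127557, 11831182807068854981, 11831182807086949061, 369724462718804677, 369724462725089989, 11831182807202878149, 11831182807001748165, 11831182807093234373, 11831182807068664517, 11831182807001621189, 11831182807223257797, 11831182807221162693, 369724462718800581, 369724462720895685, 11831183360473631237, 369724481516276229, 11831183408517286405, 11831183364764404229, 369724485807049221, 11831183545822022149, 369724479368792581, 11831183427045624325, 11831183433481783813, 11831183339799906821, 11831183545757010437, 369724485804952069, 11831183339669883397, 11831183408322251269, 369724481509984773, 369724479364598277, 11831183564480383493, 11831183566625769989, 369724462926418437, 11831182813645392389, 11831182813464388101, 369724462922228229, 11831182813511305733, 11831182813468578309, 11831182813645328901, 369724462926416389, 369724462920131077, 11831182813529399813, 11831182813535685125, 11831182813444198917, 11831182813663613445, 11831182813665708549, 11831182813444071941, 11831182813511115269, 369724462922222085, 369724462920126981]⟩,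
  ⟨⟨6, 11, [(4, 5), (5, 6), (4, 7), (3, 8), (2, 6), (2, 7), (1, 6), (1, 8), (0, 9), (0, 10), (7, 9), (8, 10), (9, 10)]⟩, .cut 510, [361125550496449, 361125550496449, 11556017615882881, 361125550496385, 361125550496385, 11556017615882881, 361125550496449, 361125550496449, 361125550496321, 11556017615884865, 11556017615884865, 361125550496321, 11556017615886913, 11556017615886913, 361125550496321, 361125550496385, 361125550496385, 361125550496321, 5539920266963138445316, 5504179700320326189056, 5504249506114501672964, 5504179700320326189060, 5539920266963138445312, 5539990072757313929220, 6076028766605322289152, 6129639616569540673540, 6076028766605322289156, 6076098572399497773060, 6129709422363716157444, 6129639616569540673536, 7255537271612302229508, 7273407554933708357636, 7273337749139532873728, 7255467465818126745600, 7273337749139532873732, 7255467465818126745604, 7320965508061953, 7320965508061953, 234270896257976961, 7320965508061825, 7320965508061825, 234270896257976961, 7320965508061953, 7320965508061953, 7320965508061761, 234270896257978945, 234270896257978945, 7320965508061761, 234270896257983041, 234270896257983041, 7320965508061761, 7320965508061825, 7320965508061825, 7320965508061761, 7496675086645742021, 234271096457679301, 7496675086468927941, 7496675086511655365, 234271096453489093,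 7496675086464737733, 234271096457677253, 7496675086645678533, 7496675086444548549, 7496675086536034757, 7496675086529749445, 234271096451391941, 7496675086666058181, 7496675086663963077, 234271096451387845, 234271096453482949, 7496675086511464901, 7496675086444421573, 241787709449118149, 7737206785790255557, 7731133289716851141, 241647109399716293, 7732707584209396165, 7731273889766252997, 7737204655486476741, 241787640729641413, 241576740655538629, 7733314720786358725, 7733525620860461509, 7730455853115187653, 7737818182974775749, 7737888482999476677, 7730451592507630021, 7732701193298059717, 241646903241286085, 241576603216585157, 7320971755281153, 7320971755281153, 234271096168991361, 7320971755281025, 7320971755281025, 234271096168991361, 7320971755281153, 7320971755281153, 7320971755280961, 234271096168993345, 234271096168993345, 7320971755280961, 234271096168997441, 234271096168997441, 7320971755280961, 7320971755281025, 7320971755281025, 7320971755280961, 7496675077874803397, 234271096185053893, 7496675077921721029, 7496675077878993605, 234271096189244101, 7496675078055807685, 234271096182956741, 7496675077939815109, 7496675077946100421, 7496675077854614213, 7496675078055744197, 234271096189242053, 7496675077854487237, 7496675077921530565, 234271096185047749, 234271096182952645, 7496675078074028741, 7496675078076123845, 7497042046316980613, 234282563943016837, 7497036252473207173, 7497037652565436805,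 234282426638281093, 7497036115168471429, 234282563875907973, 7497042044236605829, 7497035453609290117, 7497038451429353861, 7497038245472250245, 234282357918804357, 7497042712036911493, 7497042643384543621, 234282357784586629, 234282426436954501, 7497037646324312453, 7497035449448540549, 234891716401111493, 7514960514045518277, 7521034010118922693, 235032316450513349, 7515101114094920133, 7516534808538063301, 7517141945115025861, 234821347656933829, 235032247731036613, 7521031879815143877, 7514283077443854789, 7517352845189128645, 7516528417626726853, 7514278816836297157, 7521715707328143813, 7521645407303442885, 234821210217980357, 234891510242681285]⟩,
  ⟨⟨6, 13, [(5, 7), (4, 6), (4, 7), (3, 6), (3, 8), (2, 6), (2, 9), (1, 8), (1, 9), (0, 10), (0, 11), (7, 12), (8, 10), (9, 11), (10, 12), (11, 12)]⟩, .leaf 5, [233355587155510860267520, 399215700008210143747, 7496879718292480641, 245813704491352705, 304373625067225729, 229980820803240577, 304373556412762817, 304373494064562817, 304373491984124609, 7321171599502145, 7321171599502145, 7496879717890220673, 234277491184069249, 234277491184069313, 234277491184069249, 234277491184069313]⟩,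
  ⟨⟨6, 14, [(5, 6), (5, 7), (4, 6), (4, 8), (3, 6), (3, 10), (2, 7), (2, 8), (1, 9), (1, 9), (0, 11), (0, 12), (7, 11), (8, 12), (9, 10), (10, 13), (11, 13), (12, 13)]⟩, .cut 514, [404534240256999963329, 404174304130531211969, 404534240256999963329, 404174304130531211969, 383009266822014974657, 383009618322138479297, 330747263962226770689, 330387327835758019329, 9899493534675029425027, 9899493534675029424707, 12327622625078444452545, 12327622625067717520065, 313773529439949634241, 313773177939826129601, 385254662725574083329, 385254311225450578689, 12038693969457148865, 12038693969467624385, 12038693969457148865, 12038693969467624385, 385238207022628764353, 385238207022963980993, 385238207022628764417, 385238207022963981057, 12327622624724120464065, 12327622624734847396545, 385238207022628764353, 385238207022963980993, 385238207022628764417, 385238207022963981057]⟩,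
  ⟨⟨6, 13, [(5, 7), (4, 6), (4, 7), (3, 6), (3, 8), (2, 6), (2, 9), (1, 8), (1, 9), (0, 10), (0, 11), (7, 10), (8, 11), (9, 12), (10, 12), (11, 12)]⟩, .leaf 5, [232783668283431641956352, 12475485563423953475, 234277491196639873, 389790154380032641, 304373625067225793, 389721982578735745, 9739953805208412801, 304373494064562881, 9739951743491990145, 7321171599502145, 7321171599502145, 234277491184069249, 234277491184069313, 7496879717890220673, 234277491184069249, 234277491184069313]⟩,
  ⟨⟨6, 14, [(5, 6), (5, 7), (4, 6), (4, 9), (3, 6), (3, 10), (2, 8), (2, 8), (1, 7), (1, 9), (0, 11), (0, 12), (7, 11), (8, 10), (9, 13), (10, 12), (11, 13), (12, 13)]⟩, .cut 260, [5654636657375400705, 5222291093147833089, 404536421688071502529, 404104498336309000897, 5654570682449875713, 5222225118222308097, 10583982252585478875841, 10570160705329078823617, 180944104128501916227, 167109046073219752515, 385168401239479177985, 385168401239076918017, 316007316985429179073, 316006895185280973505, 12325843432378877962945, 12325829934774135384769, 12036512538385609665, 12036512538398180289, 12036512538385609665, 12036512538398180289, 385168401228339509953, 385168401228741769921, 12325388839306864323265,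 12325388839319736642241, 385168401228339510017, 385168401228741769985, 385168401228339509953, 385168401228741769921, 385168401228339510017, 385168401228741769985]⟩,
  ⟨⟨6, 8, [(4, 5), (3, 5), (4, 6), (3, 7), (2, 6), (1, 7), (0, 6), (0, 7)]⟩, .leaf 2, [285831401857, 3522339740386312, 4084757118846464, 2686846505345, 9146674315715, 4613088611927058, 2753485412801, 2686846374401, 2686846374401]⟩,
  ⟨⟨6, 9, [(4, 5), (5, 6), (4, 7), (3, 8), (2, 6), (2, 7), (1, 6), (1, 8), (0, 7), (0, 8)]⟩, .leaf 3, [148217552951099392, 293095550095809, 361265271017921, 166759718130812418, 292885101089217, 160752115982785, 292887175109187, 361125550561793, 361125550496321, 361125550496321]⟩,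
  ⟨⟨6, 10, [(5, 6), (5, 7), (4, 6), (4, 8), (3, 6), (3, 9), (2, 7), (2, 8), (1, 7), (1, 9), (0, 8), (0, 9)]⟩, .ear, [208808433553029745154, 383589239971320321, 383587043030534721, 301972156584759809, 383584906353451521, 301972165499490817, 383582709412665921, 162424481269502657, 162424481269502657, 190938150231623617026, 313715276026155521, 383589239971320321, 302115771950502401, 383587043030534721, 383584906353451521, 383582709412665921, 306400993573425857, 306400993573425857, 311533844956647937, 208826447419500136450, 374034760886323777, 311527378887518659, 374029750423396865, 311525254829117953, 162433810336979521, 374029750416724673, 374029750416724673, 385770671040827905, 385770671040827905, 190956164098094008322, 374102997244252673, 311529451073045059, 376140948172378625, 311525254829117953, 376208918101381827, 376208922862033475, 302117902254281217, 374105127548031489, 208844444242987189762, 302108500187353601, 169595891641360897, 302108566555415235, 374097988796684865, 374097988792046273, 374097988792046273, 385768474100042305, 385768474100042305, 374032630582544961, 313710882142552643, 190974160921581061634, 306410395456178753, 376216189678387779, 376209186545666625, 376209186545664579, 301972156586791425, 313708809957026243, 376140948174410241, 302108500189385217, 306408265152399937, 208827009854089987074, 376145818920819265, 376140948167611073, 376140948167611073,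 385766337422959105, 385766337422959105, 374029750421365249, 167414460571853313, 376214059374608963, 190956726532683858946, 376214055278748161, 306264785264202435, 376214053066250819, 301972163419116033, 313706685898625537, 313706685898625537, 302108566555417219, 376209186547698241, 376216185582526977, 208845006677577040386, 376209186542932673, 376209186542932673, 385764140482173505, 385764140482173505, 162435940640758337, 376208918101383811, 374097988794653249, 376143688617040449, 306264785264204419, 190974723356170912258, 376209186542869123, 162424481269504641, 306400993573427841, 374029750416726657, 374097988792048257, 376209186547696195, 376140948167613057, 376209186542934657, 376209186542867139, 208845552051987431426, 162424481269504641, 306400993573427841, 374029750416726657, 376208920781658691, 374097988792048257, 376140948167613057, 376216183370029635, 376209186542934657, 190975268730581303298]⟩,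
  ⟨⟨6, 10, [(4, 5), (5, 6), (4, 7), (3, 6), (3, 7), (2, 6), (2, 8), (1, 7), (1, 8), (0, 9), (0, 9), (8, 9)]⟩, .cut 510, [172511636124430516224, 208252202767242772480, 7182562334429889, 7182562334429761, 7250734137758401, 7250734137758273, 9372391815992001, 9372391815991873, 11555953254290113, 11555953254289985, 9372458390016705, 9372458390016577, 369794765029394947, 369794765025204739, 11556086402339521, 11556086402339393, 369794764890987139, 369794764895177347]⟩,
  ⟨⟨6, 12, [(5, 6), (5, 7), (4, 6), (4, 8), (3, 6), (3, 9), (2, 7), (2, 8), (1, 7), (1, 9), (0, 10), (0, 11), (8, 10), (9, 11), (10, 11)]⟩, .cut 1022, [162424481269506881, 162424481269506881, 5197583400624214721, 162424481269506753, 162424481269506753, 5197583400624214721, 162424481269506881, 162424481269506881, 162424481269506689, 5197583400624216705, 5197583400624216705, 162424481269506689, 5197583400624220801, 5197583400624220801, 162424481269506689, 162424481269506753, 162424481269506753, 162424481269506689, 306400993573430081, 306400993573430081, 9804831794349757121, 306400993573429953, 306400993573429953, 9804831794349757121, 306400993573430081, 306400993573430081, 306400993573429889, 9804831794349759105, 9804831794349759105,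 306400993573429889, 9804831794349763201, 9804831794349763201, 306400993573429889, 306400993573429953, 306400993573429953, 306400993573429889, 374029750416728897, 374029750416728897, 11968952013335319233, 374029750416728769, 374029750416728769, 11968952013335319233, 374029750416728897, 374029750416728897, 374029750416728705, 11968952013335321217, 11968952013335321217, 374029750416728705, 11968952013335325313, 11968952013335325313, 374029750416728705, 374029750416728769, 374029750416728769, 374029750416728705, 385238640030701197891, 12038708971901950531, 385238687097100311107, 385238644424452741699, 12038713365653494339, 385238827697149712963, 12038706772878694979, 385238708200422120003, 385238714791049435715, 385238616730503617091, 385238827630577719875, 12038713363506010691, 385238616597359630915, 385238686897384331843, 12038708965459499587, 12038706768583727683, 385238848933615508035, 385238851130491279939, 374097988792050497, 374097988792050497, 11971135641345610433, 374097988792050369, 374097988792050369, 11971135641345610433, 374097988792050497, 374097988792050497, 374097988792050305, 11971135641345612417, 11971135641345612417, 374097988792050305, 11971135641345616513, 11971135641345616513, 374097988792050305, 374097988792050369, 374097988792050369, 374097988792050305, 12038693969599683139, 385238207027189862979, 385238207027010890307, 12038693969595492931, 385238207027055776323, 385238207027015080515, 385238207027189799491, 12038693969599681091, 12038693969593395779,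 385238207027075902019, 385238207027082187331, 385238207026988669507, 385238207027210115651, 385238207027212210755, 385238207026988542531, 385238207027055585859, 12038693969595486787, 12038693969593391683, 376140948167615297, 376140948167615297, 12036510341363684033, 376140948167615169, 376140948167615169, 12036510341363684033, 376140948167615297, 376140948167615297, 376140948167615105, 12036510341363686017, 12036510341363686017, 376140948167615105, 12036510341363690113, 12036510341363690113, 376140948167615105, 376140948167615169, 376140948167615169, 376140948167615105, 385247834896136018499, 12038994840361769539, 385247651623439047235, 385247694296086616643, 12038990446610225731, 385247647229687503427, 12038994838214285891, 385247834829564025411, 385247623929489922627, 385247721990035741251, 385247715399408425539, 12038988247586970179, 385247858329477585475, 385247856132601813571, 12038988243292002883, 12038990440167774787, 385247694096370637379, 385247623796345936451, 376209186542936897, 376209186542936897, 12038693969373975233, 376209186542936769, 376209186542936769, 12038693969373975233, 376209186542936897, 376209186542936897, 376209186542936705, 12038693969373977217, 12038693969373977217, 376209186542936705, 12038693969373981313, 12038693969373981313, 376209186542936705, 376209186542936769, 376209186542936769, 376209186542936705, 12038693969394166531, 385238207020568439555, 385238207020747412227, 12038693969398356739, 385238207020572629763, 385238207020613325571, 385238207020633451267,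 12038693969392069379, 12038693969398354691, 385238207020747348739, 385238207020546218755, 385238207020639736579, 385238207020613135107, 385238207020546091779, 385238207020769760003, 385238207020767664899, 12038693969392065283, 12038693969394160387]⟩,
  ⟨⟨6, 9, [(4, 5), (5, 6), (4, 7), (3, 6), (2, 6), (2, 8), (1, 7), (1, 8), (0, 7), (0, 8)]⟩, .cut 124, [230983488315841, 361192327877057, 361192325781953, 228786612543937, 361260980244929, 361260978149825, 361123608400385, 230981340832257, 226587589288449, 361123606305281, 361260911041025, 361260913136129, 361123539196481, 361192191564353, 361192193659457, 361123541291585, 228782317576769, 226585441804865, 361123539196481, 361192191564353, 361192193659457, 361123541291585, 228782317576769, 226585441804865, 5895918950901893124, 5895918952464253440, 4220579891082444800, 7189234557913733, 7189234761335237, 4220579889520576516, 5913915758787691008, 5913915757225330692, 7189234624957061, 4797023051199823872, 4797023049637955588, 7189234761269765, 5895918950902401028, 5895918952464269312, 4220579891082428928, 7189234560008837, 7189234759240133, 4220579889520068612, 5913915758787706880, 5913915757225838596, 7189234627052165, 4797023051199808000, 4797023049637447684, 7189234759174661, 7182562546229697, 7182491534576259, 7182699840489921, 361121389875591, 361329693495687,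 7182562535754177, 7182560186944131, 7182493826753025, 361190042243463, 7182699773381121, 7182493816277505, 361329626452359, 7182562334427777, 7182493682059905, 7182697693006275, 361123535262087, 361327548109191, 7182562344903297, 7182562334427777, 7182493682059905, 361192187629959, 7182697625897475, 7182493692535425, 361327481065863, 7410794417693121, 7410794549875137, 7404128760631939, 7406400666149313, 7406400798331329, 7404128628449923, 7410792402391553, 7410792270209537, 7404201642893825, 7406325636403843, 7406325504221827, 7404201775075841, 7410725698216387, 7410725830398403, 7404197480108673, 7406394355880577, 7406394223698561, 7404197347926657, 7410723682914819, 7410723550732803, 7404197480108673, 7406394355880577, 7406394223698561, 7404197347926657, 7188896949619331, 7188899168850369, 7188899168405953, 224653029673605, 224653233095109, 7188903459178945, 7188897021366785, 7188899095005827, 224653096716933, 7188897020922369, 7188903457081857, 224653233029637, 7188897016728193, 7188899162114689, 7188899162559105, 224653031768709, 224653231000005, 7188903392070083, 7188897016728193, 7188899162114689, 224653098812037, 7188897017172609, 7188903389972995, 224653230934533]⟩,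
  ⟨⟨6, 11, [(5, 6), (4, 6), (4, 8), (3, 6), (3, 9), (2, 7), (2, 8), (1, 7), (1, 9), (0, 7), (0, 10), (8, 10), (9, 10)]⟩, .leaf 5, [189803277792859194880, 5076112735013313, 385352662824141441, 5075769473173953, 385282360719002241, 12038012056177089, 385213987052339841, 12035879606948289, 385143684947200641, 9575031049169601, 9575031049169601, 306400993573427841, 306400993573427841]⟩,
  ⟨⟨6, 12, [(5, 6), (5, 9), (4, 6), (4, 10), (3, 6), (3, 11), (2, 7), (2, 7), (1, 8), (1, 9), (0, 8), (0, 10), (7, 8), (9, 11), (10, 11)]⟩, .cut 132, [229987063471368965, 229987063471368645, 9944513768522607365, 9944513768522607045, 230055301846690565, 230055301846690245, 12180548853208214277, 12180548853208213957, 5505886536147208705, 5145598565957569025, 380642151199107845, 380642151199107525, 12180926527185756551, 12180915542806897031, 12202727787102038789, 12202727787102038469, 12180563699421553031, 12180574683800412551, 9968942438565309189, 9968942438565308869, 12180548838371322629, 12180548838371322309, 12180548838371322629, 12180548838371322309]⟩,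
  ⟨⟨6, 11, [(5, 6), (4, 6), (4, 7), (3, 6), (3, 8), (2, 7), (2, 9), (1, 7), (1, 10), (0, 8), (0, 9), (8, 10), (9, 10)]⟩, .leaf 5, [189247558262815506432, 9792669853749699, 12042270644179395, 9441169730245059, 385282358575645315, 12038072319746499, 385214186772253315, 9504797529352899, 9504797529352899, 385077712102048387, 385075579652819587, 304153520939293315, 304153520939293315]⟩,
  ⟨⟨6, 12, [(5, 6), (5, 7), (4, 6), (4, 9), (3, 6), (3, 11), (2, 8), (2, 8), (1, 7), (1, 10), (0, 9), (0, 10), (7, 8), (9, 11), (10, 11)]⟩, .cut 260, [229984868738886405, 229984868738886149, 12493144179855663495, 12484145776693944711, 230050908093049605, 230050908093049349, 12036574333901236997, 12036574333901236741, 5505886529771676225, 5217656153619964481, 376142947470764805, 376142947470764549, 12051800624783237511, 12060799027944956295, 9872618479287364357, 9872618479287364101, 9896884840236608261, 9896884840236608005, 12036598100175907589, 12036598100175907333, 12036574319064345349, 12036574319064345093, 12036574319064345349, 12036574319064345093]⟩,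
  ⟨⟨6, 9, [(4, 5), (3, 5), (4, 6), (3, 7), (2, 6), (1, 6), (1, 7), (0, 8), (0, 8), (7, 8)]⟩, .cut 254, [9146605113921, 9146605113857, 4795932368951066626, 5912825076538949634, 4795932352843399168, 5912825060431282176, 154015591844481, 154015591844353, 4934958850261443, 4934958846071235, 5158926213783939, 5154532462240131, 154217459305089, 154217459304961, 4934958711853635, 4934958716043843]⟩,
  ⟨⟨6, 11, [(4, 5), (5, 6), (4, 7), (3, 6), (2, 6), (2, 8), (1, 7), (1, 8), (0, 9), (0, 10), (7, 9), (8, 10), (9, 10)]⟩, .cut 510, [361123539196609, 361123539196609, 11555953254288001, 361123539196545, 361123539196545, 11555953254288001, 361123539196609, 361123539196609, 361123539196481, 11555953254289985, 11555953254289985, 361123539196481, 11555953254292033, 11555953254292033, 361123539196481, 361123539196545, 361123539196545, 361123539196481, 5504178064249122209794, 5504195515697678270470, 5504249506115086778374, 5539918630891934466050, 5539936082340490526726, 5539990072757899034630, 6076044581982674370566, 6076027130534118309890, 6129637980498336694274, 6076098572400082878470, 6129709422364301262854, 6129655431946892754950, 7255537271612887334918, 7273407554934293463046, 7273353564516884955142,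 7255483281195478827014, 7255465829746922766338, 7273336113068328894466, 7182562334432001, 7182562334432001, 229841994701818497, 7182562334431873, 7182562334431873, 229841994701818497, 7182562334432001, 7182562334432001, 7182562334431809, 229841994701820481, 229841994701820481, 7182562334431809, 229841994701824577, 229841994701824577, 7182562334431809, 7182562334431873, 7182562334431873, 7182562334431809, 7361440080493742597, 230045002515286533, 7361439899436124677, 7361439943189006853, 230044998224513541, 7361439895145351685, 230045002513189381, 7361440080428730885, 7361439874471627269, 7361439968153504261, 7361439961717344773, 230044996077029893, 7361440101297490437, 7361440099152103941, 230044996072835589, 230044998218222085, 7361439942993971717, 7361439874341603845, 241787709516227011, 241787707500925443, 7731133289783960003, 241647109466825155, 241647107451523587, 7731273889833361859, 241787638781448707, 241787640796750275, 241576740722647491, 7733314720853467587, 7733525620927570371, 241576738707345923, 7737818183041884611, 7737888483066585539, 241576601268392451, 241646901293093379, 241646903308394947, 241576603283694019, 7188897016732417, 7188897016732417, 230044704535431809, 7188897016732289, 7188897016732289, 230044704535431809, 7188897016732417, 7188897016732417, 7188897016732225, 230044704535433793, 230044704535433793, 7188897016732225, 230044704535437889, 230044704535437889, 7188897016732225,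 7188897016732289, 7188897016732289, 7188897016732225, 230044704551494341, 7361430545600897733, 7361430545781902021, 230044704555684549, 7361430545605087941, 7361430545647815365, 7361430545665909445, 230044704549397189, 230044704555682501, 7361430545781838533, 7361430545580708549, 7361430545672194757, 7361430545647624901, 7361430545580581573, 7361430545802218181, 7361430545800123077, 230044704549393093, 230044704551488197, 7361431099052591621, 230044723346868741, 7361431147096246789, 7361431103343364613, 230044727637641733, 7361431284400982533, 230044721199385093, 7361431165624584709, 7361431172060744197, 7361431078378867205, 7361431284335970821, 230044727635544581, 7361431078248843781, 7361431146901211653, 230044723340577285, 230044721195190789, 7361431303059343877, 7361431305204730373, 230044704757010949, 7361430552224352773, 7361430552043348485, 230044704752820741, 7361430552090266117, 7361430552047538693, 7361430552224289285, 230044704757008901, 230044704750723589, 7361430552108360197, 7361430552114645509, 7361430552023159301, 7361430552242573829, 7361430552244668933, 7361430552023032325, 7361430552090075653, 230044704752814597, 230044704750719493]⟩,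
  ⟨⟨6, 11, [(4, 5), (5, 7), (4, 8), (3, 6), (2, 6), (2, 7), (1, 6), (1, 8), (0, 9), (0, 10), (7, 9), (8, 10), (9, 10)]⟩, .cut 510, [156483377830593, 156483377830593, 5007468090575489, 156483377830529, 156483377830529, 5007468090575489, 156483377830593, 156483377830593, 156483377830465, 5007468090577473, 5007468090577473, 156483377830465, 5007468090579521, 5007468090579521, 156483377830465, 156483377830529, 156483377830529, 156483377830465, 5539920266963089178628, 5539938263769933217796, 5539990618115601399808, 5504179700320276922372, 5504197697127120961540, 5504250051472789143552, 6129657613376335446020, 6129639616569491406852, 6076028766605273022468, 6129709967722003628032, 6076099117757785243648, 6076046763412117061636, 7273408100291995828224, 7255537816970589700096, 7255485462624921518084, 7273355745946327646212, 7273337749139483607044, 7255467465818077478916, 7354891251938042371, 229840399670518275, 7354892789335007747, 7354891389242778115, 229840536975254019, 7354897183086551555, 229840330951041539, 7354893382241821187, 7354893588198924803, 7354890590378861059, 7354897181006176771, 229840536908145155, 7354890586218111491, 7354892783093883395, 229840399469191683, 229840330816823811, 7354897780154114563, 7354897848806482435, 229840064597742083, 7354882067127749123, 7354882066946744835, 229840064593551875,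 7354882066993662467, 7354882066950935043, 7354882067127685635, 229840064597740035, 229840064591454723, 7354882067011756547, 7354882067018041859, 7354882066926555651, 7354882067145970179, 7354882067148065283, 7354882066926428675, 7354882066993472003, 229840064593545731, 229840064591450627, 241787709648474499, 241787707566066053, 7731133289916207491, 241647109599072643, 241647107516664197, 7731273889965609347, 241787638846589317, 241787640928997763, 241576740854894979, 7733314720985715075, 7733525621059817859, 241576738772486533, 7737818183174132099, 7737888483198833027, 241576601333533061, 241646901358233989, 241646903440642435, 241576603415941507, 7180369625504513, 7180369625504513, 229771828016138881, 7180369625504385, 7180369625504385, 229771828016138881, 7180369625504513, 7180369625504513, 7180369625504321, 229771828016140865, 229771828016140865, 7180369625504321, 229771828016144961, 229771828016144961, 7180369625504321, 7180369625504385, 7180369625504385, 7180369625504321, 7355178658054873603, 229849333059887619, 7355172864211100163, 7355174264303329795, 229849195755151875, 7355172726906364419, 229849332992778755, 7355178655974498819, 7355172065347183107, 7355175063167246851, 7355174857210143235, 229849127035675139, 7355179323774804483, 7355179255122436611, 229849126901457411, 229849195553825283, 7355174258062205443, 7355172061186433539, 7182502011689729, 7182502011689729, 229840064374065793, 7182502011689601,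 7182502011689601, 229840064374065793, 7182502011689729, 7182502011689729, 7182502011689537, 229840064374067777, 229840064374067777, 7182502011689537, 229840064374071873, 229840064374071873, 7182502011689537, 7182502011689601, 7182502011689601, 7182502011689537, 229840064392225475, 7354882060504294083, 7354882060685298371, 229840064396415683, 7354882060508484291, 7354882060551211715, 7354882060569305795, 229840064390128323, 229840064396413635, 7354882060685234883, 7354882060484104899, 7354882060575591107, 7354882060551021251, 7354882060483977923, 7354882060705614531, 7354882060703519427, 229840064390124227, 229840064392219331]⟩,
  ⟨⟨6, 13, [(5, 6), (4, 6), (4, 7), (3, 6), (3, 8), (2, 7), (2, 9), (1, 8), (1, 9), (0, 10), (0, 11), (7, 10), (8, 11), (9, 12), (10, 12), (11, 12)]⟩, .leaf 5, [233356648847822348632064, 317869035014470273, 389856260308220545, 302121829481462401, 389785958203081409, 389721982578735745, 12470969164790063745, 389651680473596609, 12468785536779772545, 9504799676836673, 9504799676836673, 304153589658774145, 304153589658774209, 9732914869080777345, 304153589658774145, 304153589658774209]⟩,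
  ⟨⟨6, 14, [(5, 6), (5, 6), (4, 7), (4, 8), (3, 7), (3, 9), (2, 8), (2, 10), (1, 9), (1, 10), (0, 11), (0, 12), (6, 7), (8, 11), (9, 12), (10, 13), (11, 13), (12, 13)]⟩, .cut 96, [330756053464359518913, 330180155662009516737, 12572095453518250689, 11995634701214827201, 311733429180486009537, 312309326982836011713, 12572025151413111553, 11995564399109688065, 12571961175788765889, 11995500423485342401, 402302623347511028417, 383855879273801476801, 12571890873683626753, 11995430121380203265, 402300439719500737217, 383853695645791185601, 9805042900651045825, 9805042900667806657, 9805042900651045825, 9805042900667806657, 313761372820833467073, 313761372821369813697, 313761372820833467137, 313761372821369813761, 10040363930266670951105, 10040363930283834043073, 313761372820833467073, 313761372821369813697, 313761372820833467137, 313761372821369813761]⟩,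
  ⟨⟨6, 13, [(5, 6), (4, 6), (4, 7), (3, 6), (3, 9), (2, 7), (2, 8), (1, 8), (1, 9), (0, 10), (0, 11), (7, 10), (8, 11), (9, 12), (10, 12), (11, 12)]⟩, .leaf 5, [233356648847822348632064, 317869037159856769, 389856262453607041, 302121831626848897, 12473150662431564417, 389719785702963841, 389717786401784513, 389651747047621313, 12468783406410982017, 9504731024468801, 9504731024468801, 304151392783002241, 304151392783002305, 9732844569056076417, 304151392783002241, 304151392783002305]⟩,
  ⟨⟨6, 14, [(5, 6), (5, 6), (4, 7), (4, 8), (3, 7), (3, 10), (2, 8), (2, 9), (1, 9), (1, 10), (0, 11), (0, 12), (6, 7), (8, 11), (9, 12), (10, 13), (11, 13), (12, 13)]⟩, .cut 96, [330756053466504905409, 330180155664154903233, 12572095455663637185, 11995634703360213697, 311733429182631396033, 312309326984981398209, 402304804845152529089, 383858060771442977473, 12571958978912993985, 11995498226609570497, 12571956979611814657, 11995496227308391169, 12571890940257651457, 11995430187954227969, 402300437589131946689, 383853693515422395073, 9804972600626344897, 9804972600643105729, 9804972600626344897, 9804972600643105729, 313759123220043037377, 313759123220579384001, 313759123220043037441,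 313759123220579384065, 10040291943041377200833, 10040291943058540292801, 313759123220043037377, 313759123220579384001, 313759123220043037441, 313759123220579384065]⟩,
  ⟨⟨5, 5, [(0, 1), (1, 2), (2, 3)]⟩, .leaf 4, [8390791, 8589377, 87544102918, 87511025664, 85917238790]⟩,
  ⟨⟨5, 6, [(2, 4), (1, 3), (2, 5), (1, 5), (0, 5)]⟩, .leaf 0, [272959681, 203755777, 3386063749138, 3386616856594, 8736745543, 8734650439, 3386633109504]⟩,
  ⟨⟨5, 7, [(2, 4), (1, 3), (2, 5), (1, 5), (0, 6), (0, 6), (5, 6)]⟩, .cut 62, [8734710209, 8734710145, 6520185281, 6520185217, 4613088563200000, 3522373028446208, 4613089116307456, 3522373581553664, 8949101635655, 8948967548999, 8944672585799, 8944806672455]⟩,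
  ⟨⟨5, 9, [(3, 4), (3, 5), (2, 6), (1, 5), (1, 6), (0, 7), (0, 8), (5, 7), (6, 8), (7, 8)]⟩, .leaf 2, [214895241665, 148164296462843934, 9021725682113, 148166426766622726, 288430693421635, 9013074997761, 281658397249, 281658397249, 9013068712385, 9013068712449, 9013068712385]⟩,
  ⟨⟨5, 6, [(3, 4), (2, 3), (2, 5), (1, 5), (0, 5)]⟩, .leaf 1, [274868289, 140773697, 3385558368788, 2854056133132, 8795851073, 3386633093632, 8795785601]⟩,
  ⟨⟨5, 7, [(3, 4), (2, 3), (2, 5), (1, 5), (0, 6), (0, 6), (5, 6)]⟩, .leaf 1, [4504758657, 108423800700952, 108424353300492, 281469331841, 91914498998784, 8795785665, 281465141633]⟩,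
  ⟨⟨5, 8, [(3, 4), (2, 3), (2, 7), (1, 5), (1, 5), (0, 6), (0, 6), (5, 7), (6, 7)]⟩, .cut 34, [86174218625, 79731767681, 94702192277062146, 147056537945244162, 94702192828645888, 147056538496827904, 288229352094081, 288229150964097, 9007026750017, 9007033035329, 288224856000897, 288225057130881]⟩,
  ⟨⟨5, 10, [(3, 4), (3, 5), (2, 6), (2, 6), (1, 5), (1, 7), (0, 8), (0, 9), (5, 8), (6, 7), (7, 9), (8, 9)]⟩, .cut 68, [5094043105857, 4819165198913, 169610244428216696834, 171916017068686213122, 9243186650229249, 9242912040757761, 9229850978114181, 9229850978113925, 9229393621039681, 9229393352866369, 288418273841857, 288418282222273, 288418273841857, 288418282222273, 9229384762939905, 9229385031113217, 9229384762939969, 9229385031113281, 9229384762939905, 9229385031113217]⟩,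
  ⟨⟨5, 10, [(3, 4), (4, 5), (3, 7), (2, 5), (1, 6), (1, 6), (0, 8), (0, 9), (5, 8), (6, 7), (7, 9), (8, 9)]⟩, .cut 66, [2890857134657, 2615979227713, 116000488373932786176, 189785212868957307392, 4873055337994883, 4873055337994627, 4864469895625281, 4864469627451969, 5299728126585345, 5290940623497729, 152014407422657, 152014415803073, 152014407422657, 152014415803073, 4864461037525505, 4864461305698817, 4864461037525569, 4864461305698881, 4864461037525505, 4864461305698817]⟩,
  ⟨⟨5, 12, [(4, 5), (3, 5), (3, 6), (2, 6), (2, 9), (1, 7), (1, 10), (0, 8), (0, 11), (5, 7), (6, 8), (7, 10), (8, 11), (9, 10), (9, 11)]⟩, .leaf 4, [6038593105032396145152, 2755677000977089, 315474559138673153, 2975441952649729, 315406122912205505, 97042852629185, 97042852629185, 92982156272385, 92982156272385, 2771055131380417, 2975429000716801, 2771055131380417, 2975429000716801, 2982161363913409, 2975429000716993]⟩,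
  ⟨⟨5, 13, [(4, 5), (4, 5), (3, 6), (3, 7), (2, 6), (2, 9), (1, 8), (1, 10), (0, 11), (0, 12), (5, 7), (6, 8), (7, 11), (8, 10), (9, 10), (9, 12), (11, 12)]⟩, .cut 48, [10191873212873323011, 9615412460569899523, 3046839316648377025, 3046839316112030401, 10191807175329004225, 9615346423025580737, 10191800110297139843, 9615339357993716355, 318491841840495297, 300477443331013313, 104506740040682241, 103944339843074817, 95213728158739329, 95213728175500161, 95213728158739329, 95213728175500161, 10192211812385241793, 9615751060081818305, 3046839301079659201, 3046839301616005825, 10192211812385241793, 9615751060081818305, 3058868095595727617, 3058305695398120193, 3046839301079659265, 3046839301616005889, 3046839301079659201, 3046839301616005825]⟩,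
  ⟨⟨5, 7, [(3, 4), (3, 5), (2, 6), (1, 5), (1, 6), (0, 5), (0, 6)]⟩, .leaf 2, [6715476289, 108424353300488, 281794709825, 126531934880768, 281656299971, 281658462593, 281658397121, 281658397121]⟩,
  ⟨⟨5, 8, [(3, 4), (3, 5), (2, 5), (2, 6), (1, 5), (1, 6), (0, 7), (0, 7), (6, 7)]⟩, .cut 126, [150401655297, 150401655233, 131277378408169472, 166180275520290816, 288641144721731, 288636853948739, 9013068710465, 9013068710337, 288420494588291, 288420490398083, 9013135753793, 9013135753665, 288420356180483, 288420360370691]⟩,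
  ⟨⟨5, 10, [(4, 6), (3, 5), (3, 6), (2, 5), (2, 7), (1, 5), (1, 7), (0, 8), (0, 9), (6, 8), (7, 9), (8, 9)]⟩, .leaf 4, [4777373161875898368, 9717913282351427, 156210330612225, 303617758409217, 224596869593665, 303549106041345, 224596802550337, 4881572569729, 4881572569729, 156210322231809, 156210322231873, 156210322231809]⟩,
  ⟨⟨5, 11, [(4, 5), (4, 6), (3, 5), (3, 6), (2, 5), (2, 8), (1, 7), (1, 7), (0, 9), (0, 10), (6, 9), (7, 8), (8, 10), (9, 10)]⟩, .cut 130, [3052532253475457, 2771057276764801, 316028727486263873, 315747527387460161, 3052463601107585, 2770988624396929, 243971133448401473, 243689933349597761, 299714294755517123, 299714294755516867, 301963440332161665, 301963440063988353, 9436357233564417, 9436357241944833, 9436357233564417, 9436357241944833, 301963431474061889, 301963431742235201, 301963431474061953, 301963431742235265, 301963431474061889, 301963431742235201]⟩,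
  ⟨⟨5, 7, [(3, 4), (4, 5), (3, 6), (2, 5), (1, 6), (0, 5), (0, 6)]⟩, .leaf 2, [8803914049, 91912887403520, 81814556993, 281794642307, 125998838842372, 83896834433, 81814426049, 81814426049]⟩,
  ⟨⟨5, 8, [(4, 5), (3, 5), (3, 6), (2, 5), (2, 7), (1, 6), (1, 7), (0, 6), (0, 7)]⟩, .leaf 4, [4595512465983488, 7155755714945, 9352631486849, 6949798611329, 9350486034881, 9348470610305, 9348405596609, 7012008403457, 7012008403457]⟩,
  ⟨⟨5, 9, [(4, 5), (4, 6), (3, 5), (3, 6), (2, 5), (2, 7), (1, 6), (1, 7), (0, 8), (0, 8), (7, 8)]⟩, .cut 254, [222253900122753, 222253900122625, 224384268913281, 224384268913153, 292622644234881, 292622644234753, 294753013025409, 294753013025281, 292689218259585, 292689218259457, 9436357306892739, 9436357302702531, 294886161074817, 294886161074689, 9436357168484931, 9436357172675139]⟩,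
  ⟨⟨5, 8, [(3, 4), (4, 5), (3, 6), (2, 5), (1, 5), (1, 6), (0, 7), (0, 7), (6, 7)]⟩, .cut 126, [281725440513, 281725440449, 131277377350713344, 166180274462834688, 4744200602177, 4744200602049, 152014480750979, 152014476560771, 158948632240451, 158811327504707, 4750447821377, 4750447821249, 152014342343171, 152014346533379]⟩,
  ⟨⟨5, 10, [(4, 5), (3, 5), (3, 6), (2, 5), (2, 7), (1, 6), (1, 7), (0, 8), (0, 9), (6, 8), (7, 9), (8, 9)]⟩, .leaf 4, [5336311084373524480, 233382229389825, 303682254090753, 222397850530305, 303613599627841, 303549106041345, 303547025603137, 7012008403585, 7012008403585, 224384268915201, 224384268915265, 224384268915201]⟩,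
  ⟨⟨5, 11, [(4, 5), (4, 5), (3, 6), (3, 7), (2, 6), (2, 8), (1, 7), (1, 8), (0, 9), (0, 10), (5, 6), (7, 9), (8, 10), (9, 10)]⟩, .cut 48, [243977588790344257, 243555788642138689, 9807862914169409, 9385650449103425, 230045002644929089, 230466802793134657, 9807794259706497, 9385581794640513, 9807729766120001, 9385517301054017, 9807727685681793, 9385515220615809, 7250734137760513, 7250734150331137, 7250734137760513, 7250734150331137, 232023492408336961, 232023492810596929, 232023492408337025, 232023492810596993, 232023492408336961, 232023492810596929]⟩,
  ⟨⟨4, 4, [(0, 1), (1, 2)]⟩, .leaf 3, [196677, 200769, 2181611520, 2148058112]⟩,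
  ⟨⟨4, 5, [(2, 3), (2, 4), (1, 4), (0, 4)]⟩, .leaf 3, [2363585, 4393217, 88063641092, 71455227904, 77795585, 75635009]⟩,
  ⟨⟨4, 6, [(2, 3), (3, 4), (2, 4), (1, 5), (0, 5), (4, 5)]⟩, .leaf 1, [205793345, 6715476289, 140904769, 205916481, 2854057148928, 6585387393, 6585452865]⟩,
  ⟨⟨4, 7, [(2, 3), (3, 4), (2, 4), (1, 6), (0, 5), (0, 5), (4, 6), (5, 6)]⟩, .cut 33, [6585452993, 6585452865, 6876794202499, 6876790012291, 81877221825, 81877221697, 81879253441, 81879253313, 6743511808515, 6743515998723, 6743650216323, 6743646026115]⟩,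
  ⟨⟨4, 6, [(3, 4), (2, 4), (1, 4), (1, 5), (0, 5), (0, 5)]⟩, .cut 30, [6715474243, 6715408771, 4570087747, 4570022275, 219513424133, 219379337477, 214825974149, 214830164357, 126531935420416, 91381923069952]⟩,
  ⟨⟨4, 8, [(3, 4), (2, 4), (1, 5), (1, 6), (0, 5), (0, 7), (4, 6), (5, 7), (6, 7)]⟩, .leaf 3, [6585452865, 3503134275535360, 154828933441, 146247070145, 4570220865, 146247006531, 4570218819, 146247387457, 146247450947, 146247387457]⟩,
  ⟨⟨4, 9, [(3, 6), (2, 4), (2, 4), (1, 5), (1, 7), (0, 5), (0, 8), (4, 6), (5, 7), (6, 8), (7, 8)]⟩, .cut 20, [156980740419, 146243322179, 233719516889411, 233376255050051, 224580169972033, 224923431811393, 7018130311489, 7028857243969, 224580169908675, 224923431748035, 7018130309443, 7028857241923, 224580170352961, 224923432192321, 224580170416451, 224923432255811, 224580170352961, 224923432192321]⟩,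
  ⟨⟨3, 3, [(0, 1)]⟩, .leaf 0, [1064962, 4099, 51396608]⟩,
  ⟨⟨3, 4, [(1, 3), (0, 3), (0, 3)]⟩, .cut 6, [4456643, 4391171]⟩,
  ⟨⟨3, 3, [(0, 1), (0, 1)]⟩, .leaf 2, [137281]⟩,
  ⟨⟨2, 2, []⟩, .leaf 0, [65]⟩]

theorem checkRange_table_0 : checkRange table 0 15 = true := by decide +kernel

theorem checkRange_table_15 : checkRange table 15 10 = true := by decide +kernel

theorem checkRange_table_25 : checkRange table 25 10 = true := by decide +kernel

theorem checkRange_table_35 : checkRange table 35 20 = true := by decide +kernel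

theorem checkRange_table_55 : checkRange table 55 20 = true := by decide +kernel

theorem checkRange_table_75 : checkRange table 75 40 = true := by decide +kernel

theorem sound_table {W : Type*} {I : SimpleGraph W} {mk br : W → Prop} (hN : Net I mk br) :
    Sound I mk br table := by
  have h : Sound I mk br (table.drop 115) := by
    rw [List.drop_eq_nil_of_le (by decide +kernel : table.length ≤ 115)]
    simp [Sound]
  have h := h.of_drop (i := 75) hN checkRange_table_75
  have h := h.of_drop (i := 55) hN checkRange_table_55
  have h := h.of_drop (i := 35) hN checkRange_table_35
  have h := h.of_drop (i := 25) hN checkRange_table_25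
  have h := h.of_drop (i := 15) hN checkRange_table_15
  exact h.of_drop (i := 0) hN checkRange_table_0

theorem exists_entry_start (k : ℕ) (h2 : 2 ≤ k) (h6 : k ≤ 6) :
    ∃ e ∈ table, e.skel = start k := by
  have h : ∀ i : ℕ, (table[i]?).map Entry.skel = some (start k) → ∃ e ∈ table, e.skel = start k := by
    intro i hi
    obtain ⟨e, he, hs⟩ := Option.map_eq_some_iff.1 hi
    exact ⟨e, List.mem_of_getElem? he, hs⟩
  interval_cases k
  exacts [h 114 rfl, h 111 rfl, h 104 rfl, h 83 rfl, h 0 rfl]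

theorem good_start {W : Type*} {I : SimpleGraph W} {mk br : W → Prop} (hN : Net I mk br) (k : ℕ)
    (h2 : 2 ≤ k) (h6 : k ≤ 6) : Good I mk br (start k) := by
  obtain ⟨e, he, hs⟩ := exists_entry_start k h2 h6
  exact hs ▸ (sound_table hN e he).2

end Skeleton

namespace Skeleton

variable {V : Type*}

/-- The nodes of the subdivision of a graph in which every edge becomes a path of length four. -/
inductive Node (G : SimpleGraph V)
  | vert (v : V)
  | dart (d : G.Dart)
  | edge (e : G.edgeSet)

namespace Node

variable {G : SimpleGraph V}

inductive Rel : Node G → Node G → Prop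
  | vert_dart (d : G.Dart) : Rel (vert d.fst) (dart d)
  | dart_edge (d : G.Dart) : Rel (dart d) (edge ⟨d.edge, d.edge_mem⟩)

def graph (G : SimpleGraph V) : SimpleGraph (Node G) where
  Adj x y := Rel x y ∨ Rel y x
  symm := ⟨fun _ _ => Or.symm⟩
  loopless := ⟨fun x h => by rcases h with h | h <;> cases x <;> cases h⟩

theorem vert_adj {v : V} {x : Node G} (h : (graph G).Adj (vert v) x) :
    ∃ d : G.Dart, d.fst = v ∧ x = dart d := by
  rcases h with h | h <;> cases h
  exact ⟨_, rfl, rfl⟩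

theorem dart_adj {d : G.Dart} {x : Node G} (h : (graph G).Adj (dart d) x) :
    x = vert d.fst ∨ x = edge ⟨d.edge, d.edge_mem⟩ := by
  rcases h with h | h <;> cases h <;> simp

theorem edge_adj {e : G.edgeSet} {x : Node G} (h : (graph G).Adj (edge e) x) :
    ∃ d : G.Dart, d.edge = e ∧ x = dart d := by
  rcases h with h | h <;> cases h
  exact ⟨_, rfl, rfl⟩

theorem adj_vert (d : G.Dart) : (graph G).Adj (dart d) (vert d.fst) := Or.inr (.vert_dart d)

theorem adj_edge (d : G.Dart) {e : G.edgeSet} (h : d.edge = e) :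
    (graph G).Adj (dart d) (edge e) := by
  obtain ⟨e, he⟩ := e
  obtain rfl : d.edge = e := h
  exact Or.inl (.dart_edge d)

theorem exists_dart (e : G.edgeSet) : ∃ d : G.Dart, d.edge = e := by
  obtain ⟨⟨a, b⟩, h⟩ := e
  exact ⟨⟨(a, b), h⟩, rfl⟩

def IsEdge (x : Node G) : Prop := ∃ e, x = edge e

def IsVert (x : Node G) : Prop := ∃ v, x = vert v

/-- The vertices that span a node. -/
def foot : Node G → Sym2 V
  | vert v => s(v, v)
  | dart d => d.edge
  | edge e => e

theorem exists_foot (x : Node G) : (∃ v, x = vert v) ∨ ∃ a b, a ≠ b ∧ x.foot = s(a, b) := by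
  cases x with
  | vert v => exact Or.inl ⟨v, rfl⟩
  | dart d => exact Or.inr ⟨d.fst, d.snd, d.adj.ne, rfl⟩
  | edge e =>
    obtain ⟨d, hd⟩ := exists_dart e
    exact Or.inr ⟨d.fst, d.snd, d.adj.ne, hd.symm⟩

/-- A walk in a graph along edges whose nodes avoid `S`. -/
theorem reach_of_adj {S : List (Node G)} {d : G.Dart} (h : ∀ x : Node G, (∀ v ∈ x.foot, v ∈ d.edge) → x ∉ S) :
    Reach (graph G) {x | x ∈ S} (vert d.fst) (vert d.snd) := by
  have h1 : vert d.fst ∉ S := h _ (by simp [foot, SimpleGraph.Dart.edge, Sym2.mem_iff])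
  have h2 : dart d ∉ S := h _ (by simp [foot])
  have h3 : edge ⟨d.edge, d.edge_mem⟩ ∉ S := h _ (by simp [foot])
  have h4 : dart d.symm ∉ S := h _ (by simp [foot])
  have h5 : vert d.snd ∉ S := h _ (by simp [foot, SimpleGraph.Dart.edge, Sym2.mem_iff])
  exact (Reach.of_adj (adj_vert d).symm h1 h2).trans <| (Reach.of_adj (adj_edge d rfl) h2 h3).trans <|
    (Reach.of_adj (adj_edge d.symm (by simp)).symm h3 h4).trans (Reach.of_adj (adj_vert d.symm) h4 h5)

theorem reach_of_connected (hG : KConnected G 3) {S : List (Node G)} {U : Set V} (hU : U.encard < 3)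
    (hS : ∀ x ∈ S, ∃ v ∈ x.foot, v ∈ U) {u w : V} (hu : u ∉ U) (hw : w ∉ U) :
    Reach (graph G) {x | x ∈ S} (vert u) (vert w) := by
  obtain ⟨p⟩ := (hG U (by exact_mod_cast hU)).preconnected ⟨u, hu⟩ ⟨w, hw⟩
  have : ∀ a b : (Uᶜ : Set V), (G.induce Uᶜ).Walk a b →
      Reach (graph G) {x | x ∈ S} (vert a.1) (vert b.1) := by
    intro a b p
    induction p with
    | @nil a =>
      refine .refl fun h => ?_
      obtain ⟨v, hv, hvU⟩ := hS _ h
      simp only [foot, Sym2.mem_iff, or_self] at hv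
      exact a.2 (hv ▸ hvU)
    | @cons a b c h p ih =>
      refine Reach.trans (reach_of_adj (d := ⟨(a.1, b.1), h⟩) fun x hx hxS => ?_) ih
      obtain ⟨v, hv, hvU⟩ := hS x hxS
      have := hx v hv
      rw [SimpleGraph.Dart.edge, Sym2.mem_iff] at this
      rcases this with rfl | rfl
      exacts [a.2 hvU, b.2 hvU]
  exact this _ _ p

theorem reach_of_foot_ne (hG : KConnected G 3) {S : List (Node G)} (hS : S.length ≤ 2) {u w : V}
    (hu : vert u ∉ S) (hw : vert w ∉ S) (huw : ∀ x ∈ S, x.foot ≠ s(u, w)) :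
    Reach (graph G) {x | x ∈ S} (vert u) (vert w) := by
  have h : ∀ x : Node G, ∃ v, x ∈ S → v ∈ x.foot ∧ v ≠ u ∧ v ≠ w := by
    intro x
    by_cases hx : x ∈ S
    · rcases exists_foot x with ⟨v, rfl⟩ | ⟨a, b, hab, hf⟩
      · exact ⟨v, fun _ => ⟨by simp [foot], fun h => hu (h ▸ hx), fun h => hw (h ▸ hx)⟩⟩
      · have := huw x hx
        rw [hf, Ne, Sym2.eq_iff] at this
        rw [hf]
        by_cases ha : a ≠ u ∧ a ≠ w
        · exact ⟨a, fun _ => ⟨by simp, ha⟩⟩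
        · refine ⟨b, fun _ => ⟨by simp, ?_⟩⟩
          grind
    · exact ⟨u, fun h => (hx h).elim⟩
  choose g hg using h
  refine reach_of_connected hG (U := {v | v ∈ S.map g}) ?_ (fun x hx => ⟨g x, (hg x hx).1, ?_⟩) ?_ ?_
  · classical
    have : {v | v ∈ S.map g} = ((S.map g).toFinset : Set V) := by ext; simp
    rw [this, Set.encard_coe_eq_coe_finsetCard]
    have := (S.map g).toFinset_card_le
    rw [List.length_map] at this
    exact_mod_cast (this.trans hS).trans_lt (by norm_num)
  · exact List.mem_map_of_mem hx
  · intro h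
    obtain ⟨x, hx, hxu⟩ := List.mem_map.1 h
    exact (hg x hx).2.1 hxu
  · intro h
    obtain ⟨x, hx, hxu⟩ := List.mem_map.1 h
    exact (hg x hx).2.2 hxu

theorem exists_of_length_le_two {α : Type*} {S : List α} (hS : S.length ≤ 2) {s : α} (hs : s ∈ S) :
    ∃ t, ∀ x ∈ S, x = s ∨ x = t := by
  rcases S with _ | ⟨a, _ | ⟨b, _ | ⟨c, S⟩⟩⟩
  · exact ⟨s, by simp⟩
  · exact ⟨s, by simp_all⟩
  · rcases List.mem_cons.1 hs with rfl | h
    · exact ⟨b, by simp⟩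
    · exact ⟨a, by simp_all⟩
  · simp at hS

theorem reach_of_vert (hreg : ∀ v : V, (G.neighborSet v).encard = 3) (hG : KConnected G 3)
    {S : List (Node G)} (hS : S.length ≤ 2) {u w : V} (hu : vert u ∉ S) (hw : vert w ∉ S) :
    Reach (graph G) {x | x ∈ S} (vert u) (vert w) := by
  by_cases h : ∀ x ∈ S, x.foot ≠ s(u, w)
  · exact reach_of_foot_ne hG hS hu hw h
  push Not at h
  obtain ⟨s, hs, hf⟩ := h
  obtain ⟨t, ht⟩ := exists_of_length_le_two hS hs
  obtain ⟨f, hf'⟩ : ∃ f, ∀ z, z ≠ u → z ≠ w → z ≠ f →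
      t.foot ≠ s(z, z) ∧ t.foot ≠ s(u, z) ∧ t.foot ≠ s(z, w) := by
    generalize t.foot = e
    induction e with | _ a b
    by_cases ha : a = u ∨ a = w
    · exact ⟨b, by simp only [ne_eq, Sym2.eq_iff]; grind⟩
    · exact ⟨a, by simp only [ne_eq, Sym2.eq_iff]; grind⟩
  obtain ⟨z, hzu, hzw, hzf⟩ : ∃ z, z ≠ u ∧ z ≠ w ∧ z ≠ f := by
    obtain ⟨a, b, c, hab, hac, hbc, hn⟩ := Set.encard_eq_three.1 (hreg u)
    have hne : ∀ x ∈ G.neighborSet u, x ≠ u := fun x hx h => G.loopless.irrefl u (h ▸ hx)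
    rw [hn] at hne
    have ha := hne a (by simp)
    have hb := hne b (by simp)
    have hc := hne c (by simp)
    by_contra! h
    have h1 := or_iff_not_imp_left.2 (h a ha)
    have h2 := or_iff_not_imp_left.2 (h b hb)
    have h3 := or_iff_not_imp_left.2 (h c hc)
    clear * - hab hac hbc h1 h2 h3
    grind
  obtain ⟨h1, h2, h3⟩ := hf' z hzu hzw hzf
  have hz : vert z ∉ S := by
    intro h
    rcases ht _ h with rfl | rfl
    · rw [foot, Sym2.eq_iff] at hf
      grind
    · exact h1 rfl
  refine (reach_of_foot_ne hG hS hu hz fun x hx => ?_).trans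
    (reach_of_foot_ne hG hS hz hw fun x hx => ?_) <;> rcases ht x hx with rfl | rfl
  · rw [hf, Ne, Sym2.eq_iff]
    grind
  · exact h2
  · rw [hf, Ne, Sym2.eq_iff]
    grind
  · exact h3

theorem exists_reach_vert {S : List (Node G)} (hS : S.length ≤ 2) {x : Node G} (hx : x ∉ S) :
    (∃ u, vert u ∉ S ∧ Reach (graph G) {x | x ∈ S} x (vert u)) ∨
      ∃ e ∈ G.edgeSet, (∀ v ∈ x.foot, v ∈ e) ∧ (∀ s ∈ S, ∀ v ∈ s.foot, v ∈ e) ∧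
        ∃ s ∈ S, ∃ t ∈ S, s ≠ t := by
  have trap : ∀ s ∈ S, ∀ t ∈ S, s ≠ t → ∀ e ∈ G.edgeSet, (∀ v ∈ x.foot, v ∈ e) →
      (∀ v ∈ s.foot, v ∈ e) → (∀ v ∈ t.foot, v ∈ e) → 
      ∃ e ∈ G.edgeSet, (∀ v ∈ x.foot, v ∈ e) ∧ (∀ s ∈ S, ∀ v ∈ s.foot, v ∈ e) ∧
        ∃ s ∈ S, ∃ t ∈ S, s ≠ t := by
    intro s hs t ht hst e he hxe hse hte
    obtain ⟨t', ht'⟩ := exists_of_length_le_two hS hs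
    refine ⟨e, he, hxe, fun s' hs' => ?_, s, hs, t, ht, hst⟩
    rcases ht' t ht with rfl | rfl
    · exact (hst rfl).elim
    · rcases ht' s' hs' with rfl | rfl
      exacts [hse, hte]
  have hfst : ∀ d : G.Dart, ∀ v ∈ (vert d.fst : Node G).foot, v ∈ d.edge := by
    simp [foot, SimpleGraph.Dart.edge, Sym2.mem_iff]
  have way : ∀ (e : G.edgeSet), edge e ∉ S → ∀ d : G.Dart, d.edge = e →
      (∃ u, vert u ∉ S ∧ Reach (graph G) {x | x ∈ S} (edge e) (vert u)) ∨
        (vert d.fst ∈ S ∨ dart d ∈ S) := by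
    intro e he d hd
    by_cases h1 : dart d ∈ S
    · exact Or.inr (Or.inr h1)
    · by_cases h2 : vert d.fst ∈ S
      · exact Or.inr (Or.inl h2)
      · exact Or.inl ⟨_, h2, (Reach.of_adj (adj_edge d hd).symm he h1).trans
          (Reach.of_adj (adj_vert d) h1 h2)⟩
  have hdarts : ∀ d : G.Dart, d ≠ d.symm := fun d h => d.adj.ne (congrArg (fun d => d.fst) h)
  cases x with
  | vert u => exact Or.inl ⟨u, hx, .refl hx⟩
  | dart d =>
    by_cases h1 : vert d.fst ∈ S
    · by_cases he : edge ⟨d.edge, d.edge_mem⟩ ∈ S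
      · exact Or.inr (trap _ h1 _ he (by simp) d.edge d.edge_mem (fun _ h => h) (hfst d) (fun _ h => h))
      · rcases way _ he d.symm (by simp) with ⟨u, hu, hr⟩ | h | h
        · exact Or.inl ⟨u, hu, (Reach.of_adj (adj_edge d rfl) hx he).trans hr⟩
        · refine Or.inr (trap _ h1 _ h (by simp) d.edge d.edge_mem (fun _ h => h)
            (hfst d) ?_)
          simpa using hfst d.symm
        · refine Or.inr (trap _ h1 _ h (by simp) d.edge d.edge_mem (fun _ h => h) (hfst d) ?_)
          simp [foot]
    · exact Or.inl ⟨_, h1, Reach.of_adj (adj_vert d) hx h1⟩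
  | edge e =>
    obtain ⟨d, hd⟩ := exists_dart e
    have hd' : d.symm.edge = e := by simpa using hd
    have hd2 := hfst d.symm
    rw [hd'] at hd2
    have hd1 := hfst d
    rw [hd] at hd1
    have h1 : ∀ v ∈ (dart d : Node G).foot, v ∈ (e : Sym2 V) := by simp [foot, hd]
    have h2 : ∀ v ∈ (dart d.symm : Node G).foot, v ∈ (e : Sym2 V) := by simp [foot, hd]
    rcases way e hx d hd with h | h | h
    · exact Or.inl h
    all_goals
      rcases way e hx d.symm hd' with h' | h' | h'
      · exact Or.inl h'
      all_goals
        refine Or.inr (trap _ h _ h' ?_ e e.2 (fun _ h => h) (by assumption) (by assumption))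
        simp [hdarts d]

theorem eq_of_foot_subset {s t : Node G} (hst : s ≠ t) {e e' : Sym2 V}
    (hs : ∀ v ∈ s.foot, v ∈ e ∧ v ∈ e') (ht : ∀ v ∈ t.foot, v ∈ e ∧ v ∈ e') : e = e' := by
  have h : ∃ a b, a ≠ b ∧ (a ∈ e ∧ a ∈ e') ∧ b ∈ e ∧ b ∈ e' := by
    rcases exists_foot s with ⟨v, rfl⟩ | ⟨a, b, hab, hf⟩
    · rcases exists_foot t with ⟨w, rfl⟩ | ⟨a, b, hab, hf⟩
      · exact ⟨v, w, by simpa using hst, hs v (by simp [foot]), ht w (by simp [foot])⟩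
      · rw [hf] at ht
        exact ⟨a, b, hab, ht a (by simp), ht b (by simp)⟩
    · rw [hf] at hs
      exact ⟨a, b, hab, hs a (by simp), hs b (by simp)⟩
  obtain ⟨a, b, hab, ha, hb⟩ := h
  rw [(Sym2.mem_and_mem_iff hab).1 ⟨ha.1, hb.1⟩, (Sym2.mem_and_mem_iff hab).1 ⟨ha.2, hb.2⟩]

theorem length_le_of_subset {α : Type*} {l l' : List α} (hl : l.Nodup) (h : ∀ x ∈ l, x ∈ l') :
    l.length ≤ l'.length :=
  (List.subperm_of_subset hl h).length_le

theorem length_le_five {e : Sym2 V} (he : e ∈ G.edgeSet) {l : List (Node G)} (hl : l.Nodup)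
    (h : ∀ x ∈ l, ∀ v ∈ x.foot, v ∈ e) : l.length ≤ 5 := by
  obtain ⟨d, hd⟩ := exists_dart ⟨e, he⟩
  obtain rfl : d.edge = e := hd
  refine length_le_of_subset (l' := [vert d.fst, dart d, edge ⟨d.edge, he⟩, dart d.symm, vert d.snd])
    hl fun x hx => ?_
  have := h x hx
  cases x with
  | vert v =>
    have := this v (by simp [foot])
    rw [SimpleGraph.Dart.edge, Sym2.mem_iff] at this
    rcases this with rfl | rfl <;> simp
  | dart d' =>
    have : d'.edge = d.edge := ((Sym2.mem_and_mem_iff d'.adj.ne).1 ⟨this d'.fst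
      (by simp [foot, SimpleGraph.Dart.edge]), this d'.snd (by simp [foot, SimpleGraph.Dart.edge])⟩).symm
    rcases SimpleGraph.dart_edge_eq_iff d' d |>.1 this with rfl | rfl <;> simp
  | edge e' =>
    obtain ⟨d', hd'⟩ := exists_dart e'
    have : d'.edge = d.edge := ((Sym2.mem_and_mem_iff d'.adj.ne).1 ⟨this d'.fst
      (by simp [foot, SimpleGraph.Dart.edge, ← hd']), this d'.snd
      (by simp [foot, SimpleGraph.Dart.edge, ← hd'])⟩).symm
    have : e' = ⟨d.edge, he⟩ := Subtype.ext (hd'.symm.trans this)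
    simp [this]

theorem exists_reach_vert_of_length {S A : List (Node G)} (hS : S.length ≤ 2) (hA : A.Nodup)
    (hA6 : 6 ≤ A.length) :
    ∃ a ∈ A, ∃ u, vert u ∉ S ∧ Reach (graph G) {x | x ∈ S} a (vert u) := by
  by_contra! hcon
  have h : ∀ a ∈ A, a ∉ S → _ := fun a ha haS =>
    (exists_reach_vert hS haS).resolve_left fun ⟨u, hu, hr⟩ => hcon a ha u hu hr
  obtain ⟨a, ha, haS⟩ : ∃ a ∈ A, a ∉ S := by
    by_contra! h
    have := length_le_of_subset hA h
    omega
  obtain ⟨e, he, -, hSe, s, hs, t, ht, hst⟩ := h a ha haS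
  refine absurd (length_le_five he hA fun x hx => ?_) (by omega)
  by_cases hxS : x ∈ S
  · exact hSe x hxS
  · obtain ⟨e', -, hxe, hSe', -⟩ := h x hx hxS
    obtain rfl := eq_of_foot_subset hst (fun v hv => ⟨hSe s hs v hv, hSe' s hs v hv⟩)
      (fun v hv => ⟨hSe t ht v hv, hSe' t ht v hv⟩)
    exact hxe

theorem net (hreg : ∀ v : V, (G.neighborSet v).encard = 3) (hG : KConnected G 3)
    (hcut : ¬ ∃ F : Set (Sym2 V), F ⊆ G.edgeSet ∧ F.encard = 6 ∧
        ∃ f : Fin 4 → (G.deleteEdges F).ConnectedComponent, Function.Injective f) :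
    Net (graph G) IsEdge IsVert where
  not_br := by rintro _ ⟨e, rfl⟩ ⟨v, h⟩; simp at h
  main_adj := by
    rintro x y (⟨e, rfl⟩ | ⟨v, rfl⟩) (⟨e', rfl⟩ | ⟨v', rfl⟩) (h | h) <;> cases h
  deg_le_three x l hl h := by
    cases x with
    | vert v =>
      obtain ⟨a, b, c, -, -, -, hn⟩ := Set.encard_eq_three.1 (hreg v)
      have hmem : ∀ z, G.Adj v z ↔ z = a ∨ z = b ∨ z = c := fun z => by
        rw [← SimpleGraph.mem_neighborSet, hn]; simp
      refine length_le_of_subset (l' := [dart ⟨(v, a), (hmem a).2 (by simp)⟩,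
        dart ⟨(v, b), (hmem b).2 (by simp)⟩, dart ⟨(v, c), (hmem c).2 (by simp)⟩]) hl fun y hy => ?_
      obtain ⟨⟨⟨v', w⟩, hd⟩, rfl, rfl⟩ := vert_adj (h y hy)
      rcases (hmem w).1 hd with rfl | rfl | rfl <;> simp
    | dart d =>
      refine (length_le_of_subset (l' := [vert d.fst, edge ⟨d.edge, d.edge_mem⟩]) hl
        fun y hy => ?_).trans (by simp)
      simpa using dart_adj (h y hy)
    | edge e =>
      obtain ⟨d, hd⟩ := exists_dart e
      refine (length_le_of_subset (l' := [dart d, dart d.symm]) hl fun y hy => ?_).trans (by simp)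
      obtain ⟨d', hd', rfl⟩ := edge_adj (h y hy)
      rcases SimpleGraph.dart_edge_eq_iff d' d |>.1 (hd'.trans hd.symm) with rfl | rfl <;> simp
  deg_le_two x l hx hl h := by
    cases x with
    | vert v => exact (hx ⟨v, rfl⟩).elim
    | dart d =>
      refine length_le_of_subset (l' := [vert d.fst, edge ⟨d.edge, d.edge_mem⟩]) hl fun y hy => ?_
      simpa using dart_adj (h y hy)
    | edge e =>
      obtain ⟨d, hd⟩ := exists_dart e
      refine length_le_of_subset (l' := [dart d, dart d.symm]) hl fun y hy => ?_
      obtain ⟨d', hd', rfl⟩ := edge_adj (h y hy)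
      rcases SimpleGraph.dart_edge_eq_iff d' d |>.1 (hd'.trans hd.symm) with rfl | rfl <;> simp
  exists_adj := by
    rintro _ ⟨e, rfl⟩
    obtain ⟨d, hd⟩ := exists_dart e
    refine ⟨dart d, dart d.symm, fun h => d.adj.ne ?_, (adj_edge d hd).symm,
      (adj_edge d.symm (by simpa using hd)).symm⟩
    exact congrArg (fun d : G.Dart => d.fst) (by simpa using h)
  conn_one S hS x y hx hy := by
    have key : ∀ z, z ∉ S → ∃ u, vert u ∉ S ∧ Reach (graph G) {x | x ∈ S} z (vert u) := by
      intro z hz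
      rcases exists_reach_vert (hS.trans one_le_two) hz with h | ⟨-, -, -, -, s, hs, t, ht, hst⟩
      · exact h
      · refine (hst ?_).elim
        rcases S with _ | ⟨a, _ | ⟨b, S⟩⟩ <;> simp_all
    obtain ⟨u, hu, hxu⟩ := key x hx
    obtain ⟨w, hw, hyw⟩ := key y hy
    exact hxu.trans ((reach_of_vert hreg hG (hS.trans one_le_two) hu hw).trans hyw.symm)
  conn_two S hS A B hA hB hA6 hB6 := by
    obtain ⟨a, ha, u, hu, hau⟩ := exists_reach_vert_of_length hS hA hA6
    obtain ⟨b, hb, w, hw, hbw⟩ := exists_reach_vert_of_length hS hB hB6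
    exact ⟨a, ha, b, hb, hau.trans ((reach_of_vert hreg hG hS hu hw).trans hbw.symm)⟩
  four M N hM hN hM6 hN4 hMe hNv := by
    classical
    by_contra! hcon
    refine hcut ⟨{e | ∃ h : e ∈ G.edgeSet, edge ⟨e, h⟩ ∈ M}, fun e he => he.1, ?_, ?_⟩
    · have : {e | ∃ h : e ∈ G.edgeSet, edge ⟨e, h⟩ ∈ M} = ((M.map foot).toFinset : Set (Sym2 V)) := by
        ext e
        simp only [Set.mem_ofPred_eq, List.coe_toFinset, List.mem_map]
        constructor
        · rintro ⟨h, h'⟩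
          exact ⟨_, h', rfl⟩
        · rintro ⟨x, hx, rfl⟩
          obtain ⟨e, rfl⟩ := hMe x hx
          exact ⟨e.2, hx⟩
      rw [this, Set.encard_coe_eq_coe_finsetCard, List.toFinset_card_of_nodup, List.length_map, hM6]
      · rfl
      · refine hM.map_on fun x hx y hy hxy => ?_
        obtain ⟨e, rfl⟩ := hMe x hx
        obtain ⟨e', rfl⟩ := hMe y hy
        exact congrArg edge (Subtype.ext hxy)
    · have hv : ∀ i : Fin 4, ∃ v, N[i.1] = vert v := fun i => hNv _ (List.getElem_mem _)
      choose g hg using hv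
      refine ⟨fun i => SimpleGraph.connectedComponentMk _ (g i), fun i j hij => ?_⟩
      by_contra hne
      obtain ⟨p⟩ := SimpleGraph.ConnectedComponent.exact hij
      refine hcon _ (List.getElem_mem (by omega)) _ (List.getElem_mem (by omega)) (fun h => hne ?_)
        (?_ : Reach (graph G) {z | z ∈ M} N[i.1] N[j.1])
      · exact Fin.ext ((hN.getElem_inj_iff).1 h)
      · rw [hg i, hg j]
        have hvM : ∀ v, vert v ∉ M := fun v h => by
          obtain ⟨e, he⟩ := hMe _ h
          simp at he
        have hdM : ∀ d, dart d ∉ M := fun v h => by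
          obtain ⟨e, he⟩ := hMe _ h
          simp at he
        have : ∀ a b (p : (G.deleteEdges {e | ∃ h : e ∈ G.edgeSet, edge ⟨e, h⟩ ∈ M}).Walk a b),
            Reach (graph G) {z | z ∈ M} (vert a) (vert b) := by
          intro a b p
          induction p with
          | nil => exact .refl (hvM _)
          | @cons a b c h p ih =>
            rw [SimpleGraph.deleteEdges_adj] at h
            refine Reach.trans ?_ ih
            refine reach_of_adj (d := ⟨(a, b), h.1⟩) fun x hx hxM => ?_
            obtain ⟨e, rfl⟩ := hMe x hxM
            refine h.2 ?_
            obtain ⟨d, hd⟩ := exists_dart e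
            have : s(a, b) = e := by
              rw [← hd]
              exact (Sym2.mem_and_mem_iff d.adj.ne).1 ⟨hx d.fst (by simp [foot, SimpleGraph.Dart.edge, ← hd]),
                hx d.snd (by simp [foot, SimpleGraph.Dart.edge, ← hd])⟩
            rw [this]
            exact ⟨e.2, hxM⟩
        exact this _ _ p

end Node

end Skeleton

namespace Skeleton

theorem exists_chain_insert {W : Type*} {I : SimpleGraph W} {l : List W} (hl : l.Nodup)
    (hc : l.IsChain I.Adj) {x y z : W} (hx : x ∈ l) (hxy : I.Adj x y)
    (hz : ∀ w, I.Adj x w → w = y ∨ w = z) :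
    ∃ l' : List W, l'.Nodup ∧ l'.IsChain I.Adj ∧ y ∈ l' ∧ ∀ w ∈ l, w ∈ l' := by
  by_cases hy : y ∈ l
  · exact ⟨l, hl, hc, hy, fun _ h => h⟩
  obtain ⟨s, t, rfl⟩ := List.append_of_mem hx
  rcases List.eq_nil_or_concat s with rfl | ⟨s, a, rfl⟩
  · refine ⟨y :: x :: t, ?_, ?_, by simp, ?_⟩
    · exact List.nodup_cons.2 ⟨hy, hl⟩
    · exact List.isChain_cons_cons.2 ⟨hxy.symm, hc⟩
    · exact fun w hw => List.mem_cons_of_mem _ hw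
  rcases t with _ | ⟨b, t⟩
  · refine ⟨(s.concat a ++ [x]) ++ [y], ?_, ?_, by simp, ?_⟩
    · exact List.nodup_append'.2 ⟨hl, by simp, by simpa using hy⟩
    · have := (List.isChain_split (c := x) (l₂ := [y])).2 ⟨hc, by simpa using hxy⟩
      simpa using this
    · exact fun w hw => List.mem_append_left _ hw
  · exfalso
    have h1 : I.Adj x b := by
      have := (List.isChain_split.1 hc).2
      exact (List.isChain_cons_cons.1 this).1
    have h2 : I.Adj a x := by
      have := (List.isChain_split.1 hc).1
      rw [List.concat_eq_append, List.append_assoc, List.singleton_append] at this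
      simpa using ((List.isChain_split (l₁ := s) (l₂ := [x])).1 this).2
    have hb : b = z := (hz b h1).resolve_left fun h => hy (by simp [h])
    have ha : a = z := (hz a h2.symm).resolve_left fun h => hy (by simp [h])
    exact (List.nodup_append'.1 hl).2.2 (by simp [ha] : z ∈ s.concat a) (by simp [hb])

namespace Node

variable {V : Type*} {G : SimpleGraph V}

theorem exists_chain_insert_vert {l : List (Node G)} (hl : l.Nodup) (hc : l.IsChain (graph G).Adj)
    {d : G.Dart} (hd : edge ⟨d.edge, d.edge_mem⟩ ∈ l) :
    ∃ l' : List (Node G), l'.Nodup ∧ l'.IsChain (graph G).Adj ∧ vert d.fst ∈ l' ∧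
      ∀ w ∈ l, w ∈ l' := by
  obtain ⟨l₁, h1, hc1, hd1, hl1⟩ := exists_chain_insert (y := dart d) (z := dart d.symm) hl hc hd
    (adj_edge d rfl).symm fun w hw => by
      obtain ⟨d', hd', rfl⟩ := edge_adj hw
      rcases (SimpleGraph.dart_edge_eq_iff d' d).1 hd' with rfl | rfl <;> simp
  obtain ⟨l₂, h2, hc2, hd2, hl2⟩ := exists_chain_insert (y := vert d.fst) h1 hc1 hd1
    (adj_vert d) fun w hw => dart_adj hw
  exact ⟨l₂, h2, hc2, hd2, fun w hw => hl2 w (hl1 w hw)⟩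

theorem exists_chain_insert_ends (E : List G.edgeSet) {l : List (Node G)} (hl : l.Nodup)
    (hc : l.IsChain (graph G).Adj) (hE : ∀ e ∈ E, edge e ∈ l) :
    ∃ l' : List (Node G), l'.Nodup ∧ l'.IsChain (graph G).Adj ∧ (∀ w ∈ l, w ∈ l') ∧
      ∀ e ∈ E, ∀ v ∈ (e : Sym2 V), vert v ∈ l' := by
  induction E generalizing l with
  | nil => exact ⟨l, hl, hc, by simp, by simp⟩
  | cons e E ih =>
    obtain ⟨d, hd⟩ := exists_dart e
    obtain rfl : (⟨d.edge, d.edge_mem⟩ : G.edgeSet) = e := Subtype.ext hd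
    obtain ⟨l₀, h0, hc0, hl0, hE0⟩ := ih hl hc fun e' he' => hE e' (by simp [he'])
    have hd0 := hl0 _ (hE _ List.mem_cons_self)
    obtain ⟨l₁, h1, hc1, hv1, hl1⟩ := exists_chain_insert_vert h0 hc0 hd0
    obtain ⟨l₂, h2, hc2, hv2, hl2⟩ := exists_chain_insert_vert (d := d.symm) h1 hc1
      (by simpa using hl1 _ hd0)
    refine ⟨l₂, h2, hc2, fun w hw => hl2 w (hl1 w (hl0 w hw)), List.forall_mem_cons.2 ⟨?_, ?_⟩⟩
    · intro v hv
      simp only [SimpleGraph.Dart.edge, Sym2.mem_iff] at hv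
      rcases hv with rfl | rfl
      exacts [hl2 _ hv1, hv2]
    · exact fun e he v hv => hl2 _ (hl1 _ (hE0 e he v hv))

/-- At most six edges lie on a common path. -/
theorem exists_chain_of_edges (hg : ∀ k, 2 ≤ k → k ≤ 6 → Good (graph G) IsEdge IsVert (start k))
    {E : List G.edgeSet} (hE : E.Nodup) (hlen : E.length ≤ 6) :
    ∃ l : List (Node G), l.Nodup ∧ l.IsChain (graph G).Adj ∧ (∀ e ∈ E, edge e ∈ l) ∧
      ∀ e ∈ E, ∀ v ∈ (e : Sym2 V), vert v ∈ l := by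
  obtain ⟨l, hl, hc, hm⟩ := exists_chain_of_marks hg (M := E.map edge)
    (hE.map fun _ _ h => by simpa using h)
    (List.forall_mem_map.2 fun e _ => ⟨e, rfl⟩) (by simpa using hlen)
  have hm' : ∀ e ∈ E, edge e ∈ l := fun e he => hm _ (List.mem_map_of_mem he)
  obtain ⟨l', hl', hc', hll', hv⟩ := exists_chain_insert_ends E hl hc hm'
  exact ⟨l', hl', hc', fun e he => hll' _ (hm' e he), hv⟩

end Node
end Skeleton

namespace Skeleton

theorem injective_path_trans {X : Type*} [TopologicalSpace X] {a b c : X} {γ : Path a b}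
    {γ' : Path b c} (h : Function.Injective γ) (h' : Function.Injective γ')
    (hd : ∀ p ∈ Set.range γ, p ∈ Set.range γ' → p = b) : Function.Injective (γ.trans γ') := by
  have key : ∀ s t : unitInterval, (s : ℝ) ≤ 1 / 2 → ¬ (t : ℝ) ≤ 1 / 2 →
      γ.trans γ' s ≠ γ.trans γ' t := by
    intro s t hs ht hst
    rw [Path.trans_apply, Path.trans_apply, dif_pos hs, dif_neg ht] at hst
    have h2 := hd _ ⟨_, rfl⟩ ⟨_, hst.symm⟩
    have := congrArg Subtype.val (h' ((hst.symm.trans h2).trans γ'.source.symm))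
    simp only [Set.Icc.coe_zero] at this
    exact ht (by linarith)
  intro s t hst
  by_cases hs : (s : ℝ) ≤ 1 / 2 <;> by_cases ht : (t : ℝ) ≤ 1 / 2
  · rw [Path.trans_apply, Path.trans_apply, dif_pos hs, dif_pos ht] at hst
    have := congrArg Subtype.val (h hst)
    simp only at this
    exact Subtype.ext (by linarith)
  · exact (key s t hs ht hst).elim
  · exact (key t s ht hs hst.symm).elim
  · rw [Path.trans_apply, Path.trans_apply, dif_neg hs, dif_neg ht] at hst
    have := congrArg Subtype.val (h' hst)
    simp only at this
    exact Subtype.ext (by linarith)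

theorem infix_cons_cons {N : Type*} {x y u w : N} {l : List N} :
    [u, w] <:+: x :: y :: l ↔ u = x ∧ w = y ∨ [u, w] <:+: y :: l := by
  rw [List.infix_cons_iff]
  simp [List.cons_prefix_cons]

/-- Arcs between consecutive nodes of a path fit together to a single arc. -/
theorem exists_path_of_chain {X N : Type*} [TopologicalSpace X] {R : N → N → Prop} {pos : N → X}
    {A : N → N → Set X}
    (hA : ∀ x y, R x y → ∃ γ : Path (pos x) (pos y), Function.Injective γ ∧ Set.range γ = A x y)
    (hd : ∀ x y u w, R x y → R u w → s(x, y) ≠ s(u, w) → ∀ p ∈ A x y, p ∈ A u w →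
      ∃ n, (n = x ∨ n = y) ∧ (n = u ∨ n = w) ∧ p = pos n)
    {x y : N} {l : List N} (hl : (x :: y :: l).Nodup) (hc : (x :: y :: l).IsChain R) :
    ∃ (b : X) (γ : Path (pos x) b), Function.Injective γ ∧
      ∀ p, p ∈ Set.range γ ↔ ∃ u w, [u, w] <:+: x :: y :: l ∧ p ∈ A u w := by
  induction l generalizing x y with
  | nil =>
    obtain ⟨γ, hγ, hr⟩ := hA x y (by simpa using hc)
    refine ⟨_, γ, hγ, fun p => ?_⟩
    rw [hr]
    constructor
    · exact fun hp => ⟨x, y, List.infix_rfl, hp⟩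
    · rintro ⟨u, w, huw, hp⟩
      rcases infix_cons_cons.1 huw with ⟨rfl, rfl⟩ | h
      · exact hp
      · exact absurd h.length_le (by simp)
  | cons z l ih =>
    obtain ⟨hxy, hc'⟩ := List.isChain_cons_cons.1 hc
    obtain ⟨hx, hl'⟩ := List.nodup_cons.1 hl
    obtain ⟨b, γ', hγ', hr'⟩ := ih hl' hc'
    obtain ⟨γ, hγ, hr⟩ := hA x y hxy
    refine ⟨b, γ.trans γ', injective_path_trans hγ hγ' fun p hp hp' => ?_, fun p => ?_⟩
    · obtain ⟨u, w, huw, hpA⟩ := (hr' p).1 hp'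
      have hu : u ∈ y :: z :: l := huw.subset (by simp)
      have hw : w ∈ y :: z :: l := huw.subset (by simp)
      have hxu : x ≠ u := fun h => hx (h ▸ hu)
      have hxw : x ≠ w := fun h => hx (h ▸ hw)
      have huwR : R u w := by simpa using hc'.infix huw
      obtain ⟨n, h1, h2, rfl⟩ := hd x y u w hxy huwR
        (fun h => by rcases Sym2.eq_iff.1 h with h | h; exacts [hxu h.1, hxw h.1]) p (hr ▸ hp) hpA
      rcases h1 with rfl | rfl
      · rcases h2 with rfl | rfl
        exacts [(hxu rfl).elim, (hxw rfl).elim]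
      · rfl
    · rw [Path.trans_range, Set.mem_union, hr, hr']
      simp only [infix_cons_cons (x := x)]
      constructor
      · rintro (h | ⟨u, w, h, hp⟩)
        exacts [⟨x, y, Or.inl ⟨rfl, rfl⟩, h⟩, ⟨u, w, Or.inr h, hp⟩]
      · rintro ⟨u, w, ⟨rfl, rfl⟩ | h, hp⟩
        exacts [Or.inl hp, Or.inr ⟨u, w, h, hp⟩]

theorem exists_infix_of_mem {N : Type*} {x : N} {l : List N} (hx : x ∈ l) (hl : 2 ≤ l.length) :
    ∃ y, [x, y] <:+: l ∨ [y, x] <:+: l := by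
  obtain ⟨s, t, rfl⟩ := List.append_of_mem hx
  rcases t with _ | ⟨y, t⟩
  · rcases List.eq_nil_or_concat s with rfl | ⟨s, y, rfl⟩
    · simp at hl
    · exact ⟨y, Or.inr ⟨s, [], by simp⟩⟩
  · exact ⟨y, Or.inl ⟨s, t, by simp⟩⟩

section edgePoint

variable {V : Type*}

theorem edgePoint_zero (v w : V) : edgePoint v w 0 = vertexPoint v := by
  funext u
  simp [edgePoint, vertexPoint]

theorem edgePoint_symm (v w : V) (t : ℝ) : edgePoint v w (1 - t) = edgePoint w v t := by
  funext u
  simp [edgePoint, add_comm]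

theorem edgePoint_inj {v w v' w' : V} (h : v ≠ w) (h' : v' ≠ w') {t t' : ℝ}
    (ht1 : t < 1) (ht1' : t' < 1) (he : edgePoint v w t = edgePoint v' w' t') :
    (t = 0 ∧ t' = 0 ∧ v = v') ∨ (v = v' ∧ w = w' ∧ t = t') ∨ (v = w' ∧ w = v' ∧ t + t' = 1) := by
  have h1 := congrFun he v
  have h2 := congrFun he w
  have h3 := congrFun he v'
  have h4 := congrFun he w'
  simp only [edgePoint, if_pos, if_neg h, if_neg h.symm, if_neg h', if_neg h'.symm] at h1 h2 h3 h4
  by_cases hvv : v = v'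
  · subst hvv
    by_cases hww : w = w'
    · subst hww
      refine Or.inr (Or.inl ⟨rfl, rfl, ?_⟩)
      simp [h.symm] at h2
      exact h2
    · refine Or.inl ⟨?_, ?_, rfl⟩
      · simp [h.symm, hww] at h2
        exact h2
      · simp [h'.symm, Ne.symm hww] at h4
        exact h4.symm
  · by_cases hvw : v = w'
    · subst hvw
      simp [hvv] at h1
      by_cases hwv : w = v'
      · exact Or.inr (Or.inr ⟨rfl, hwv, by linarith⟩)
      · simp [Ne.symm hvv, Ne.symm hwv] at h3
        linarith
    · simp [hvv, hvw] at h1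
      linarith

theorem continuous_edgePoint (v w : V) : Continuous (edgePoint v w) := by
  refine continuous_pi fun u => ?_
  unfold edgePoint
  split_ifs <;> fun_prop

theorem exists_path_edgePoint {v w : V} (h : v ≠ w) {p q : ℝ} (hpq : p < q) :
    ∃ γ : Path (edgePoint v w p) (edgePoint v w q), Function.Injective γ ∧
      Set.range γ = edgePoint v w '' Set.Icc p q := by
  refine ⟨⟨⟨fun t => edgePoint v w (p + (q - p) * t), ?_⟩, by simp, by simp⟩, fun s t hst => ?_, ?_⟩
  · exact (continuous_edgePoint v w).comp (by fun_prop)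
  · have h1 := congrFun hst w
    simp only [edgePoint, Path.coe_mk_mk, if_neg h.symm, if_true, zero_add] at h1
    have h2 : (q - p) * (s : ℝ) = (q - p) * t := by linarith
    exact Subtype.ext (mul_left_cancel₀ (by linarith) h2)
  · ext x
    constructor
    · rintro ⟨t, rfl⟩
      refine ⟨_, ⟨?_, ?_⟩, rfl⟩
      · nlinarith [t.2.1]
      · nlinarith [t.2.2]
    · rintro ⟨r, ⟨h1, h2⟩, rfl⟩
      have hqp : 0 < q - p := by linarith
      refine ⟨⟨(r - p) / (q - p), div_nonneg (by linarith) hqp.le, (div_le_one hqp).2 (by linarith)⟩, ?_⟩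
      simp only [Path.coe_mk_mk]
      congr 1
      field_simp
      ring

end edgePoint

end Skeleton

namespace Skeleton

namespace Node

variable {V : Type*} {G : SimpleGraph V}

/-- The position of a node in the realization, where the nodes of an edge sit at distance `ε` from
its ends and at distance `2 * ε` from the end selected by `o`. -/
noncomputable def pos (ε : ℝ) (o : G.edgeSet → G.Dart) : Node G → V → ℝ
  | vert v => vertexPoint v
  | dart d => edgePoint d.fst d.snd ε
  | edge e => edgePoint (o e).fst (o e).snd (2 * ε)

open Classical in
/-- The parameter along `d` of the position of the node of the edge of `d`. -/
noncomputable def param (ε : ℝ) (o : G.edgeSet → G.Dart) (d : G.Dart) : ℝ :=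
  if o ⟨d.edge, d.edge_mem⟩ = d then 2 * ε else 1 - 2 * ε

/-- The arc between the positions of two adjacent nodes. -/
noncomputable def track (ε : ℝ) (o : G.edgeSet → G.Dart) : Node G → Node G → Set (V → ℝ)
  | vert _, dart d => edgePoint d.fst d.snd '' Set.Icc 0 ε
  | dart d, vert _ => edgePoint d.fst d.snd '' Set.Icc 0 ε
  | dart d, edge _ => edgePoint d.fst d.snd '' Set.Icc ε (param ε o d)
  | edge _, dart d => edgePoint d.fst d.snd '' Set.Icc ε (param ε o d)
  | _, _ => ∅

variable {ε : ℝ} {o : G.edgeSet → G.Dart}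

theorem track_symm (x y : Node G) : track ε o x y = track ε o y x := by
  cases x <;> cases y <;> rfl

theorem eq_symm_of_ne (ho : ∀ e, (o e).edge = e) {d : G.Dart}
    (h : o ⟨d.edge, d.edge_mem⟩ ≠ d) : o ⟨d.edge, d.edge_mem⟩ = d.symm :=
  ((SimpleGraph.dart_edge_eq_iff _ _).1 (ho ⟨d.edge, d.edge_mem⟩)).resolve_left h

theorem pos_edge (ho : ∀ e, (o e).edge = e) (d : G.Dart) :
    pos ε o (edge ⟨d.edge, d.edge_mem⟩) = edgePoint d.fst d.snd (param ε o d) := by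
  by_cases h : o ⟨d.edge, d.edge_mem⟩ = d
  · rw [param, if_pos h, pos, h]
  · rw [param, if_neg h, pos, eq_symm_of_ne ho h, edgePoint_symm]
    rfl

theorem param_symm (ho : ∀ e, (o e).edge = e) (d : G.Dart) :
    param ε o d + param ε o d.symm = 1 := by
  have he : (⟨d.symm.edge, d.symm.edge_mem⟩ : G.edgeSet) = ⟨d.edge, d.edge_mem⟩ :=
    Subtype.ext (by simp)
  rw [param, param, he]
  by_cases h : o ⟨d.edge, d.edge_mem⟩ = d
  · rw [if_pos h, if_neg (by rw [h]; exact d.symm_ne.symm)]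
    ring
  · rw [if_neg h, if_pos (eq_symm_of_ne ho h)]
    ring

theorem lt_param (hε : 0 < ε) (hε' : ε ≤ 1 / 4) (d : G.Dart) : ε < param ε o d := by
  unfold param
  split_ifs <;> linarith

theorem param_le (hε' : ε ≤ 1 / 4) (d : G.Dart) : param ε o d ≤ 1 - 2 * ε := by
  unfold param
  split_ifs <;> linarith

theorem exists_path_track (hε : 0 < ε) (hε' : ε ≤ 1 / 4) (ho : ∀ e, (o e).edge = e) {x y : Node G}
    (h : (graph G).Adj x y) : ∃ γ : Path (pos ε o x) (pos ε o y), Function.Injective γ ∧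
      Set.range γ = track ε o x y := by
  have key : ∀ x y : Node G, Rel x y → ∃ γ : Path (pos ε o x) (pos ε o y),
      Function.Injective γ ∧ Set.range γ = track ε o x y := by
    rintro _ _ (d | d)
    · have := exists_path_edgePoint d.adj.ne hε
      rwa [edgePoint_zero] at this
    · rw [pos_edge ho]
      exact exists_path_edgePoint d.adj.ne (lt_param hε hε' d)
  rcases h with h | h
  · exact key x y h
  · obtain ⟨γ, h1, h2⟩ := key y x h
    refine ⟨γ.symm, h1.comp unitInterval.symm_bijective.injective, ?_⟩
    rw [Path.symm_range, h2, track_symm]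

theorem dart_ext {d d' : G.Dart} (h : d.fst = d'.fst) (h' : d.snd = d'.snd) : d = d' :=
  SimpleGraph.Dart.ext _ _ (Prod.ext h h')

theorem exists_node_of_mem_track (hε : 0 < ε) (hε' : ε ≤ 1 / 4) (ho : ∀ e, (o e).edge = e)
    {x y u w : Node G} (h : (graph G).Adj x y) (h' : (graph G).Adj u w) (hne : s(x, y) ≠ s(u, w))
    {p : V → ℝ} (hp : p ∈ track ε o x y) (hp' : p ∈ track ε o u w) :
    ∃ n, (n = x ∨ n = y) ∧ (n = u ∨ n = w) ∧ p = pos ε o n := by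
  have hvd : ∀ d d' : G.Dart, p ∈ edgePoint d.fst d.snd '' Set.Icc 0 ε →
      p ∈ edgePoint d'.fst d'.snd '' Set.Icc ε (param ε o d') → d = d' ∧ p = pos ε o (dart d) := by
    rintro d d' ⟨t, ht, rfl⟩ ⟨t', ht', he⟩
    have h1 := param_le (o := o) hε' d'
    rcases edgePoint_inj d'.adj.ne d.adj.ne (by linarith [ht'.2]) (by linarith [ht.2]) he with
      h | ⟨h, h', h''⟩ | h
    · linarith [ht'.1]
    · obtain rfl := dart_ext h h'
      refine ⟨rfl, ?_⟩
      rw [pos, le_antisymm ht.2 (h'' ▸ ht'.1)]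
    · linarith [ht'.2, ht.2]
  have key : ∀ x y u w : Node G, Rel x y → Rel u w → s(x, y) ≠ s(u, w) → p ∈ track ε o x y →
      p ∈ track ε o u w → ∃ n, (n = x ∨ n = y) ∧ (n = u ∨ n = w) ∧ p = pos ε o n := by
    rintro _ _ _ _ (d | d) (d' | d') hne hp hp'
    · obtain ⟨t, ht, rfl⟩ := hp
      obtain ⟨t', ht', he⟩ := hp'
      rcases edgePoint_inj d'.adj.ne d.adj.ne (by linarith [ht'.2]) (by linarith [ht.2]) he with
        h | ⟨h, h', -⟩ | h
      · refine ⟨vert d.fst, Or.inl rfl, Or.inl (by rw [h.2.2]), ?_⟩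
        rw [h.2.1, edgePoint_zero, pos]
      · obtain rfl := dart_ext h h'
        exact (hne rfl).elim
      · linarith [ht'.2, ht.2]
    · obtain ⟨rfl, h⟩ := hvd d d' hp hp'
      exact ⟨dart d, by simp, by simp, h⟩
    · obtain ⟨rfl, h⟩ := hvd d' d hp' hp
      exact ⟨dart d', by simp, by simp, h⟩
    · obtain ⟨t, ht, rfl⟩ := hp
      obtain ⟨t', ht', he⟩ := hp'
      have h1 := param_le (o := o) hε' d'
      have h2 := param_le (o := o) hε' d
      rcases edgePoint_inj d'.adj.ne d.adj.ne (by linarith [ht'.2]) (by linarith [ht.2]) he with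
        h | ⟨h, h', -⟩ | ⟨h, h', h''⟩
      · linarith [ht'.1]
      · obtain rfl := dart_ext h h'
        exact (hne rfl).elim
      · obtain rfl : d' = d.symm := dart_ext h h'
        refine ⟨edge ⟨d.edge, d.edge_mem⟩, Or.inr rfl, Or.inr (by simp), ?_⟩
        rw [pos_edge ho, show t = param ε o d by
          linarith [ht.2, ht'.2, param_symm (ε := ε) ho d]]
  rcases h with h | h <;> rcases h' with h' | h'
  · exact key _ _ _ _ h h' hne hp hp'
  · rw [track_symm] at hp'
    rw [Sym2.eq_swap (a := u)] at hne
    simpa only [or_comm] using key _ _ _ _ h h' hne hp hp'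
  · rw [track_symm] at hp
    rw [Sym2.eq_swap (a := x)] at hne
    simpa only [or_comm] using key _ _ _ _ h h' hne hp hp'
  · rw [track_symm] at hp hp'
    rw [Sym2.eq_swap (a := x), Sym2.eq_swap (a := u)] at hne
    simpa only [or_comm] using key _ _ _ _ h h' hne hp hp'

end Node

end Skeleton

namespace Skeleton

namespace Node

variable {V : Type*} {G : SimpleGraph V} {ε : ℝ} {o : G.edgeSet → G.Dart}

theorem edgePoint_mem (d : G.Dart) {t : ℝ} (h0 : 0 ≤ t) (h1 : t ≤ 1) :
    edgePoint d.fst d.snd t ∈ GraphRealization G :=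
  Or.inr ⟨_, _, t, d.adj, ⟨h0, h1⟩, rfl⟩

theorem track_subset (hε : 0 < ε) (hε' : ε ≤ 1 / 4) (x y : Node G) :
    track ε o x y ⊆ GraphRealization G := by
  rintro p hp
  have := fun d => param_le (ε := ε) (o := o) hε' d
  cases x <;> cases y <;> first | exact hp.elim | skip
  all_goals
    obtain ⟨t, ht, rfl⟩ := hp
    exact edgePoint_mem _ (by linarith [ht.1]) (by linarith [ht.2, this ‹_›])

/-- A path of nodes sweeps out an arc. -/
theorem exists_isArc_of_chain (hε : 0 < ε) (hε' : ε ≤ 1 / 4) (ho : ∀ e, (o e).edge = e)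
    {l : List (Node G)} (hl : l.Nodup) (hc : l.IsChain (graph G).Adj) (h2 : 2 ≤ l.length) :
    ∃ A : Set ↥(GraphRealization G), IsArc A ∧
      ∀ p, p ∈ A ↔ ∃ u w, [u, w] <:+: l ∧ (p : V → ℝ) ∈ track ε o u w := by
  obtain ⟨x, y, l, rfl⟩ : ∃ x y l', l = x :: y :: l' := by
    match l, h2 with
    | x :: y :: l', _ => exact ⟨x, y, l', rfl⟩
  obtain ⟨b, γ, hγ, hr⟩ := exists_path_of_chain (fun _ _ h => exists_path_track hε hε' ho h)
    (fun _ _ _ _ h h' hne _ => exists_node_of_mem_track hε hε' ho h h' hne) hl hc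
  have hmem : ∀ t, γ t ∈ GraphRealization G := fun t => by
    obtain ⟨u, w, -, h⟩ := (hr (γ t)).1 ⟨t, rfl⟩
    exact track_subset hε hε' u w h
  have hf : IsClosedEmbedding fun t => (⟨γ t, hmem t⟩ : ↥(GraphRealization G)) :=
    (γ.continuous.subtype_mk hmem).isClosedEmbedding fun s t h => hγ (congrArg Subtype.val h)
  refine ⟨_, ⟨hf.isEmbedding.toHomeomorph.symm⟩, fun p => ?_⟩
  rw [← hr]
  constructor
  · rintro ⟨t, rfl⟩
    exact ⟨t, rfl⟩
  · rintro ⟨t, ht⟩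
    exact ⟨t, Subtype.ext ht⟩

theorem mem_track_of_adj_vert (hε : 0 ≤ ε) {v : V} {y : Node G} (h : (graph G).Adj (vert v) y) :
    vertexPoint v ∈ track ε o (vert v) y := by
  obtain ⟨d, rfl, rfl⟩ := vert_adj h
  exact ⟨0, ⟨le_rfl, hε⟩, edgePoint_zero _ _⟩

theorem mem_track_of_edge (hε : 0 < ε) {d d' : G.Dart} (hd : d'.edge = d.edge)
    (h : o ⟨d'.edge, d'.edge_mem⟩ ≠ d') {t : ℝ} (h0 : 2 * ε ≤ t) (h1 : t ≤ 1 - 2 * ε)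
    (e : G.edgeSet) : edgePoint d.fst d.snd t ∈ track ε o (dart d') (edge e) := by
  rw [track, param, if_neg h]
  rcases (SimpleGraph.dart_edge_eq_iff _ _).1 hd with rfl | rfl
  · exact ⟨t, ⟨by linarith, h1⟩, rfl⟩
  · exact ⟨1 - t, ⟨by linarith, by linarith⟩, edgePoint_symm _ _ _⟩

theorem exists_orientation {l : List (Node G)} (hc : l.IsChain (graph G).Adj) (h2 : 2 ≤ l.length)
    (e : G.edgeSet) : ∃ d : G.Dart, d.edge = e ∧
      (edge e ∈ l → [edge e, dart d.symm] <:+: l ∨ [dart d.symm, edge e] <:+: l) := by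
  by_cases he : edge e ∈ l
  · obtain ⟨y, hy⟩ := exists_infix_of_mem he h2
    have hadj : (graph G).Adj (edge e) y := by
      rcases hy with h | h
      · simpa using hc.infix h
      · simpa [SimpleGraph.adj_comm] using hc.infix h
    obtain ⟨d, hd, rfl⟩ := edge_adj hadj
    exact ⟨d.symm, by simpa using hd, fun _ => by simpa using hy⟩
  · obtain ⟨d, hd⟩ := exists_dart e
    exact ⟨d, hd, fun h => (he h).elim⟩

theorem exists_eq_edgePoint (hG : ∀ v, ∃ w, G.Adj v w) {p : V → ℝ} (hp : p ∈ GraphRealization G) :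
    ∃ (d : G.Dart) (t : ℝ), 0 ≤ t ∧ t < 1 ∧ p = edgePoint d.fst d.snd t := by
  rcases hp with ⟨v, rfl⟩ | ⟨v, w, t, h, ⟨h0, h1⟩, rfl⟩
  · obtain ⟨w, h⟩ := hG v
    exact ⟨⟨(v, w), h⟩, 0, le_rfl, one_pos, (edgePoint_zero _ _).symm⟩
  · rcases h1.lt_or_eq with h1 | rfl
    · exact ⟨⟨(v, w), h⟩, t, h0, h1, rfl⟩
    · exact ⟨⟨(w, v), h.symm⟩, 0, le_rfl, one_pos, by simpa using edgePoint_symm v w 0⟩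

theorem exists_eps {ι : Type*} (S : Finset ι) (t : ι → ℝ) (h0 : ∀ i, 0 ≤ t i) (h1 : ∀ i, t i < 1) :
    ∃ ε : ℝ, 0 < ε ∧ ε ≤ 1 / 4 ∧ ∀ i ∈ S, t i = 0 ∨ 2 * ε ≤ t i ∧ t i ≤ 1 - 2 * ε := by
  have h : ∀ᶠ ε : ℝ in 𝓝[>] 0, ∀ i ∈ S, t i = 0 ∨ 2 * ε ≤ t i ∧ t i ≤ 1 - 2 * ε := by
    refine (Filter.eventually_all_finset S).2 fun i _ => ?_
    rcases (h0 i).eq_or_lt with h | h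
    · exact Filter.Eventually.of_forall fun _ => Or.inl h.symm
    · filter_upwards [Ioo_mem_nhdsGT (half_pos h), Ioo_mem_nhdsGT (half_pos (sub_pos.2 (h1 i)))]
        with ε h2 h3
      exact Or.inr ⟨by linarith [h2.2], by linarith [h3.2]⟩
  obtain ⟨ε, hε, hε'⟩ := (h.and (Ioo_mem_nhdsGT (show (0 : ℝ) < 1 / 4 by norm_num))).exists
  exact ⟨ε, hε'.1, hε'.2.le, hε⟩

theorem nArcConn_six (hG : ∀ v, ∃ w, G.Adj v w) [Nonempty V]
    (hE : ∀ E : List G.edgeSet, E.Nodup → E.length ≤ 6 →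
      ∃ l : List (Node G), l.Nodup ∧ l.IsChain (graph G).Adj ∧ (∀ e ∈ E, edge e ∈ l) ∧
        ∀ e ∈ E, ∀ v ∈ (e : Sym2 V), vert v ∈ l) :
    NArcConn ↥(GraphRealization G) 6 := by
  classical
  intro S hS
  wlog hne : S.Nonempty generalizing S
  · obtain rfl := Finset.not_nonempty_iff_eq_empty.1 hne
    obtain ⟨A, hA, -⟩ := this {⟨vertexPoint (Classical.arbitrary V), Or.inl ⟨_, rfl⟩⟩} (by simp)
      (Finset.singleton_nonempty _)
    exact ⟨A, hA, by simp⟩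
  choose d t h0 h1 hp using fun p : ↥(GraphRealization G) => exists_eq_edgePoint hG p.2
  obtain ⟨ε, hε, hε', hS'⟩ := exists_eps S t h0 h1
  let ed : ↥(GraphRealization G) → G.edgeSet := fun p => ⟨(d p).edge, (d p).edge_mem⟩
  obtain ⟨l, hl, hc, hle, hlv⟩ := hE (S.image ed).toList (Finset.nodup_toList _)
    (by rw [Finset.length_toList]; exact Finset.card_image_le.trans hS)
  replace hle : ∀ p ∈ S, edge (ed p) ∈ l := fun p hp => hle _ (by simpa using ⟨p.1, p.2, hp, rfl⟩)
  replace hlv : ∀ p ∈ S, vert (d p).fst ∈ l := fun p hp => hlv (ed p)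
    (by simpa using ⟨p.1, p.2, hp, rfl⟩) _ (by simp [ed, SimpleGraph.Dart.edge])
  have h2 : 2 ≤ l.length := by
    obtain ⟨p, hp⟩ := hne
    exact length_le_of_subset (l := [edge (ed p), vert (d p).fst]) (by simp)
      (by simp [hle p hp, hlv p hp])
  choose o ho hol using exists_orientation hc h2
  obtain ⟨A, hA, hAt⟩ := exists_isArc_of_chain hε hε' ho hl hc h2
  refine ⟨A, hA, fun p hpS => (hAt p).2 ?_⟩
  rw [hp p]
  rcases hS' p hpS with ht | ⟨h2t, ht2⟩
  · rw [ht, edgePoint_zero]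
    obtain ⟨y, h | h⟩ := exists_infix_of_mem (hlv p hpS) h2
    · exact ⟨_, _, h, mem_track_of_adj_vert hε.le (by simpa using hc.infix h)⟩
    · refine ⟨_, _, h, ?_⟩
      rw [track_symm]
      exact mem_track_of_adj_vert hε.le (by simpa [SimpleGraph.adj_comm] using hc.infix h)
  · have hoe : (o (ed p)).symm.edge = (d p).edge := by simpa using ho (ed p)
    have hmem := mem_track_of_edge (o := o) hε hoe (by
      rw [show (⟨_, (o (ed p)).symm.edge_mem⟩ : G.edgeSet) = ed p from Subtype.ext hoe]
      exact (o (ed p)).symm_ne.symm) h2t ht2 (ed p)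
    rcases hol (ed p) (hle p hpS) with h | h
    · exact ⟨_, _, h, track_symm (ε := ε) (o := o) _ _ ▸ hmem⟩
    · exact ⟨_, _, h, hmem⟩

end Node

end Skeleton

/-- If `G` is a simple 3-regular, 3-connected graph in which no set of 6
edges disconnects `G` into 4 or more components, then `|G|` is 6-arc connected. -/
theorem statement14 {V : Type*} (G : SimpleGraph V)
    (hreg : ∀ v : V, (G.neighborSet v).encard = 3)
    (hconn : KConnected G 3)
    (hcut : ¬ ∃ F : Set (Sym2 V), F ⊆ G.edgeSet ∧ F.encard = 6 ∧
        ∃ f : Fin 4 → (G.deleteEdges F).ConnectedComponent, Function.Injective f) :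
    NArcConn ↥(GraphRealization G) 6 := by
  have hnbr : ∀ v, ∃ w, G.Adj v w := fun v =>
    Set.nonempty_of_encard_ne_zero (s := G.neighborSet v) (by simp [hreg v])
  have : Nonempty V := by
    obtain ⟨v⟩ := (hconn ∅ (by simp)).nonempty
    exact ⟨v⟩
  exact Skeleton.Node.nArcConn_six hnbr fun E hE hlen => Skeleton.Node.exists_chain_of_edges
    (Skeleton.good_start (Skeleton.Node.net hreg hconn hcut)) hE hlen
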